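/- Let F be a finite extension of Q_p with p ≠ 2 equipped with a nonidentity involution a ↦ ā, and let F∘ be the fixed field of the involution. Each pair of Hermitian matrices of the same size over F is *congruent to a direct sum, uniquely determined up to permutation of summands, consisting of any number of summands of the following types: (i) ([F_n ⟍ F_n*], [G_n ⟍ G_n*]); (ii) ([I_n ⟍ I_n], [Φ ⟍ Φ*]), where Φ is an n×n Frobenius block with p_Φ(x) ∉ F∘[x], determined up to replacement by the Frobenius block Ψ with χ_Ψ(x) = χ̄_Φ(x) (coefficientwise conjugation); (iii) for each Frobenius block Φ over F with p_Φ(x) ∈ F∘[x]: any number of summands (Φ₁, Φ₁Φ) and at most one summand equal to (Φ₁, Φ₁Φ)π̃(Φ) if K = K∘(√ũ) and to (Φ₁, Φ₁Φ)ũ(Φ) if K = K∘(√π̃) or K = K∘(√(ũπ̃)); here K := F[x]/p_Φ(x)F[x] with involution f(ω)° := f̄(ω) (ω the class of x), K∘ is its fixed field, π̃ is a prime element of K∘, ũ is a unit of the ring of integers of K∘ that is not a square in K∘, and π̃(x), ũ(x) are polynomials over F∘ of degree < deg p_Φ(x) with π̃(ω) = π̃ and ũ(ω) = ũ; (iv)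 for each n = 1,2,…: any number of summands B_n and at most one summand equal to B_nπ if F = F∘(√u) and to B_nu if F = F∘(√π) or F = F∘(√(uπ)), where π is a prime element of F∘ and u is a unit of the ring of integers of F∘ that is not a square in F∘. -/

import Mathlib

open Polynomial Matrix

namespace Can

noncomputable section

abbrev Mat (F : Type*) (n : ℕ) := Matrix (Fin n) (Fin n) F

variable {F : Type*} [Field F]

/-- conjugate transpose w.r.t. an involution σ -/
def ctr (σ : F →+* F) {m n : ℕ} (A : Matrix (Fin m) (Fin n) F) : Matrix (Fin n) (Fin m) F :=
  (A.map σ)ᵀ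

/-- congruence: SᵀAS = B for a nonsingular S -/
def Congruent {n : ℕ} (A B : Mat F n) : Prop :=
  ∃ S : Mat F n, IsUnit S.det ∧ Sᵀ * A * S = B

/-- *congruence: S*AS = B for a nonsingular S -/
def StarCongruent (σ : F →+* F) {n : ℕ} (A B : Mat F n) : Prop :=
  ∃ S : Mat F n, IsUnit S.det ∧ ctr σ S * A * S = B

/-- a square-matrix "summand" of unspecified size -/
abbrev Block (F : Type*) := Σ n : ℕ, Mat F n

def castMat {m n : ℕ} (h : m = n) (A : Mat F m) : Mat F n :=
  Matrix.reindex (finCongr h) (finCongr h) A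

def BCong (X Y : Block F) : Prop :=
  ∃ h : X.1 = Y.1, Congruent (castMat h X.2) Y.2

def BStarCong (σ : F →+* F) (X Y : Block F) : Prop :=
  ∃ h : X.1 = Y.1, StarCongruent σ (castMat h X.2) Y.2

/-- direct sum of a list of blocks -/
def bsum : List (Block F) → Block F
  | [] => ⟨0, 0⟩
  | X :: L => ⟨X.1 + (bsum L).1,
      Matrix.reindex finSumFinEquiv finSumFinEquiv (Matrix.fromBlocks X.2 0 0 (bsum L).2)⟩

/-- pairs of square matrices of the same size -/
abbrev PBlock (F : Type*) := Σ n : ℕ, Mat F n × Mat F n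

def PCong (X Y : PBlock F) : Prop :=
  ∃ h : X.1 = Y.1, ∃ S : Mat F Y.1, IsUnit S.det ∧
    Sᵀ * castMat h X.2.1 * S = Y.2.1 ∧ Sᵀ * castMat h X.2.2 * S = Y.2.2

def PStarCong (σ : F →+* F) (X Y : PBlock F) : Prop :=
  ∃ h : X.1 = Y.1, ∃ S : Mat F Y.1, IsUnit S.det ∧
    ctr σ S * castMat h X.2.1 * S = Y.2.1 ∧ ctr σ S * castMat h X.2.2 * S = Y.2.2

def psum : List (PBlock F) → PBlock F
  | [] => ⟨0, (0, 0)⟩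
  | X :: L =>
      ⟨X.1 + (psum L).1,
        (Matrix.reindex finSumFinEquiv finSumFinEquiv (Matrix.fromBlocks X.2.1 0 0 (psum L).2.1),
         Matrix.reindex finSumFinEquiv finSumFinEquiv (Matrix.fromBlocks X.2.2 0 0 (psum L).2.2))⟩

/-- lower-triangular Jordan block -/
def J (F : Type*) [Field F] (n : ℕ) (lam : F) : Mat F n :=
  Matrix.of fun i j => if i = j then lam else if (i : ℕ) = (j : ℕ) + 1 then 1 else 0

/-- the companion (Frobenius) matrix of a polynomial -/
def companion (F : Type*) [Field F] (f : Polynomial F) : Mat F f.natDegree :=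
  Matrix.of fun i j => if (i : ℕ) = (j : ℕ) + 1 then 1
    else if (j : ℕ) + 1 = f.natDegree then -f.coeff i else 0

/-- f ↦ f^∨ (with respect to the involution σ) -/
def dualPoly (σ : F →+* F) (f : Polynomial F) : Polynomial F :=
  Polynomial.C (σ (f.coeff 0))⁻¹ * (f.map σ).reverse

/-- the skew sum [A ⟍ B] = [[0, B], [A, 0]] -/
def skewSum {k l : ℕ} (A : Matrix (Fin k) (Fin l) F) (B : Matrix (Fin l) (Fin k) F) :
    Mat F (l + k) :=
  Matrix.reindex finSumFinEquiv finSumFinEquiv (Matrix.fromBlocks 0 B A 0)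

/-- the matrix Γₙ -/
def Gamma (F : Type*) [Field F] (n : ℕ) : Mat F n :=
  Matrix.of fun i j =>
    if (i : ℕ) + (j : ℕ) + 1 = n ∨ (i : ℕ) + (j : ℕ) = n then (-1 : F) ^ (n - 1 - (i : ℕ)) else 0

/-- Fₙ = [I | 0], an (n−1)×n matrix -/
def Fmat (F : Type*) [Field F] (n : ℕ) : Matrix (Fin (n - 1)) (Fin n) F :=
  Matrix.of fun i j => if (i : ℕ) = (j : ℕ) then 1 else 0

/-- Gₙ = [0 | I], an (n−1)×n matrix -/
def Gmat (F : Type*) [Field F] (n : ℕ) : Matrix (Fin (n - 1)) (Fin n) F :=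
  Matrix.of fun i j => if (i : ℕ) + 1 = (j : ℕ) then 1 else 0

/-- the pair Bₙ of symmetric n×n matrices -/
def Bpair (F : Type*) [Field F] (n : ℕ) : Mat F n × Mat F n :=
  (Matrix.of fun i j => if (i : ℕ) + (j : ℕ) + 2 = n then 1 else 0,
   Matrix.of fun i j => if (i : ℕ) + (j : ℕ) + 1 = n then 1 else 0)

/-- the pair Cₙ of a symmetric and a skew-symmetric n×n matrix -/
def Cpair (F : Type*) [Field F] (n : ℕ) : Mat F n × Mat F n :=
  if Odd n then
    (Matrix.of fun i j => if (i : ℕ) + (j : ℕ) + 1 = n then 1 else 0,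
     Matrix.of fun i j =>
       if (i : ℕ) + (j : ℕ) + 2 = n ∧ i < j then 1
       else if (i : ℕ) + (j : ℕ) + 2 = n ∧ j < i then -1 else 0)
  else
    (Matrix.of fun i j => if (i : ℕ) + (j : ℕ) + 2 = n then 1 else 0,
     Matrix.of fun i j =>
       if (i : ℕ) + (j : ℕ) + 1 = n ∧ i < j then 1
       else if (i : ℕ) + (j : ℕ) + 1 = n ∧ j < i then -1 else 0)

/-- at most one entry of the list satisfies P -/
def AtMostOne {α : Type*} (P : α → Prop) (L : List α) : Prop :=
  ¬ ∃ b₁ b₂ : α, List.Sublist [b₁, b₂] L ∧ P b₁ ∧ P b₂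


section PadicCore

variable (p : ℕ) [Fact p.Prime]

/-- ν is the (unique) extension to K of the exponential valuation of ℚ_p -/
def IsExpValuation (K : Type*) [Field K] [Algebra ℚ_[p] K] (ν : K → ℚ) : Prop :=
  (∀ a b : K, a ≠ 0 → b ≠ 0 → ν (a * b) = ν a + ν b) ∧
  (∀ a b : K, a ≠ 0 → b ≠ 0 → a + b ≠ 0 → min (ν a) (ν b) ≤ ν (a + b)) ∧
  (∀ x : ℚ_[p], x ≠ 0 → ν (algebraMap ℚ_[p] K x) = (x.valuation : ℚ))

variable {K : Type*} [CommRing K]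

/-- a member of the ring of integers O(K) = {a : ν(a) ≥ 0} -/
def IsIntegerElem (ν : K → ℚ) (a : K) : Prop := a = 0 ∨ 0 ≤ ν a

/-- a unit of the ring of integers: an element of valuation 0 -/
def IsUnitElem (ν : K → ℚ) (a : K) : Prop := a ≠ 0 ∧ ν a = 0

/-- a prime element: a generator of the maximal ideal of O(K), i.e. an element of the
smallest positive valuation -/
def IsPrimeElem (ν : K → ℚ) (π : K) : Prop :=
  π ≠ 0 ∧ 0 < ν π ∧ ∀ a : K, a ≠ 0 → 0 < ν a → ν π ≤ ν a

/-- congruence modulo the maximal ideal of O(K) -/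
def ResEq (ν : K → ℚ) (a b : K) : Prop := a = b ∨ 0 < ν (a - b)

/-- the residue field O(K)/𝔪 has exactly q elements -/
def ResidueCard (ν : K → ℚ) (q : ℕ) : Prop :=
  ∃ S : Finset K, S.card = q ∧ (∀ a ∈ S, IsIntegerElem ν a) ∧
    (∀ a ∈ S, ∀ b ∈ S, a ≠ b → ¬ ResEq ν a b) ∧
    (∀ a : K, IsIntegerElem ν a → ∃ b ∈ S, ResEq ν a b)

end PadicCore

section Laurent
variable {F : Type*} [Field F] (σ : F →+* F)

/-- the value q(Φ) of the Laurent function q(x) = a_r x^r + ⋯ + a₀ + ⋯ + ā_r x⁻ʳ at a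
nonsingular matrix Φ -/
def lvalM {N : ℕ} (Φ : Mat F N) (r : ℕ) (a : ℕ → F) : Mat F N :=
  a 0 • (1 : Mat F N) + ∑ i ∈ Finset.Icc 1 r, (a i • Φ ^ i + σ (a i) • Φ⁻¹ ^ i)

/-- the value q(κ) ∈ K = F[x]/(p) of the Laurent function, where κ⁻¹ = κ° is given by the
involution τ -/
def lvalK (pp : Polynomial F) (τ : AdjoinRoot pp ≃+* AdjoinRoot pp) (r : ℕ) (a : ℕ → F) :
    AdjoinRoot pp :=
  algebraMap F (AdjoinRoot pp) (a 0) + ∑ i ∈ Finset.Icc 1 r,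
    (algebraMap F (AdjoinRoot pp) (a i) * (AdjoinRoot.root pp) ^ i +
     algebraMap F (AdjoinRoot pp) (σ (a i)) * (τ (AdjoinRoot.root pp)) ^ i)

/-- the summand [Φ ⟍ Iₙ] attached to the characteristic polynomial χ of Φ -/
def skewIB (χ : Polynomial F) : Block F :=
  ⟨χ.natDegree + χ.natDegree, skewSum (companion F χ) (1 : Mat F χ.natDegree)⟩

end Laurent

section Stmt9
variable {F : Type*} [Field F] (σ : F →+* F)

/-- the pair ([Iₙ ⟍ Iₙ], [Φ ⟍ Φ*]) attached to the characteristic polynomial χ of Φ -/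
def pairStar9 (χ : Polynomial F) : PBlock F :=
  ⟨χ.natDegree + χ.natDegree,
    (skewSum (1 : Mat F χ.natDegree) (1 : Mat F χ.natDegree),
     skewSum (companion F χ) (ctr σ (companion F χ)))⟩

/-- type (i): ([Fₙ ⟍ Fₙ*], [Gₙ ⟍ Gₙ*]) -/
def T9i (b : PBlock F) : Prop :=
  ∃ n : ℕ, 0 < n ∧
    b = ⟨n + (n - 1), (skewSum (Fmat F n) (ctr σ (Fmat F n)),
                       skewSum (Gmat F n) (ctr σ (Gmat F n)))⟩

/-- type (ii): ([Iₙ ⟍ Iₙ], [Φ ⟍ Φ*]), p_Φ ∉ F∘[x] -/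
def T9ii (b : PBlock F) : Prop :=
  ∃ (pp : Polynomial F) (l : ℕ), pp.Monic ∧ Irreducible pp ∧ 0 < l ∧
    (¬ ∀ k : ℕ, σ (pp.coeff k) = pp.coeff k) ∧
    b = pairStar9 σ (pp ^ l)

/-- type (iii), first kind: (Φ₁, Φ₁Φ), p_Φ ∈ F∘[x] -/
def T9iiia (Phi1 : (q : Polynomial F) → Mat F q.natDegree) (b : PBlock F) : Prop :=
  ∃ (pp : Polynomial F) (l : ℕ), pp.Monic ∧ Irreducible pp ∧ 0 < l ∧
    (∀ k : ℕ, σ (pp.coeff k) = pp.coeff k) ∧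
    b = ⟨(pp ^ l).natDegree, (Phi1 (pp ^ l), Phi1 (pp ^ l) * companion F (pp ^ l))⟩

/-- type (iii), second kind: (Φ₁,Φ₁Φ)π̃(Φ) if K = K∘(√ũ), and (Φ₁,Φ₁Φ)ũ(Φ) if
K = K∘(√π̃) or K = K∘(√(ũπ̃)); here π̃(x), ũ(x) are polynomials over F∘ of degree
< deg p_Φ representing π̃, ũ ∈ K∘ ⊆ K = F[x]/(p_Φ) -/
def T9iiib (Phi1 : (q : Polynomial F) → Mat F q.natDegree)
    (πK uK : (pp : Polynomial F) → AdjoinRoot pp)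
    (pp : Polynomial F) (l : ℕ) (b : PBlock F) : Prop :=
  pp.Monic ∧ Irreducible pp ∧ 0 < l ∧ (∀ k : ℕ, σ (pp.coeff k) = pp.coeff k) ∧
  ∃ t : AdjoinRoot pp,
    (((∃ w : AdjoinRoot pp, w ^ 2 = uK pp) ∧ t = πK pp) ∨
     (((∃ w : AdjoinRoot pp, w ^ 2 = πK pp) ∨
       (∃ w : AdjoinRoot pp, w ^ 2 = uK pp * πK pp)) ∧ t = uK pp)) ∧
    ∃ f : Polynomial F, f.degree < pp.degree ∧ (∀ k : ℕ, σ (f.coeff k) = f.coeff k) ∧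
      AdjoinRoot.mk pp f = t ∧
      b = ⟨(pp ^ l).natDegree,
        (Phi1 (pp ^ l) * Polynomial.aeval (companion F (pp ^ l)) f,
         Phi1 (pp ^ l) * companion F (pp ^ l) * Polynomial.aeval (companion F (pp ^ l)) f)⟩

/-- type (iv), first kind: Bₙ -/
def T9iva (b : PBlock F) : Prop := ∃ n : ℕ, 0 < n ∧ b = ⟨n, Bpair F n⟩

/-- type (iv), second kind: Bₙπ if F = F∘(√u), Bₙu if F = F∘(√π) or F = F∘(√(uπ)) -/
def T9ivb (uF πF : F) (n : ℕ) (b : PBlock F) : Prop :=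
  0 < n ∧ ∃ t : F,
    (((∃ w : F, w ^ 2 = uF) ∧ t = πF) ∨
     (((∃ w : F, w ^ 2 = πF) ∨ (∃ w : F, w ^ 2 = uF * πF)) ∧ t = uF)) ∧
    b = ⟨n, (t • (Bpair F n).1, t • (Bpair F n).2)⟩

def Canon9 (uF πF : F) (Phi1 : (q : Polynomial F) → Mat F q.natDegree)
    (πK uK : (pp : Polynomial F) → AdjoinRoot pp) (L : List (PBlock F)) : Prop :=
  (∀ b ∈ L, T9i σ b ∨ T9ii σ b ∨ T9iiia σ Phi1 b ∨
      (∃ pp l, T9iiib σ Phi1 πK uK pp l b) ∨ T9iva b ∨ ∃ n, T9ivb uF πF n b) ∧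
  (∀ (pp : Polynomial F) (l : ℕ), AtMostOne (T9iiib σ Phi1 πK uK pp l) L) ∧
  (∀ n : ℕ, AtMostOne (T9ivb uF πF n) L)

/-- a type (ii) summand may be replaced by the one with χ_Ψ = χ̄_Φ -/
def Equiv9 (b c : PBlock F) : Prop :=
  b = c ∨
  ∃ (pp : Polynomial F) (l : ℕ), pp.Monic ∧ Irreducible pp ∧ 0 < l ∧
    (¬ ∀ k : ℕ, σ (pp.coeff k) = pp.coeff k) ∧
    b = pairStar9 σ (pp ^ l) ∧ c = pairStar9 σ ((pp ^ l).map σ)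

end Stmt9

set_option linter.unusedSectionVars false

section LocalField

variable {K : Type*} [NormedField K] [IsUltrametricDist K] [ProperSpace K]

lemma norm_add_lt_one {a b : K} (ha : ‖a‖ < 1) (hb : ‖b‖ < 1) : ‖a + b‖ < 1 :=
  (IsUltrametricDist.norm_add_le_max a b).trans_lt (max_lt ha hb)

lemma norm_add_le_one {a b : K} (ha : ‖a‖ ≤ 1) (hb : ‖b‖ ≤ 1) : ‖a + b‖ ≤ 1 :=
  (IsUltrametricDist.norm_add_le_max a b).trans (max_le ha hb)

lemma norm_eq_one_of_near {a b : K} (ha : ‖a‖ = 1) (hab : ‖b - a‖ < 1) : ‖b‖ = 1 := by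
  have := IsUltrametricDist.norm_add_eq_max_of_norm_ne_norm (x := a) (y := b - a)
    (by rw [ha]; exact hab.ne')
  rw [add_sub_cancel, ha, max_eq_left hab.le] at this
  exact this

/-- Hensel's lemma for square roots of principal units. -/
lemma exists_sqrt_near_one (h2 : ‖(2 : K)‖ = 1) {c : K} (hc : ‖c - 1‖ < 1) :
    ∃ w : K, ‖w - 1‖ < 1 ∧ w ^ 2 = c := by
  have h20 : (2 : K) ≠ 0 := by intro h; rw [h, norm_zero] at h2; exact zero_ne_one h2
  set s : Set K := Metric.closedBall 1 ‖c - 1‖ with hs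
  let f : K → K := fun y => y - (y ^ 2 - c) / 2
  have hmem : ∀ y, y ∈ s ↔ ‖y - 1‖ ≤ ‖c - 1‖ := fun y => by
    rw [hs, Metric.mem_closedBall, dist_eq_norm]
  have hdiff : ∀ y ∈ s, ∀ z ∈ s, ‖f y - f z‖ ≤ ‖c - 1‖ * ‖y - z‖ := by
    intro y hy z hz
    have h : f y - f z = ((1 - y) + (1 - z)) / 2 * (y - z) := by
      simp only [f]; field_simp; ring
    rw [h, norm_mul, norm_div, h2, div_one]
    refine mul_le_mul_of_nonneg_right ?_ (norm_nonneg _)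
    refine (IsUltrametricDist.norm_add_le_max _ _).trans (max_le ?_ ?_)
    · rw [norm_sub_rev]; exact (hmem y).1 hy
    · rw [norm_sub_rev]; exact (hmem z).1 hz
  have h1s : (1 : K) ∈ s := by rw [hmem]; simp
  have hmaps : Set.MapsTo f s s := by
    intro y hy
    rw [hmem]
    have h1 : ‖f 1 - 1‖ = ‖c - 1‖ := by
      have : f 1 - 1 = (c - 1) / 2 := by simp only [f]; ring
      rw [this, norm_div, h2, div_one]
    have : f y - 1 = (f y - f 1) + (f 1 - 1) := by ring
    rw [this]
    refine (IsUltrametricDist.norm_add_le_max _ _).trans (max_le ?_ h1.le)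
    refine (hdiff y hy 1 h1s).trans ?_
    have := (hmem y).1 hy
    calc ‖c - 1‖ * ‖y - 1‖ ≤ 1 * ‖c - 1‖ :=
          mul_le_mul hc.le this (norm_nonneg _) zero_le_one
      _ = _ := one_mul _
  have hcon : ContractingWith ⟨‖c - 1‖, norm_nonneg _⟩ (hmaps.restrict f s s) := by
    refine ⟨by exact_mod_cast hc, LipschitzWith.of_dist_le_mul ?_⟩
    rintro ⟨y, hy⟩ ⟨z, hz⟩
    have := hdiff y hy z hz
    simp only [Subtype.dist_eq, dist_eq_norm]
    exact this
  obtain ⟨w, hw, hfix, -⟩ := hcon.exists_fixedPoint' (Metric.isClosed_closedBall.isComplete)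
    hmaps h1s (edist_ne_top _ _)
  refine ⟨w, lt_of_le_of_lt ((hmem w).1 hw) hc, ?_⟩
  have h3 : w - (w ^ 2 - c) / 2 = w := hfix
  have h4 : (w ^ 2 - c) / 2 = 0 := by linear_combination -h3
  rw [div_eq_zero_iff] at h4
  rcases h4 with h | h
  · exact sub_eq_zero.1 h
  · exact absurd h h20

lemma exists_pow_root_near_one (h2 : ‖(2 : K)‖ = 1) {c : K} (hc : ‖c - 1‖ < 1) (j : ℕ) :
    ∃ w : K, ‖w - 1‖ < 1 ∧ w ^ (2 ^ j) = c := by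
  induction j with
  | zero => exact ⟨c, hc, by simp⟩
  | succ j ih =>
    obtain ⟨w, hw, hwc⟩ := ih
    obtain ⟨v, hv, hvw⟩ := exists_sqrt_near_one h2 hw
    exact ⟨v, hv, by rw [pow_succ', pow_mul, hvw, hwc]⟩

variable (τ : K →+* K) (hτ : ∀ a, τ (τ a) = a)

/-- `π` generates the value group of the field fixed by `τ` and lies in the maximal ideal. -/
def IsFixedPrime (π : K) : Prop :=
  τ π = π ∧ π ≠ 0 ∧ ‖π‖ < 1 ∧ ∀ a, τ a = a → ‖a‖ < 1 → ‖a‖ ≤ ‖π‖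

/-- `u` is a unit of norm one of the field fixed by `τ` which is not a square there. -/
def IsFixedNonsquareUnit (u : K) : Prop :=
  τ u = u ∧ ‖u‖ = 1 ∧ ¬ ∃ w : K, τ w = w ∧ w ^ 2 = u

variable {τ} {π u : K}

omit [IsUltrametricDist K] [ProperSpace K] in
lemma IsFixedPrime.exists_zpow (hπ : IsFixedPrime τ π) {c : K} (hc : τ c = c) (h0 : c ≠ 0) :
    ∃ k : ℤ, ‖c * π ^ (-k)‖ = 1 := by
  obtain ⟨hπ1, hπ0, hπ2, hπ3⟩ := hπ
  have hpos : 0 < ‖π‖ := norm_pos_iff.2 hπ0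
  obtain ⟨k, hk1, hk2⟩ := exists_mem_Ico_zpow (x := ‖c‖) (y := ‖π‖⁻¹) (norm_pos_iff.2 h0)
    ((one_lt_inv₀ hpos).2 hπ2)
  refine ⟨-k, ?_⟩
  have hfix : τ (c * π ^ (k + 1)) = c * π ^ (k + 1) := by
    rw [map_mul, map_zpow₀, hc, hπ1]
  rw [_root_.inv_zpow', _root_.zpow_neg] at hk1 hk2
  have hp1 : 0 < ‖π‖ ^ (k + 1) := zpow_pos hpos _
  have hp0 : 0 < ‖π‖ ^ k := zpow_pos hpos _
  have hlt : ‖c * π ^ (k + 1)‖ < 1 := by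
    rw [norm_mul, norm_zpow]
    calc ‖c‖ * ‖π‖ ^ (k + 1) < (‖π‖ ^ (k + 1))⁻¹ * ‖π‖ ^ (k + 1) :=
          mul_lt_mul_of_pos_right hk2 hp1
      _ = 1 := inv_mul_cancel₀ hp1.ne'
  have hle := hπ3 _ hfix hlt
  rw [neg_neg, norm_mul, norm_zpow]
  rw [norm_mul, norm_zpow, zpow_add_one₀ hpos.ne', ← mul_assoc] at hle
  have h1 : ‖c‖ * ‖π‖ ^ k ≤ 1 := by
    have := (mul_le_iff_le_one_left hpos).1 hle
    exact this
  refine le_antisymm h1 ?_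
  calc 1 = (‖π‖ ^ k)⁻¹ * ‖π‖ ^ k := (inv_mul_cancel₀ hp0.ne').symm
    _ ≤ ‖c‖ * ‖π‖ ^ k := mul_le_mul_of_nonneg_right hk1 hp0.le

include hτ in
lemma norm_map_eq_one_of_near_one (h2 : ‖(2 : K)‖ = 1) (hπ : IsFixedPrime τ π) {a : K}
    (ha : ‖a - 1‖ < 1) : ‖τ a‖ = 1 := by
  have hpos : 0 < ‖π‖ := norm_pos_iff.2 hπ.2.1
  have key : ∀ b : K, ‖b - 1‖ < 1 → ∃ k : ℤ, ‖τ b‖ = ‖π‖ ^ k := by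
    intro b hb
    have hb1 : ‖b‖ = 1 := norm_eq_one_of_near norm_one hb
    have hb0 : b ≠ 0 := by intro h; simp [h] at hb1
    have hτb : τ b ≠ 0 := (map_ne_zero τ).2 hb0
    obtain ⟨k, hk⟩ := hπ.exists_zpow (c := b * τ b) (by rw [map_mul, hτ, mul_comm])
      (mul_ne_zero hb0 hτb)
    refine ⟨k, ?_⟩
    rw [norm_mul, norm_mul, hb1, one_mul, norm_zpow, _root_.zpow_neg] at hk
    have : ‖π‖ ^ k ≠ 0 := (zpow_pos hpos k).ne'
    field_simp at hk
    exact hk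
  obtain ⟨k, hk⟩ := key a ha
  have hdvd : ∀ j : ℕ, (2 : ℤ) ^ j ∣ k := by
    intro j
    obtain ⟨w, hw, hwa⟩ := exists_pow_root_near_one h2 ha j
    obtain ⟨m, hm⟩ := key w hw
    refine ⟨m, ?_⟩
    have : ‖π‖ ^ k = ‖π‖ ^ (2 ^ j * m) := by
      rw [← hk, ← hwa, map_pow, norm_pow, hm, mul_comm, _root_.zpow_mul, ← zpow_natCast]
      norm_cast
    exact zpow_right_injective₀ hpos hπ.2.2.1.ne this
  have hk0 : k = 0 := by
    by_contra h
    have h1 := Int.le_of_dvd (abs_pos.2 h) ((dvd_abs _ _).2 (hdvd k.natAbs))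
    have h2 : k.natAbs < 2 ^ k.natAbs := Nat.lt_two_pow_self
    rw [Int.abs_eq_natAbs] at h1
    have : ((2 ^ k.natAbs : ℕ) : ℤ) ≤ (k.natAbs : ℤ) := by exact_mod_cast h1
    omega
  rw [hk, hk0, zpow_zero]

include hτ in
/-- Principal units fixed by the involution are squares of fixed elements. -/
lemma exists_fixed_sqrt {p : ℕ} (hodd : Odd p) (hp : ‖(p : K)‖ < 1)
    (h2 : ‖(2 : K)‖ = 1) (hπ : IsFixedPrime τ π) {c : K} (hc : τ c = c) (hc1 : ‖c - 1‖ < 1) :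
    ∃ w : K, τ w = w ∧ w ^ 2 = c := by
  obtain ⟨w, hw, hwc⟩ := exists_sqrt_near_one h2 hc1
  have : (τ w - w) * (τ w + w) = 0 := by
    have : τ w ^ 2 = w ^ 2 := by rw [← map_pow, hwc, hc]
    linear_combination this
  rcases mul_eq_zero.1 this with h | h
  · exact ⟨w, sub_eq_zero.1 h, hwc⟩
  exfalso
  obtain ⟨k, hk⟩ := hodd
  have hk' : (p : K) = 2 * k + 1 := by rw [hk]; push_cast; ring
  have h_nat : ∀ n : ℕ, ‖(n : K)‖ ≤ 1 := fun n => by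
    exact IsUltrametricDist.norm_natCast_le_one K n
  have hkw : ‖(1 + (k + 1 : K) * (w - 1)) - 1‖ < 1 := by
    rw [add_sub_cancel_left, norm_mul]
    have : ‖(k + 1 : K)‖ ≤ 1 := by have := h_nat (k + 1); push_cast at this; exact this
    calc _ ≤ 1 * ‖w - 1‖ := mul_le_mul_of_nonneg_right this (norm_nonneg _)
      _ < 1 := by rwa [one_mul]
  have h1 := norm_map_eq_one_of_near_one hτ h2 hπ hkw
  have hτw : τ w = -w := by linear_combination h
  have h3 : τ (1 + (k + 1 : K) * (w - 1)) = -(p : K) - (k + 1) * (w - 1) := by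
    simp only [map_add, map_one, map_mul, map_natCast, map_sub, hτw, hk']; ring
  have h4 : ‖-(p : K) - (k + 1) * (w - 1)‖ < 1 := by
    rw [sub_eq_add_neg]
    refine norm_add_lt_one (by rwa [norm_neg]) ?_
    rw [norm_neg]; simpa using hkw
  rw [← h3, h1] at h4
  exact lt_irrefl _ h4

end LocalField

section LocalField

variable {K : Type*} [NormedField K] [IsUltrametricDist K] [ProperSpace K]
variable {τ : K →+* K} (hτ : ∀ a, τ (τ a) = a) {π u : K}

variable (τ) in
/-- The ring of integers of the field fixed by `τ`. -/
def fixedIntegers : Subring K where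
  carrier := {x | τ x = x ∧ ‖x‖ ≤ 1}
  mul_mem' := by
    rintro a b ⟨ha, ha'⟩ ⟨hb, hb'⟩
    exact ⟨by rw [map_mul, ha, hb], by rw [norm_mul]; exact mul_le_one₀ ha' (norm_nonneg _) hb'⟩
  one_mem' := ⟨map_one _, norm_one.le⟩
  add_mem' := by
    rintro a b ⟨ha, ha'⟩ ⟨hb, hb'⟩
    exact ⟨by rw [map_add, ha, hb], norm_add_le_one ha' hb'⟩
  zero_mem' := ⟨map_zero _, by simp⟩
  neg_mem' := by
    rintro a ⟨ha, ha'⟩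
    exact ⟨by rw [map_neg, ha], by rwa [norm_neg]⟩

variable (τ) in
/-- The maximal ideal of the ring of integers of the field fixed by `τ`. -/
def fixedMaxIdeal : Ideal (fixedIntegers τ) where
  carrier := {x | ‖(x : K)‖ < 1}
  add_mem' := fun ha hb => norm_add_lt_one ha hb
  zero_mem' := by simp
  smul_mem' := by
    rintro ⟨c, hc, hc'⟩ ⟨x, hx, hx'⟩ h
    change ‖c * x‖ < 1
    rw [norm_mul]
    change ‖x‖ < 1 at h
    calc ‖c‖ * ‖x‖ ≤ 1 * ‖x‖ := mul_le_mul_of_nonneg_right hc' (norm_nonneg _)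
      _ < 1 := by rwa [one_mul]

lemma mem_fixedMaxIdeal (x : fixedIntegers τ) : x ∈ fixedMaxIdeal τ ↔ ‖(x : K)‖ < 1 := Iff.rfl

instance : (fixedMaxIdeal τ).IsPrime where
  ne_top' := by
    rw [Ideal.ne_top_iff_one, mem_fixedMaxIdeal]
    simp
  mem_or_mem' := by
    rintro ⟨x, hx, hx'⟩ ⟨y, hy, hy'⟩ h
    rw [mem_fixedMaxIdeal] at h ⊢
    rw [mem_fixedMaxIdeal]
    change ‖x * y‖ < 1 at h
    change ‖x‖ < 1 ∨ ‖y‖ < 1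
    by_contra! hcon
    rw [norm_mul] at h
    exact absurd h (not_lt.2 (one_le_mul_of_one_le_of_one_le hcon.1 hcon.2))

instance : Finite (fixedIntegers τ ⧸ fixedMaxIdeal τ) := by
  obtain ⟨t, -, htfin, ht⟩ := (isCompact_closedBall (0 : K) 1).finite_cover_balls one_pos
  have hch : ∀ x : fixedIntegers τ, ∃ s ∈ t, (x : K) ∈ Metric.ball s 1 := by
    rintro ⟨x, hx, hx'⟩
    have : x ∈ Metric.closedBall (0 : K) 1 := by simpa using hx'
    simpa using ht this
  choose g hgt hg using hch
  have : Finite t := htfin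
  refine Finite.of_injective
    (fun q : fixedIntegers τ ⧸ fixedMaxIdeal τ => (⟨g q.out, hgt _⟩ : t)) ?_
  intro q r h
  rw [← Quotient.out_eq' q, ← Quotient.out_eq' r]
  have h' : g q.out = g r.out := congrArg Subtype.val h
  refine Ideal.Quotient.eq.2 ?_
  rw [mem_fixedMaxIdeal]
  have h1 := hg q.out
  have h2 := hg r.out
  rw [Metric.mem_ball, dist_eq_norm] at h1 h2
  rw [h'] at h1
  have : ((q.out - r.out : fixedIntegers τ) : K) = ((q.out : K) - g r.out) + -((r.out : K) - g r.out) := by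
    push_cast; ring
  rw [this]
  exact norm_add_lt_one h1 (by rwa [norm_neg])

/-- The residue field of the field fixed by `τ`. -/
abbrev FixedResidue (τ : K →+* K) := fixedIntegers τ ⧸ fixedMaxIdeal τ

instance : Field (FixedResidue τ) := (Finite.isField_of_domain (FixedResidue τ)).toField

lemma fixedResidue_mk_eq_iff (x y : fixedIntegers τ) :
    (Ideal.Quotient.mk (fixedMaxIdeal τ) x = Ideal.Quotient.mk (fixedMaxIdeal τ) y) ↔
      ‖(x : K) - y‖ < 1 := by
  rw [Ideal.Quotient.eq, mem_fixedMaxIdeal]; rfl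

lemma fixedResidue_ringChar (h2 : ‖(2 : K)‖ = 1) : ringChar (FixedResidue τ) ≠ 2 := by
  intro h
  have h3 : ((2 : ℕ) : FixedResidue τ) = 0 := by
    rw [← h]; exact ringChar.Nat.cast_ringChar
  have h4 : Ideal.Quotient.mk (fixedMaxIdeal τ) 2 = Ideal.Quotient.mk (fixedMaxIdeal τ) 0 := by
    rw [map_zero]; exact_mod_cast h3
  rw [fixedResidue_mk_eq_iff] at h4
  have h5 : ‖(2 : K) - 0‖ < 1 := h4
  have : ‖(2 : K)‖ < 1 := by rwa [sub_zero] at h5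
  exact absurd h2 this.ne

variable {p : ℕ} (hodd : Odd p) (hp : ‖(p : K)‖ < 1) (h2 : ‖(2 : K)‖ = 1)
  (hπ : IsFixedPrime τ π) (hu : IsFixedNonsquareUnit τ u)

include hτ hodd hp h2 hπ in
lemma exists_fixed_ratio {c d : K} (hc : τ c = c) (hd : τ d = d) (hd1 : ‖d‖ = 1)
    (hcd : ‖c - d‖ < 1) : ∃ w, τ w = w ∧ w ^ 2 * d = c := by
  have hd0 : d ≠ 0 := by intro h; simp [h] at hd1
  obtain ⟨w, hw, hwc⟩ := exists_fixed_sqrt hτ hodd hp h2 hπ (c := c / d)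
    (by rw [map_div₀, hc, hd]) (by
      have : c / d - 1 = (c - d) / d := by field_simp
      rw [this, norm_div, hd1, div_one]; exact hcd)
  exact ⟨w, hw, by rw [hwc]; field_simp⟩

include hτ hodd hp h2 hπ hu in
lemma exists_fixed_unit_sq {c : K} (hc : τ c = c) (hc1 : ‖c‖ = 1) :
    ∃ w, τ w = w ∧ (w ^ 2 = c ∨ u * w ^ 2 = c) := by
  classical
  have := Fintype.ofFinite (FixedResidue τ)
  have hchar := fixedResidue_ringChar (τ := τ) h2
  have hsq : ∀ (d : K) (hd : τ d = d) (hd1 : ‖d‖ = 1),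
      IsSquare (Ideal.Quotient.mk (fixedMaxIdeal τ) ⟨d, hd, hd1.le⟩) →
      ∃ w, τ w = w ∧ w ^ 2 = d := by
    rintro d hd hd1 ⟨r, hr⟩
    obtain ⟨⟨x, hx, hx'⟩, rfl⟩ := Ideal.Quotient.mk_surjective r
    rw [← map_mul, fixedResidue_mk_eq_iff] at hr
    change ‖d - x * x‖ < 1 at hr
    have hxx : ‖x * x‖ = 1 := norm_eq_one_of_near hd1 (by rwa [norm_sub_rev])
    obtain ⟨w, hw, h⟩ := exists_fixed_ratio hτ hodd hp h2 hπ hd (by rw [map_mul, hx]) hxx hr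
    exact ⟨w * x, by rw [map_mul, hw, hx], by rw [← h]; ring⟩
  have hne : ∀ (d : K) (hd : τ d = d) (hd1 : ‖d‖ = 1),
      Ideal.Quotient.mk (fixedMaxIdeal τ) ⟨d, hd, hd1.le⟩ ≠ 0 := by
    intro d hd hd1 h
    rw [← map_zero (Ideal.Quotient.mk (fixedMaxIdeal τ)), fixedResidue_mk_eq_iff] at h
    simp [hd1] at h
  by_cases hcs : IsSquare (Ideal.Quotient.mk (fixedMaxIdeal τ) ⟨c, hc, hc1.le⟩)
  · obtain ⟨w, hw, h⟩ := hsq c hc hc1 hcs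
    exact ⟨w, hw, Or.inl h⟩
  have hus : ¬ IsSquare (Ideal.Quotient.mk (fixedMaxIdeal τ) ⟨u, hu.1, hu.2.1.le⟩) :=
    fun h => hu.2.2 (hsq u hu.1 hu.2.1 h)
  have hcu1 : ‖c * u‖ = 1 := by rw [norm_mul, hc1, hu.2.1, one_mul]
  have hcu : τ (c * u) = c * u := by rw [map_mul, hc, hu.1]
  have hprod : IsSquare (Ideal.Quotient.mk (fixedMaxIdeal τ) ⟨c * u, hcu, hcu1.le⟩) := by
    rw [FiniteField.isSquare_iff hchar (hne _ hcu hcu1)]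
    rw [FiniteField.isSquare_iff hchar (hne _ hc hc1)] at hcs
    rw [FiniteField.isSquare_iff hchar (hne _ hu.1 hu.2.1)] at hus
    have h3 := (FiniteField.pow_dichotomy hchar (hne _ hc hc1)).resolve_left hcs
    have h4 := (FiniteField.pow_dichotomy hchar (hne _ hu.1 hu.2.1)).resolve_left hus
    have h5 : Ideal.Quotient.mk (fixedMaxIdeal τ) ⟨c * u, hcu, hcu1.le⟩ =
      Ideal.Quotient.mk (fixedMaxIdeal τ) ⟨c, hc, hc1.le⟩ *
      Ideal.Quotient.mk (fixedMaxIdeal τ) ⟨u, hu.1, hu.2.1.le⟩ := by rw [← map_mul]; rfl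
    rw [h5, mul_pow, h3, h4]; ring
  obtain ⟨w, hw, h⟩ := hsq _ hcu hcu1 hprod
  have hu0 : u ≠ 0 := by intro h; have := hu.2.1; simp [h] at this
  exact ⟨w / u, by rw [map_div₀, hw, hu.1], Or.inr (by rw [div_pow, h]; field_simp)⟩

include hτ hodd hp h2 hπ hu in
lemma exists_fixed_unit_eq_sq_sub :
    ∃ x y, τ x = x ∧ τ y = y ∧ x ^ 2 - u * y ^ 2 = u := by
  classical
  have := Fintype.ofFinite (FixedResidue τ)
  have hchar := fixedResidue_ringChar (τ := τ) h2
  set v := Ideal.Quotient.mk (fixedMaxIdeal τ) ⟨u, hu.1, hu.2.1.le⟩ with hv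
  have hv0 : v ≠ 0 := by
    intro h
    rw [hv, ← map_zero (Ideal.Quotient.mk (fixedMaxIdeal τ)), fixedResidue_mk_eq_iff] at h
    have := hu.2.1
    simp [this] at h
  obtain ⟨a, b, hab⟩ := FiniteField.exists_root_sum_quadratic
    (f := (X ^ 2 : (FixedResidue τ)[X])) (g := C (-v) * X ^ 2 + C 0 * X + C (-v))
    (by simp) (degree_quadratic (neg_ne_zero.2 hv0)) (FiniteField.odd_card_of_char_ne_two hchar)
  simp only [eval_pow, eval_X, eval_add, eval_mul, eval_C, zero_mul, add_zero] at hab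
  obtain ⟨⟨x, hx, hx'⟩, rfl⟩ := Ideal.Quotient.mk_surjective a
  obtain ⟨⟨y, hy, hy'⟩, rfl⟩ := Ideal.Quotient.mk_surjective b
  have hfix : τ (x ^ 2 - u * y ^ 2) = x ^ 2 - u * y ^ 2 := by
    simp only [map_sub, map_mul, map_pow, hx, hy, hu.1]
  have hlt : ‖u - (x ^ 2 - u * y ^ 2)‖ < 1 := by
    have h3 : Ideal.Quotient.mk (fixedMaxIdeal τ) ⟨u, hu.1, hu.2.1.le⟩ =
        Ideal.Quotient.mk (fixedMaxIdeal τ)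
          (⟨x, hx, hx'⟩ ^ 2 - ⟨u, hu.1, hu.2.1.le⟩ * ⟨y, hy, hy'⟩ ^ 2) := by
      simp only [map_sub, map_mul, map_pow]
      linear_combination -hab
    rw [fixedResidue_mk_eq_iff] at h3
    exact h3
  have h1 : ‖x ^ 2 - u * y ^ 2‖ = 1 := norm_eq_one_of_near hu.2.1 (by rwa [norm_sub_rev])
  obtain ⟨w, hw, h⟩ := exists_fixed_ratio hτ hodd hp h2 hπ hu.1 hfix h1 hlt
  exact ⟨w * x, w * y, by rw [map_mul, hw, hx], by rw [map_mul, hw, hy], by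
    linear_combination h⟩

end LocalField

/-- `t` represents the unique class of fixed elements, modulo norms `a * τ a`, of non-norms. -/
structure IsNormRep {K : Type*} [Field K] (τ : K →+* K) (t : K) : Prop where
  fixed : τ t = t
  ne_zero : t ≠ 0
  not_norm : ¬ ∃ a, a * τ a = t
  class_eq : ∀ c, τ c = c → c ≠ 0 → ∃ a, c * (a * τ a) = 1 ∨ c * (a * τ a) = t
  sum_norm : ∃ a b, a * τ a + b * τ b = t

/-- `t` is `π` when `u` is a square in `K`, and `u` when `π` or `u * π` is one. -/
def RepCond {K : Type*} [CommRing K] (u π t : K) : Prop :=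
  ((∃ w : K, w ^ 2 = u) ∧ t = π) ∨
    (((∃ w : K, w ^ 2 = π) ∨ (∃ w : K, w ^ 2 = u * π)) ∧ t = u)

section LocalField

variable {K : Type*} [NormedField K] [IsUltrametricDist K] [ProperSpace K]
variable {τ : K →+* K} (hτ : ∀ a, τ (τ a) = a) {π u : K}
variable {p : ℕ} (hodd : Odd p) (hp : ‖(p : K)‖ < 1) (h2 : ‖(2 : K)‖ = 1)
  (hπ : IsFixedPrime τ π) (hu : IsFixedNonsquareUnit τ u)

include hπ in
lemma IsFixedPrime.norm_sq_ne {y : K} (hy : τ y = y) : ‖y‖ ^ 2 ≠ ‖π‖ := by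
  have hpos : 0 < ‖π‖ := norm_pos_iff.2 hπ.2.1
  intro h
  have hy0 : y ≠ 0 := by rintro rfl; rw [norm_zero] at h; simp at h; exact hpos.ne h
  obtain ⟨k, hk⟩ := hπ.exists_zpow hy hy0
  rw [norm_mul, norm_zpow, _root_.zpow_neg] at hk
  have h1 : ‖y‖ = ‖π‖ ^ k := by
    have : ‖π‖ ^ k ≠ 0 := (zpow_pos hpos k).ne'
    field_simp at hk
    exact hk
  rw [h1, ← zpow_natCast, ← _root_.zpow_mul] at h
  have h3 : k * 2 = 1 := zpow_right_injective₀ hpos hπ.2.2.1.ne (by simpa using h)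
  omega

include hπ in
lemma IsFixedPrime.norm_sq_ne_mul {x y : K} (hx : τ x = x) (hy : τ y = y) (hy0 : y ≠ 0) :
    ‖x‖ ^ 2 ≠ ‖π‖ * ‖y‖ ^ 2 := by
  intro h
  refine hπ.norm_sq_ne (y := x / y) (by rw [map_div₀, hx, hy]) ?_
  have : ‖y‖ ≠ 0 := norm_ne_zero_iff.2 hy0
  rw [norm_div, div_pow, h]
  field_simp

include hτ hodd hp h2 hπ hu in
lemma exists_antifixed (hne : ∃ a, τ a ≠ a) :
    ∃ s, τ s = -s ∧ s ≠ 0 ∧ (s ^ 2 = u ∨ s ^ 2 = π ∨ s ^ 2 = u * π) := by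
  obtain ⟨a, ha⟩ := hne
  have h20 : (2 : K) ≠ 0 := by intro h; simp [h] at h2
  set s := a - τ a with hs
  have hs0 : s ≠ 0 := sub_ne_zero.2 (Ne.symm ha)
  have hτs : τ s = -s := by rw [hs, map_sub, hτ]; ring
  have hfix : τ (s ^ 2) = s ^ 2 := by rw [map_pow, hτs]; ring
  obtain ⟨k, hk⟩ := hπ.exists_zpow hfix (pow_ne_zero 2 hs0)
  obtain ⟨w, hw, h⟩ := exists_fixed_unit_sq hτ hodd hp h2 hπ hu
    (c := s ^ 2 * π ^ (-k)) (by rw [map_mul, hfix, map_zpow₀, hπ.1]) hk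
  have hπ0 := hπ.2.1
  have hu0 : u ≠ 0 := by intro h; have := hu.2.1; simp [h] at this
  have hw0 : w ≠ 0 := by
    rintro rfl
    have h0 : s ^ 2 * π ^ (-k) ≠ 0 := mul_ne_zero (pow_ne_zero 2 hs0) (zpow_ne_zero _ hπ0)
    rcases h with h | h <;> simp at h <;> simp_all
  have hk' : s ^ 2 = (s ^ 2 * π ^ (-k)) * π ^ k := by
    rw [_root_.zpow_neg]; have := zpow_ne_zero k hπ0; field_simp
  have hfin : ∀ m : ℤ, τ (s / (w * π ^ m)) = -(s / (w * π ^ m)) ∧ s / (w * π ^ m) ≠ 0 := by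
    intro m
    refine ⟨?_, div_ne_zero hs0 (mul_ne_zero hw0 (zpow_ne_zero _ hπ0))⟩
    rw [map_div₀, hτs, map_mul, hw, map_zpow₀, hπ.1]; ring
  rcases Int.even_or_odd' k with ⟨m, hm | hm⟩
  · have hpk : π ^ k = (π ^ m) ^ 2 := by rw [hm, mul_comm, _root_.zpow_mul]; norm_cast
    have hm0 := zpow_ne_zero m hπ0
    refine ⟨s / (w * π ^ m), (hfin m).1, (hfin m).2, ?_⟩
    rcases h with h | h
    · exfalso
      have h1 : (s / (w * π ^ m)) ^ 2 = 1 := by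
        rw [div_pow, hk', ← h, hpk]; field_simp
      have h3 := hfin m
      set r := s / (w * π ^ m)
      have h4 : τ r = r := by
        rcases sq_eq_sq_iff_eq_or_eq_neg.1 (h1.trans (one_pow 2).symm) with h | h <;> simp [h]
      rw [h4] at h3
      have : 2 * r = 0 := by linear_combination h3.1
      exact (mul_ne_zero h20 h3.2) this
    · left
      rw [div_pow, hk', ← h, hpk]; field_simp
  · have hpk : π ^ k = (π ^ m) ^ 2 * π := by
      rw [hm, zpow_add_one₀ hπ0, mul_comm 2, _root_.zpow_mul]; norm_cast
    have hm0 := zpow_ne_zero m hπ0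
    refine ⟨s / (w * π ^ m), (hfin m).1, (hfin m).2, ?_⟩
    rcases h with h | h
    · right; left; rw [div_pow, hk', ← h, hpk]; field_simp
    · right; right; rw [div_pow, hk', ← h, hpk]; field_simp

/-- If every fixed element is, up to norms, `1` or the non-norm `t`, then `t` is a sum of two
norms. -/
lemma exists_sum_norm_eq (hτ : ∀ a, τ (τ a) = a) (hodd : Odd p) (hp : ‖(p : K)‖ < 1)
    (h2 : ‖(2 : K)‖ = 1) (hπ : IsFixedPrime τ π) {t : K} (ht : τ t = t)
    (hnot : ¬ ∃ a, a * τ a = t)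
    (hclass : ∀ c, τ c = c → c ≠ 0 → ∃ a, c * (a * τ a) = 1 ∨ c * (a * τ a) = t) :
    ∃ a b, a * τ a + b * τ b = t := by
  by_contra! hno
  have h20 : (2 : K) ≠ 0 := by intro h; simp [h] at h2
  have hadd : ∀ c d, (∃ a, a * τ a = c) → (∃ a, a * τ a = d) → ∃ a, a * τ a = c + d := by
    rintro _ _ ⟨a, rfl⟩ ⟨b, rfl⟩
    by_cases h0 : a * τ a + b * τ b = 0
    · exact ⟨0, by rw [h0, zero_mul]⟩
    obtain ⟨c, hc | hc⟩ := hclass (a * τ a + b * τ b)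
      (by simp only [map_add, map_mul, hτ]; ring) h0
    · have hc0 : c * τ c ≠ 0 := by intro h; simp [h] at hc
      refine ⟨c⁻¹, ?_⟩
      rw [map_inv₀, ← mul_inv]
      exact (eq_inv_of_mul_eq_one_left hc).symm
    · refine absurd ?_ (hno (a * c) (b * c))
      rw [map_mul, map_mul]; linear_combination hc
  have hmul : ∀ c d, (∃ a, a * τ a = c) → (∃ a, a * τ a = d) → ∃ a, a * τ a = c * d := by
    rintro _ _ ⟨a, rfl⟩ ⟨b, rfl⟩
    exact ⟨a * b, by rw [map_mul]; ring⟩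
  have hsq : ∀ c, τ c = c → ∃ a, a * τ a = c ^ 2 := fun c hc => ⟨c, by rw [hc]; ring⟩
  have hnat : ∀ n : ℕ, ∃ a, a * τ a = (n : K) := by
    intro n
    induction n with
    | zero => exact ⟨0, by simp⟩
    | succ n ih =>
      have := hadd _ _ ih ⟨1, by rw [map_one, mul_one]⟩
      simpa using this
  have hp2 : 2 ≤ p := by
    rcases hodd with ⟨k, rfl⟩
    rcases k with _ | k
    · simp at hp
    · omega
  obtain ⟨s, hs, hs2⟩ := exists_fixed_sqrt hτ hodd hp h2 hπ (c := 1 - (p : K)) (by simp)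
    (by simpa using hp)
  have hneg : ∃ a, a * τ a = (-1 : K) := by
    have := hadd _ _ (hsq s hs) (hnat (p - 2))
    rw [hs2, Nat.cast_sub hp2] at this
    convert this using 2
    push_cast; ring_nf
  apply hnot
  have := hadd _ _ (hsq ((t + 1) / 2) (by simp only [map_div₀, map_add, map_one, map_ofNat, ht]))
    (hmul _ _ hneg (hsq ((t - 1) / 2) (by simp only [map_div₀, map_sub, map_one, map_ofNat, ht])))
  have h3 : ((t + 1) / 2) ^ 2 + -1 * ((t - 1) / 2) ^ 2 = t := by field_simp; ring
  rwa [h3] at this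

include hτ hodd hp h2 hπ hu in
lemma isNormRep_of {t : K} (ht : τ t = t) (ht0 : t ≠ 0) (hnot : ¬ ∃ a, a * τ a = t)
    (h1 : ∃ a, u * (a * τ a) = 1 ∨ u * (a * τ a) = t)
    (h3 : ∃ a, π * (a * τ a) = 1 ∨ π * (a * τ a) = t) : IsNormRep τ t := by
  have hclass : ∀ c, τ c = c → c ≠ 0 → ∃ a, c * (a * τ a) = 1 ∨ c * (a * τ a) = t := by
    have hmul : ∀ c d, (∃ a, c * (a * τ a) = 1 ∨ c * (a * τ a) = t) →
        (∃ a, d * (a * τ a) = 1 ∨ d * (a * τ a) = t) →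
        ∃ a, c * d * (a * τ a) = 1 ∨ c * d * (a * τ a) = t := by
      rintro c d ⟨a, ha⟩ ⟨b, hb⟩
      rcases ha with ha | ha <;> rcases hb with hb | hb
      · exact ⟨a * b, Or.inl (by rw [map_mul]; linear_combination d * (b * τ b) * ha + hb)⟩
      · exact ⟨a * b, Or.inr (by rw [map_mul]; linear_combination d * (b * τ b) * ha + hb)⟩
      · exact ⟨a * b, Or.inr (by rw [map_mul]; linear_combination d * (b * τ b) * ha + t * hb)⟩
      · refine ⟨a * b / t, Or.inl ?_⟩
        rw [map_div₀, map_mul, ht]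
        field_simp
        linear_combination d * (b * τ b) * ha + t * hb
    have hsq : ∀ c, τ c = c → c ≠ 0 → ∃ a, c ^ 2 * (a * τ a) = 1 ∨ c ^ 2 * (a * τ a) = t :=
      fun c hc hc0 => ⟨c⁻¹, Or.inl (by rw [map_inv₀, hc]; field_simp)⟩
    intro c hc hc0
    obtain ⟨k, hk⟩ := hπ.exists_zpow hc hc0
    have hπ0 := hπ.2.1
    obtain ⟨w, hw, h⟩ := exists_fixed_unit_sq hτ hodd hp h2 hπ hu
      (c := c * π ^ (-k)) (by rw [map_mul, hc, map_zpow₀, hπ.1]) hk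
    have hk' : c = (c * π ^ (-k)) * π ^ k := by
      rw [_root_.zpow_neg]; have := zpow_ne_zero k hπ0; field_simp
    have hw0 : w ≠ 0 := by
      rintro rfl
      have h0 : c * π ^ (-k) ≠ 0 := mul_ne_zero hc0 (zpow_ne_zero _ hπ0)
      rcases h with h | h <;> exact h0 (by rw [← h]; ring)
    have hu0 : u ≠ 0 := by intro h; have := hu.2.1; simp [h] at this
    rw [hk']
    refine hmul _ _ ?_ ?_
    · rcases h with h | h
      · rw [← h]; exact hsq w hw hw0
      · rw [← h]; exact hmul _ _ h1 (hsq w hw hw0)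
    · rcases Int.even_or_odd' k with ⟨m, hm | hm⟩
      · have hpk : π ^ k = (π ^ m) ^ 2 := by rw [hm, mul_comm, _root_.zpow_mul]; norm_cast
        rw [hpk]
        exact hsq _ (by rw [map_zpow₀, hπ.1]) (zpow_ne_zero m hπ0)
      · have hpk : π ^ k = (π ^ m) ^ 2 * π := by
          rw [hm, zpow_add_one₀ hπ0, mul_comm 2, _root_.zpow_mul]; norm_cast
        rw [hpk]
        exact hmul _ _ (hsq _ (by rw [map_zpow₀, hπ.1]) (zpow_ne_zero m hπ0)) h3
  exact ⟨ht, ht0, hnot, hclass, exists_sum_norm_eq hτ hodd hp h2 hπ ht hnot hclass⟩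

include hτ h2 in
lemma exists_fixed_coords {s : K} (hs : τ s = -s) (hs0 : s ≠ 0) (a : K) :
    ∃ x y, τ x = x ∧ τ y = y ∧ a * τ a = x ^ 2 - s ^ 2 * y ^ 2 := by
  have h20 : (2 : K) ≠ 0 := by intro h; simp [h] at h2
  refine ⟨(a + τ a) / 2, (a - τ a) / (2 * s), ?_, ?_, ?_⟩
  · simp only [map_div₀, map_add, hτ, map_ofNat]; ring
  · simp only [map_div₀, map_sub, hτ, map_ofNat, map_mul, hs]
    field_simp; ring
  · field_simp; ring

lemma fixed_or_ratio_fixed {s w c : K} (hs : τ s = -s) (hs0 : s ≠ 0) (hc : τ c = c)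
    (hw : w ^ 2 = c) : τ w = w ∨ ∃ y, τ y = y ∧ s ^ 2 * y ^ 2 = c := by
  have : (τ w - w) * (τ w + w) = 0 := by
    have : τ w ^ 2 = w ^ 2 := by rw [← map_pow, hw, hc]
    linear_combination this
  rcases mul_eq_zero.1 this with h | h
  · exact Or.inl (sub_eq_zero.1 h)
  · refine Or.inr ⟨w / s, ?_, by rw [← hw]; field_simp⟩
    rw [map_div₀, hs, eq_neg_of_add_eq_zero_left h, neg_div_neg_eq]

include hτ hodd hp h2 hπ hu in
/-- The choice of representative made in the classification of hermitian forms over a local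
field is a representative of the non-norms. -/
theorem exists_repCond (hne : ∃ a, τ a ≠ a) :
    ∃ t, RepCond u π t ∧ (∀ t', RepCond u π t' → t' = t) ∧ IsNormRep τ t := by
  obtain ⟨s, hs, hs0, hD⟩ := exists_antifixed hτ hodd hp h2 hπ hu hne
  have hu0 : u ≠ 0 := by intro h; have := hu.2.1; simp [h] at this
  have hπ0 := hπ.2.1
  have hpos : 0 < ‖π‖ := norm_pos_iff.2 hπ0
  have huπ : τ (u * π) = u * π := by rw [map_mul, hu.1, hπ.1]
  have hnu : ‖u‖ = 1 := hu.2.1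
  rcases hD with hD | hD
  · have hexcl : ∀ c, τ c = c → ‖c‖ = ‖π‖ → ¬ ∃ w : K, w ^ 2 = c := by
      rintro c hc hcπ ⟨w, hw⟩
      rcases fixed_or_ratio_fixed hs hs0 hc hw with h | ⟨y, hy, hyc⟩
      · exact hπ.norm_sq_ne h (by rw [← norm_pow, hw, hcπ])
      · refine hπ.norm_sq_ne hy ?_
        rw [← hcπ, ← hyc, hD, norm_mul, hnu, one_mul, norm_pow]
    refine ⟨π, Or.inl ⟨⟨s, hD⟩, rfl⟩, ?_, ?_⟩
    · rintro t' (⟨-, h⟩ | ⟨h | h, -⟩)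
      · exact h
      · exact absurd h (hexcl _ hπ.1 rfl)
      · exact absurd h (hexcl _ huπ (by rw [norm_mul, hnu, one_mul]))
    · refine isNormRep_of hτ hodd hp h2 hπ hu hπ.1 hπ0 ?_ ?_ ⟨1, Or.inr (by simp)⟩
      · rintro ⟨a, ha⟩
        obtain ⟨x, y, hx, hy, hxy⟩ := exists_fixed_coords hτ h2 hs hs0 a
        rw [ha, hD] at hxy
        by_cases hy0 : y = 0
        · refine hπ.norm_sq_ne hx ?_
          rw [hxy, hy0]; simp
        have hyn : 0 < ‖y‖ := norm_pos_iff.2 hy0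
        set z := x / y with hz
        have hzf : τ z = z := by rw [hz, map_div₀, hx, hy]
        have hz2 : π = (z ^ 2 - u) * y ^ 2 := by rw [hxy, hz]; field_simp
        have hnot1 : ‖z ^ 2 - u‖ = 1 → False := by
          intro h
          refine hπ.norm_sq_ne hy ?_
          conv_rhs => rw [hz2, norm_mul, h, one_mul, norm_pow]
        by_cases hlt : ‖z ^ 2 - u‖ < 1
        · have hz1 : ‖z ^ 2‖ = 1 := norm_eq_one_of_near hnu hlt
          obtain ⟨w, hw, hwz⟩ := exists_fixed_ratio hτ hodd hp h2 hπ (c := u) (d := z ^ 2)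
            hu.1 (by rw [map_pow, hzf]) hz1 (by rwa [norm_sub_rev])
          exact hu.2.2 ⟨w * z, by rw [map_mul, hw, hzf], by rw [← hwz]; ring⟩
        · by_cases hz1 : ‖z ^ 2‖ = 1
          · refine hnot1 (le_antisymm ?_ (not_lt.1 hlt))
            rw [sub_eq_add_neg]
            exact norm_add_le_one hz1.le (by rw [norm_neg, hnu])
          · have := IsUltrametricDist.norm_add_eq_max_of_norm_ne_norm (x := z ^ 2) (y := -u)
              (by rw [norm_neg, hnu]; exact hz1)
            rw [← sub_eq_add_neg, norm_neg, hnu] at this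
            rcases le_total ‖z ^ 2‖ 1 with h | h
            · exact hnot1 (by rw [this, max_eq_right h])
            · rw [max_eq_left h] at this
              refine hπ.norm_sq_ne hx ?_
              conv_rhs => rw [hz2, norm_mul, this]
              rw [norm_pow, norm_pow, hz, norm_div]
              field_simp
      · obtain ⟨x, y, hx, hy, hxy⟩ := exists_fixed_unit_eq_sq_sub hτ hodd hp h2 hπ hu
        have hn : (x + y * s) * τ (x + y * s) = u := by
          rw [map_add, map_mul, hx, hy, hs]; linear_combination hxy - y ^ 2 * hD
        refine ⟨(x + y * s)⁻¹, Or.inl ?_⟩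
        rw [map_inv₀, ← mul_inv, hn, mul_inv_cancel₀ hu0]
  · have hDn : ‖s ^ 2‖ = ‖π‖ := by
      rcases hD with h | h <;> rw [h]
      rw [norm_mul, hnu, one_mul]
    have hsf : τ (s ^ 2) = s ^ 2 := by rw [map_pow, hs]; ring
    refine ⟨u, Or.inr ⟨hD.imp (fun h => ⟨s, h⟩) (fun h => ⟨s, h⟩), rfl⟩, ?_, ?_⟩
    · rintro t' (⟨⟨w, hw⟩, -⟩ | ⟨-, h⟩)
      · exfalso
        rcases fixed_or_ratio_fixed hs hs0 hu.1 hw with h | ⟨y, hy, hyc⟩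
        · exact hu.2.2 ⟨w, h, hw⟩
        · have hy0 : y ≠ 0 := by rintro rfl; simp at hyc; exact hu0 hyc.symm
          refine hπ.norm_sq_ne_mul (x := 1) (map_one _) hy hy0 ?_
          rw [← hDn, ← norm_pow y, ← norm_mul, hyc, hnu]; simp
      · exact h
    · refine isNormRep_of hτ hodd hp h2 hπ hu hu.1 hu0 ?_ ⟨1, Or.inr (by simp)⟩ ?_
      · rintro ⟨a, ha⟩
        obtain ⟨x, y, hx, hy, hxy⟩ := exists_fixed_coords hτ h2 hs hs0 a
        rw [ha] at hxy
        by_cases hy0 : y = 0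
        · exact hu.2.2 ⟨x, hx, by rw [hxy, hy0]; ring⟩
        have hne' := hπ.norm_sq_ne_mul hx hy hy0
        have hmax := IsUltrametricDist.norm_add_eq_max_of_norm_ne_norm (x := x ^ 2)
          (y := -(s ^ 2 * y ^ 2))
          (by rw [norm_neg, norm_mul, hDn, norm_pow, norm_pow]; exact hne')
        rw [← sub_eq_add_neg, ← hxy, hnu, norm_neg] at hmax
        have hy1 : ‖s ^ 2 * y ^ 2‖ ≠ 1 := by
          rw [norm_mul, hDn, norm_pow]
          intro h
          exact hπ.norm_sq_ne_mul (x := 1) (map_one _) hy hy0 (by rw [h]; simp)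
        have hlt : ‖s ^ 2 * y ^ 2‖ < 1 :=
          lt_of_le_of_ne (by rw [hmax]; exact le_max_right _ _) hy1
        have hx1 : ‖x ^ 2‖ = 1 := by
          rcases max_choice ‖x ^ 2‖ ‖s ^ 2 * y ^ 2‖ with h | h
          · rw [← h, ← hmax]
          · rw [h] at hmax; exact absurd hmax.symm hy1
        obtain ⟨w, hw, hwz⟩ := exists_fixed_ratio hτ hodd hp h2 hπ (c := u) (d := x ^ 2)
          hu.1 (by rw [map_pow, hx]) hx1 (by
            rw [hxy]; simpa using hlt)
        exact hu.2.2 ⟨w * x, by rw [map_mul, hw, hx], by rw [← hwz]; ring⟩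
      · obtain ⟨w, hw, h⟩ := exists_fixed_unit_sq hτ hodd hp h2 hπ hu (c := -1) (by simp)
          (by simp)
        have hw0 : w ≠ 0 := by rintro rfl; rcases h with h | h <;> simp at h
        rcases hD with hD | hD <;> rcases h with h | h
        · refine ⟨(w * s)⁻¹, Or.inl ?_⟩
          rw [map_inv₀, map_mul, hs, hw, ← hD]
          field_simp
          linear_combination -h
        · refine ⟨w * u / s, Or.inr ?_⟩
          rw [map_div₀, map_mul, hs, hw, hu.1, ← hD]
          field_simp
          linear_combination -h
        · refine ⟨w * u / s, Or.inr ?_⟩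
          have : π = s ^ 2 / u := by rw [hD]; field_simp
          rw [map_div₀, map_mul, hs, hw, hu.1, this]
          field_simp
          linear_combination -h
        · refine ⟨w * u / s, Or.inl ?_⟩
          have : π = s ^ 2 / u := by rw [hD]; field_simp
          rw [map_div₀, map_mul, hs, hw, hu.1, this]
          field_simp
          linear_combination -h

end LocalField

section Valuation

variable {p : ℕ} [Fact p.Prime] {K : Type*} [Field K] [Algebra ℚ_[p] K] {ν : K → ℚ}

lemma IsExpValuation.map_one (hν : IsExpValuation p K ν) : ν 1 = 0 := by
  have := hν.1 1 1 one_ne_zero one_ne_zero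
  rw [mul_one] at this
  linarith

open Classical in
/-- The absolute value attached to an exponential valuation. -/
def IsExpValuation.absoluteValue (hν : IsExpValuation p K ν) : AbsoluteValue K ℝ := by
  have hp1 : (1 : ℝ) ≤ p := by exact_mod_cast (Fact.out : p.Prime).one_lt.le
  have hp0 : (0 : ℝ) < p := lt_of_lt_of_le one_pos hp1
  exact
  { toFun := fun x => if x = 0 then 0 else (p : ℝ) ^ (-(ν x : ℝ))
    map_mul' := fun x y => by
      by_cases hx : x = 0
      · simp [hx]
      by_cases hy : y = 0
      · simp [hy]
      simp only [hx, hy, mul_eq_zero, or_self, if_false]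
      rw [hν.1 x y hx hy, ← Real.rpow_add hp0]
      congr 1; push_cast; ring
    nonneg' := fun x => by
      split_ifs
      · exact le_rfl
      · exact (Real.rpow_pos_of_pos hp0 _).le
    eq_zero' := fun x => by
      split_ifs with h
      · simp [h]
      · simp [h, (Real.rpow_pos_of_pos hp0 _).ne']
    add_le' := fun x y => by
      by_cases hx : x = 0
      · simp [hx]
      by_cases hy : y = 0
      · simp [hy]
      by_cases hxy : x + y = 0
      · simp only [hx, hy, hxy, if_true, if_false]
        exact add_nonneg (Real.rpow_pos_of_pos hp0 _).le (Real.rpow_pos_of_pos hp0 _).le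
      simp only [hx, hy, hxy, if_false]
      have h := hν.2.1 x y hx hy hxy
      rcases min_le_iff.1 h with h | h
      · have h' : (ν x : ℝ) ≤ ν (x + y) := by exact_mod_cast h
        have := Real.rpow_le_rpow_of_exponent_le hp1 (neg_le_neg h')
        linarith [Real.rpow_pos_of_pos hp0 (-(ν y : ℝ))]
      · have h' : (ν y : ℝ) ≤ ν (x + y) := by exact_mod_cast h
        have := Real.rpow_le_rpow_of_exponent_le hp1 (neg_le_neg h')
        linarith [Real.rpow_pos_of_pos hp0 (-(ν x : ℝ))] }

lemma IsExpValuation.absoluteValue_apply (hν : IsExpValuation p K ν) {x : K} (hx : x ≠ 0) :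
    hν.absoluteValue x = (p : ℝ) ^ (-(ν x : ℝ)) := by
  classical
  exact if_neg hx

lemma IsExpValuation.absoluteValue_le_iff (hν : IsExpValuation p K ν) {x y : K} (hx : x ≠ 0)
    (hy : y ≠ 0) : hν.absoluteValue x ≤ hν.absoluteValue y ↔ ν y ≤ ν x := by
  have hp1 : (1 : ℝ) < p := by exact_mod_cast (Fact.out : p.Prime).one_lt
  rw [hν.absoluteValue_apply hx, hν.absoluteValue_apply hy, Real.rpow_le_rpow_left_iff hp1]
  rw [neg_le_neg_iff]; norm_cast

lemma IsExpValuation.absoluteValue_lt_one_iff (hν : IsExpValuation p K ν) {x : K} (hx : x ≠ 0) :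
    hν.absoluteValue x < 1 ↔ 0 < ν x := by
  have := hν.absoluteValue_le_iff one_ne_zero hx
  rw [hν.map_one, hν.absoluteValue.map_one] at this
  rw [← not_le, this, not_le]

lemma IsExpValuation.absoluteValue_algebraMap (hν : IsExpValuation p K ν) (r : ℚ_[p]) :
    hν.absoluteValue (algebraMap ℚ_[p] K r) = ‖r‖ := by
  by_cases hr : r = 0
  · simp [hr]
  rw [hν.absoluteValue_apply (by simpa using hr), hν.2.2 r hr, Padic.norm_eq_zpow_neg_valuation hr,
    ← Real.rpow_intCast]
  push_cast; rfl

lemma IsExpValuation.absoluteValue_add (hν : IsExpValuation p K ν) (x y : K) :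
    hν.absoluteValue (x + y) ≤ max (hν.absoluteValue x) (hν.absoluteValue y) := by
  by_cases hx : x = 0
  · simp [hx]
  by_cases hy : y = 0
  · simp [hy]
  by_cases hxy : x + y = 0
  · simp [hxy]
  rw [le_max_iff, hν.absoluteValue_le_iff hxy hx, hν.absoluteValue_le_iff hxy hy]
  exact min_le_iff.1 (hν.2.1 x y hx hy hxy)

theorem exists_repCond_of_isExpValuation [FiniteDimensional ℚ_[p] K] (hp2 : p ≠ 2)
    (hν : IsExpValuation p K ν) {τ : K →+* K} (hτ : ∀ a, τ (τ a) = a) (hne : ∃ a, τ a ≠ a)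
    {u π : K} (hu : τ u = u ∧ u ≠ 0 ∧ ν u = 0 ∧ ¬ ∃ w : K, τ w = w ∧ w ^ 2 = u)
    (hπ : τ π = π ∧ π ≠ 0 ∧ 0 < ν π ∧ ∀ a : K, τ a = a → a ≠ 0 → 0 < ν a → ν π ≤ ν a) :
    ∃ t, RepCond u π t ∧ (∀ t', RepCond u π t' → t' = t) ∧ IsNormRep τ t := by
  let _ : NormedField K := hν.absoluteValue.toNormedField
  have hnorm : ∀ x : K, ‖x‖ = hν.absoluteValue x := fun _ => rfl
  have : IsUltrametricDist K :=
    IsUltrametricDist.isUltrametricDist_of_forall_norm_add_le_max_norm hν.absoluteValue_add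
  let _ : NormedSpace ℚ_[p] K :=
    { norm_smul_le := fun r x => by
        rw [Algebra.smul_def, norm_mul, hnorm (algebraMap _ _ r), hν.absoluteValue_algebraMap] }
  have : ProperSpace K := FiniteDimensional.proper ℚ_[p] K
  have hprime : p.Prime := Fact.out
  have hmap : ∀ n : ℕ, ‖(n : K)‖ = ‖(n : ℚ_[p])‖ := fun n => by
    rw [hnorm, ← hν.absoluteValue_algebraMap, _root_.map_natCast (algebraMap ℚ_[p] K)]
  refine exists_repCond hτ (hprime.odd_of_ne_two hp2) ?_ ?_ ?_ ?_ hne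
  · rw [hmap]; exact Padic.norm_p_lt_one
  · have h2 := hmap 2
    rw [Nat.cast_ofNat] at h2
    rw [h2, Padic.norm_natCast_eq_one_iff]
    exact (Nat.coprime_primes hprime Nat.prime_two).2 hp2
  · refine ⟨hπ.1, hπ.2.1, (hν.absoluteValue_lt_one_iff hπ.2.1).2 hπ.2.2.1, fun a ha ha1 => ?_⟩
    by_cases h0 : a = 0
    · rw [h0, norm_zero]; exact norm_nonneg _
    exact (hν.absoluteValue_le_iff h0 hπ.2.1).2
      (hπ.2.2.2 a ha h0 ((hν.absoluteValue_lt_one_iff h0).1 ha1))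
  · refine ⟨hu.1, ?_, hu.2.2.2⟩
    rw [hnorm, hν.absoluteValue_apply hu.2.1, hu.2.2.1]; simp

end Valuation

section StarCongruence

variable {F : Type*} [Field F] [StarRing F]
variable {ι κ μ ρ : Type} [Fintype ι] [DecidableEq ι] [Fintype κ] [DecidableEq κ]
  [Fintype μ] [DecidableEq μ] [Fintype ρ] [DecidableEq ρ]

/-- Pairs of square matrices indexed by `ι`. -/
abbrev MatPair (F : Type*) (ι : Type) := Matrix ι ι F × Matrix ι ι F

/-- Simultaneous `*`congruence of pairs of matrices with arbitrary index types. -/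
def PairCong (P : MatPair F ι) (Q : MatPair F κ) : Prop :=
  ∃ (S : Matrix ι κ F) (S' : Matrix κ ι F), S * S' = 1 ∧ S' * S = 1 ∧
    Sᴴ * P.1 * S = Q.1 ∧ Sᴴ * P.2 * S = Q.2

/-- The direct sum of two pairs of matrices. -/
def pairSum (P : MatPair F ι) (Q : MatPair F κ) : MatPair F (ι ⊕ κ) :=
  (fromBlocks P.1 0 0 Q.1, fromBlocks P.2 0 0 Q.2)

/-- Both matrices of the pair are Hermitian. -/
def IsHermPair (P : MatPair F ι) : Prop := P.1ᴴ = P.1 ∧ P.2ᴴ = P.2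

lemma PairCong.refl (P : MatPair F ι) : PairCong P P := ⟨1, 1, by simp, by simp, by simp, by simp⟩

lemma PairCong.symm {P : MatPair F ι} {Q : MatPair F κ} (h : PairCong P Q) : PairCong Q P := by
  obtain ⟨S, S', h1, h2, h3, h4⟩ := h
  have h1' : S'ᴴ * Sᴴ = 1 := by rw [← conjTranspose_mul, h1, conjTranspose_one]
  have key : ∀ A : Matrix ι ι F, S'ᴴ * (Sᴴ * A * S) * S' = A := fun A => by
    calc S'ᴴ * (Sᴴ * A * S) * S' = (S'ᴴ * Sᴴ) * A * (S * S') := by simp only [Matrix.mul_assoc]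
      _ = A := by rw [h1, h1']; simp
  exact ⟨S', S, h2, h1, by rw [← h3, key], by rw [← h4, key]⟩

lemma PairCong.trans {P : MatPair F ι} {Q : MatPair F κ} {R : MatPair F μ} (h : PairCong P Q)
    (h' : PairCong Q R) : PairCong P R := by
  obtain ⟨S, S', h1, h2, h3, h4⟩ := h
  obtain ⟨T, T', k1, k2, k3, k4⟩ := h'
  refine ⟨S * T, T' * S', ?_, ?_, ?_, ?_⟩
  · calc S * T * (T' * S') = S * (T * T') * S' := by simp only [Matrix.mul_assoc]
      _ = 1 := by rw [k1, Matrix.mul_one, h1]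
  · calc T' * S' * (S * T) = T' * (S' * S) * T := by simp only [Matrix.mul_assoc]
      _ = 1 := by rw [h2, Matrix.mul_one, k2]
  · rw [← k3, ← h3, conjTranspose_mul]; simp only [Matrix.mul_assoc]
  · rw [← k4, ← h4, conjTranspose_mul]; simp only [Matrix.mul_assoc]

lemma PairCong.swap {P : MatPair F ι} {Q : MatPair F κ} (h : PairCong P Q) :
    PairCong P.swap Q.swap := by
  obtain ⟨S, S', h1, h2, h3, h4⟩ := h
  exact ⟨S, S', h1, h2, h4, h3⟩

lemma PairCong.card_eq {P : MatPair F ι} {Q : MatPair F κ} (h : PairCong P Q) :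
    Fintype.card ι = Fintype.card κ := by
  obtain ⟨S, S', h1, h2, -, -⟩ := h
  have := LinearEquiv.finrank_eq (Matrix.toLin'OfInv h1 h2)
  simpa using this

lemma PairCong.of_equiv {P : MatPair F ι} {Q : MatPair F κ} (e : ι ≃ κ)
    (h1 : ∀ i j, Q.1 (e i) (e j) = P.1 i j) (h2 : ∀ i j, Q.2 (e i) (e j) = P.2 i j) :
    PairCong P Q := by
  have key : ∀ A : Matrix ι ι F, ((1 : Matrix ι ι F).submatrix id e.symm)ᴴ * A *
      (1 : Matrix ι ι F).submatrix id e.symm = A.submatrix e.symm e.symm := by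
    intro A
    rw [conjTranspose_submatrix, conjTranspose_one]
    ext i j
    simp [Matrix.mul_apply, Matrix.one_apply]
  refine ⟨(1 : Matrix ι ι F).submatrix id e.symm, (1 : Matrix ι ι F).submatrix e.symm id,
    ?_, ?_, ?_, ?_⟩
  · have := Matrix.submatrix_mul_equiv (1 : Matrix ι ι F) (1 : Matrix ι ι F) id e.symm id
    rw [this, Matrix.one_mul]; rfl
  · ext i j
    simp [Matrix.mul_apply, Matrix.one_apply]
  · rw [key]; ext i j; simp [← h1]
  · rw [key]; ext i j; simp [← h2]

lemma PairCong.sum {P : MatPair F ι} {Q : MatPair F κ} {P' : MatPair F μ} {Q' : MatPair F ρ}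
    (h : PairCong P Q) (h' : PairCong P' Q') : PairCong (pairSum P P') (pairSum Q Q') := by
  obtain ⟨S, S', h1, h2, h3, h4⟩ := h
  obtain ⟨T, T', k1, k2, k3, k4⟩ := h'
  refine ⟨fromBlocks S 0 0 T, fromBlocks S' 0 0 T', ?_, ?_, ?_, ?_⟩
  · rw [fromBlocks_multiply]; simp [h1, k1]
  · rw [fromBlocks_multiply]; simp [h2, k2]
  · simp only [pairSum, fromBlocks_conjTranspose, fromBlocks_multiply]; simp [h3, k3]
  · simp only [pairSum, fromBlocks_conjTranspose, fromBlocks_multiply]; simp [h4, k4]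

lemma pairSum_assoc (P : MatPair F ι) (Q : MatPair F κ) (R : MatPair F μ) :
    PairCong (pairSum (pairSum P Q) R) (pairSum P (pairSum Q R)) := by
  refine PairCong.of_equiv (Equiv.sumAssoc ι κ μ) ?_ ?_ <;>
  · rintro ((i | i) | i) ((j | j) | j) <;> simp [pairSum]

lemma pairSum_comm (P : MatPair F ι) (Q : MatPair F κ) :
    PairCong (pairSum P Q) (pairSum Q P) := by
  refine PairCong.of_equiv (Equiv.sumComm ι κ) ?_ ?_ <;>
  · rintro (i | i) (j | j) <;> simp [pairSum]

lemma IsHermPair.cong {P : MatPair F ι} {Q : MatPair F κ} (hP : IsHermPair P)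
    (h : PairCong P Q) : IsHermPair Q := by
  obtain ⟨S, S', h1, h2, h3, h4⟩ := h
  constructor
  · rw [← h3]; simp only [conjTranspose_mul, conjTranspose_conjTranspose, hP.1, Matrix.mul_assoc]
  · rw [← h4]; simp only [conjTranspose_mul, conjTranspose_conjTranspose, hP.2, Matrix.mul_assoc]

lemma IsHermPair.of_sum {P : MatPair F ι} {Q : MatPair F κ} (h : IsHermPair (pairSum P Q)) :
    IsHermPair P ∧ IsHermPair Q := by
  obtain ⟨h1, h2⟩ := h
  simp only [pairSum, fromBlocks_conjTranspose, fromBlocks_inj] at h1 h2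
  exact ⟨⟨h1.1, h2.1⟩, ⟨h1.2.2.2, h2.2.2.2⟩⟩

/-- A retract `X, Y` compatible with a pair of Hermitian forms splits off a direct summand. -/
lemma exists_pairSum_of_retract {P : MatPair F ι} (hP : IsHermPair P) {G : MatPair F κ}
    {X : Matrix ι κ F} {Y : Matrix κ ι F} (hYX : Y * X = 1)
    (h1 : Xᴴ * P.1 = G.1 * Y) (h2 : Xᴴ * P.2 = G.2 * Y) :
    ∃ (m : ℕ) (P' : MatPair F (Fin m)), IsHermPair P' ∧ PairCong P (pairSum G P') := by
  classical
  set W : Submodule F (ι → F) := LinearMap.ker Y.mulVecLin with hW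
  let b := Module.finBasis F W
  set m := Module.finrank F W
  let Z : Matrix ι (Fin m) F := Matrix.of fun i j => (b j : ι → F) i
  let pr : (ι → F) →ₗ[F] W := LinearMap.codRestrict W (1 - X * Y).mulVecLin (fun v => by
    rw [hW, LinearMap.mem_ker, mulVecLin_apply, mulVecLin_apply, mulVec_mulVec, Matrix.mul_sub,
      ← Matrix.mul_assoc, hYX]
    simp)
  let Z' : Matrix (Fin m) ι F := LinearMap.toMatrix' (b.equivFun.toLinearMap ∘ₗ pr)
  have hYZ : Y * Z = 0 := by
    ext i j
    have : Y.mulVec (b j : ι → F) = 0 := (b j).2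
    exact congrFun this i
  have hZmul : ∀ c, Z.mulVec c = (b.equivFun.symm c : W) := by
    intro c
    rw [Module.Basis.equivFun_symm_apply]
    ext i
    simp [Matrix.mulVec, dotProduct, Z, mul_comm]
  have hZ'mul : ∀ v, Z'.mulVec v = b.equivFun (pr v) := fun v => by
    rw [← Matrix.toLin'_apply, Matrix.toLin'_toMatrix']; rfl
  have hprW : ∀ w : W, pr (w : ι → F) = w := by
    intro w
    apply Subtype.ext
    have hw : Y.mulVec (w : ι → F) = 0 := w.2
    change (1 - X * Y).mulVec (w : ι → F) = ((w : W) : ι → F)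
    rw [sub_mulVec, ← mulVec_mulVec, hw]; simp
  have hZZ' : Z * Z' = 1 - X * Y := by
    apply Matrix.toLin'.injective
    ext1 v
    apply LinearMap.ext; intro v
    simp only [LinearMap.comp_apply, toLin'_apply, ← mulVec_mulVec, hZ'mul, hZmul,
      LinearEquiv.symm_apply_apply]
    rfl
  have hZ'Z : Z' * Z = 1 := by
    apply Matrix.toLin'.injective
    apply LinearMap.ext; intro v
    simp only [toLin'_apply, ← mulVec_mulVec, hZ'mul, hZmul, hprW,
      LinearEquiv.apply_symm_apply, one_mulVec]
  have hZ'X : Z' * X = 0 := by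
    apply Matrix.toLin'.injective
    apply LinearMap.ext; intro v
    simp only [toLin'_apply, ← mulVec_mulVec, hZ'mul]
    have : pr (X.mulVec v) = 0 := by
      apply Subtype.ext
      change (1 - X * Y).mulVec (X.mulVec v) = 0
      rw [mulVec_mulVec, Matrix.sub_mul, Matrix.mul_assoc, hYX]; simp
    rw [this]; simp
  have hherm : ∀ (A : Matrix ι ι F) (C : Matrix κ κ F), Aᴴ = A → Xᴴ * A = C * Y →
      (fromCols X Z)ᴴ * A * fromCols X Z = fromBlocks C 0 0 (Zᴴ * A * Z) := by
    intro A C hA h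
    have e1 : Xᴴ * A * X = C := by rw [h, Matrix.mul_assoc, hYX, Matrix.mul_one]
    have e2 : Xᴴ * A * Z = 0 := by rw [h, Matrix.mul_assoc, hYZ, Matrix.mul_zero]
    have e3 : Zᴴ * A * X = 0 := by
      have := congrArg conjTranspose e2
      simpa [conjTranspose_mul, hA, Matrix.mul_assoc] using this
    rw [conjTranspose_fromCols_eq_fromRows_conjTranspose, fromRows_mul, fromRows_mul_fromCols,
      e1, e2, e3]
  have hPC : PairCong P (pairSum G (Zᴴ * P.1 * Z, Zᴴ * P.2 * Z)) := by
    refine ⟨fromCols X Z, fromRows Y Z', ?_, ?_, hherm _ _ hP.1 h1, hherm _ _ hP.2 h2⟩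
    · rw [fromCols_mul_fromRows, hZZ']; simp
    · rw [fromRows_mul_fromCols, hYX, hYZ, hZ'X, hZ'Z, fromBlocks_one]
  exact ⟨m, _, (hP.cong hPC).of_sum.2, hPC⟩

lemma psum_cons_cong (X : PBlock F) (L : List (PBlock F)) :
    PairCong (psum (X :: L)).2 (pairSum X.2 (psum L).2) := by
  refine (PairCong.of_equiv finSumFinEquiv ?_ ?_).symm <;>
  · intro i j
    simp [psum, pairSum]

lemma psum_perm {L L' : List (PBlock F)} (h : L.Perm L') : PairCong (psum L).2 (psum L').2 := by
  induction h with
  | nil => exact PairCong.refl _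
  | cons x _ ih =>
    exact (psum_cons_cong _ _).trans (((PairCong.refl _).sum ih).trans (psum_cons_cong _ _).symm)
  | swap x y l =>
    refine (psum_cons_cong _ _).trans (((PairCong.refl _).sum (psum_cons_cong _ _)).trans ?_)
    refine PairCong.trans ?_ (((PairCong.refl _).sum (psum_cons_cong _ _)).symm.trans
      (psum_cons_cong _ _).symm)
    exact (pairSum_assoc _ _ _).symm.trans (((pairSum_comm _ _).sum (PairCong.refl _)).trans
      (pairSum_assoc _ _ _))
  | trans _ _ ih1 ih2 => exact ih1.trans ih2

end StarCongruence

lemma pStarCong_iff {F : Type*} [Field F] [StarRing F] (X Y : PBlock F) :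
    PStarCong (starRingEnd F) X Y ↔ PairCong X.2 Y.2 := by
  obtain ⟨m, A, B⟩ := X
  obtain ⟨n, C, D⟩ := Y
  have hct : ∀ S : Mat F n, ctr (starRingEnd F) S = Sᴴ := fun _ => rfl
  constructor
  · rintro ⟨h, S, hS, h1, h2⟩
    dsimp only at h
    subst h
    exact ⟨S, S⁻¹, Matrix.mul_nonsing_inv _ hS, Matrix.nonsing_inv_mul _ hS, h1, h2⟩
  · intro h
    have hmn : m = n := by simpa using h.card_eq
    subst hmn
    obtain ⟨S, S', h1, h2, h3, h4⟩ := h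
    exact ⟨rfl, S, (Matrix.isUnit_iff_isUnit_det _).1 ⟨⟨S, S', h1, h2⟩, rfl⟩, h3, h4⟩

section Intertwine

variable {F : Type*} [Field F] {ι : Type} [Fintype ι] [DecidableEq ι]

/-- An intertwining relation extends to polynomials. -/
lemma mul_aeval_of_mul_eq {κ : Type} [Fintype κ] [DecidableEq κ] {H : Matrix ι κ F}
    {T : Matrix κ κ F} {T' : Matrix ι ι F} (h : H * T = T' * H) (g : F[X]) :
    H * aeval T g = aeval T' g * H := by
  have hpow : ∀ n : ℕ, H * T ^ n = T' ^ n * H := by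
    intro n
    induction n with
    | zero => simp
    | succ n ih => rw [pow_succ, ← Matrix.mul_assoc, ih, Matrix.mul_assoc, h, ← Matrix.mul_assoc,
        pow_succ]
  induction g using Polynomial.induction_on' with
  | add g h hg hh => simp [Matrix.mul_add, Matrix.add_mul, hg, hh]
  | monomial n a =>
    rw [← C_mul_X_pow_eq_monomial]
    simp [Algebra.algebraMap_eq_smul_one, hpow]

end Intertwine

section PolynomialStar

variable {F : Type*} [Field F] [StarRing F]

/-- Coefficientwise conjugation of polynomials. -/
instance polynomialStarRing : StarRing F[X] where
  star g := g.map (starRingEnd F)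
  star_involutive g := by
    change (g.map (starRingEnd F)).map (starRingEnd F) = g
    ext i; simp
  star_mul g h := by
    change (g * h).map (starRingEnd F) = h.map (starRingEnd F) * g.map (starRingEnd F)
    rw [Polynomial.map_mul, mul_comm]
  star_add g h := Polynomial.map_add _

lemma polyStar_def (g : F[X]) : star g = g.map (starRingEnd F) := rfl

@[simp] lemma polyStar_coeff (g : F[X]) (k : ℕ) : (star g).coeff k = star (g.coeff k) := by
  simp [polyStar_def, starRingEnd_apply]

@[simp] lemma polyStar_X : star (X : F[X]) = X := by simp [polyStar_def]

@[simp] lemma polyStar_C (a : F) : star (C a : F[X]) = C (star a) := by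
  simp [polyStar_def, starRingEnd_apply]

lemma polyStar_eq_self_iff (g : F[X]) :
    star g = g ↔ ∀ k, starRingEnd F (g.coeff k) = g.coeff k := by
  rw [Polynomial.ext_iff]; simp [starRingEnd_apply]

lemma polyStar_monic {g : F[X]} (hg : g.Monic) : (star g).Monic := hg.map _

lemma polyStar_irreducible {g : F[X]} (hg : Irreducible g) : Irreducible (star g) := by
  have : star g = starRingAut g := rfl
  rw [this]
  exact (MulEquiv.irreducible_iff (starRingAut : F[X] ≃+* F[X]).toMulEquiv).2 hg

lemma polyStar_dvd_polyStar {g h : F[X]} : star g ∣ star h ↔ g ∣ h := by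
  have key : ∀ {g h : F[X]}, g ∣ h → star g ∣ star h := by
    rintro g h ⟨k, rfl⟩
    exact ⟨star k, by rw [star_mul']⟩
  exact ⟨fun H => by simpa using key H, key⟩

lemma dvd_of_irreducible_of_dvd {p r : F[X]} (hp : p.Monic) (hpi : Irreducible p) (hr : r.Monic)
    (hri : Irreducible r) (h : p ∣ r) : p = r :=
  eq_of_monic_of_associated hp hr (hpi.associated_of_dvd hri h)

variable {ι : Type} [Fintype ι] [DecidableEq ι]

lemma aeval_conjTranspose (T : Matrix ι ι F) (g : F[X]) :
    (aeval T g)ᴴ = aeval Tᴴ (star g) := by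
  induction g using Polynomial.induction_on' with
  | add g h hg hh => simp [conjTranspose_add, hg, hh]
  | monomial n a =>
    rw [← C_mul_X_pow_eq_monomial]
    simp [conjTranspose_pow, Algebra.algebraMap_eq_smul_one, conjTranspose_smul]

/-- `A * g(T)` is the adjoint of `g̅(T)` times `A` for `T` selfadjoint with respect to `A`. -/
lemma mul_aeval_eq_conjTranspose_mul {A T : Matrix ι ι F} (h : A * T = Tᴴ * A) (g : F[X]) :
    A * aeval T g = (aeval T (star g))ᴴ * A := by
  rw [mul_aeval_of_mul_eq h, aeval_conjTranspose, star_star]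

end PolynomialStar

section Companion

variable {F : Type*} [Field F] {q : F[X]}

lemma companion_mulVec_single (i : ℕ) (hi : i + 1 < q.natDegree) :
    companion F q *ᵥ Pi.single ⟨i, by omega⟩ 1 = Pi.single ⟨i + 1, hi⟩ 1 := by
  ext j
  simp only [mulVec_single_one, col_apply, companion, of_apply, Pi.single_apply, Fin.ext_iff]
  split_ifs <;> simp_all

lemma companion_mulVec_last (i : ℕ) (hi : i + 1 = q.natDegree) :
    companion F q *ᵥ Pi.single ⟨i, by omega⟩ 1 = fun j : Fin q.natDegree => -q.coeff j := by
  ext j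
  have := j.2
  simp only [mulVec_single_one, col_apply, companion, of_apply]
  split_ifs with h1
  · omega
  · rfl

lemma companion_pow_mulVec (i : ℕ) (hi : i < q.natDegree) :
    (companion F q ^ i) *ᵥ Pi.single ⟨0, by omega⟩ 1 = Pi.single ⟨i, hi⟩ 1 := by
  induction i with
  | zero => rw [pow_zero, one_mulVec]
  | succ i ih =>
    rw [pow_succ', ← mulVec_mulVec, ih (by omega), companion_mulVec_single i hi]

/-- Intertwiners out of a companion matrix are determined by the cyclic vector. -/
lemma companion_hom_ext (hN : 0 < q.natDegree) {ι : Type} [Fintype ι] [DecidableEq ι] {T : Matrix ι ι F}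
    {H H' : Matrix ι (Fin q.natDegree) F} (h : H * companion F q = T * H)
    (h' : H' * companion F q = T * H')
    (h0 : H *ᵥ Pi.single ⟨0, hN⟩ 1 = H' *ᵥ Pi.single ⟨0, hN⟩ 1) : H = H' := by
  ext i j
  have e1 : ∀ {H : Matrix ι (Fin q.natDegree) F}, H * companion F q = T * H →
      H *ᵥ Pi.single j 1 = T ^ (j : ℕ) *ᵥ (H *ᵥ Pi.single ⟨0, hN⟩ 1) := by
    intro H h
    have := mul_aeval_of_mul_eq h (X ^ (j : ℕ))
    simp only [map_pow, aeval_X] at this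
    rw [mulVec_mulVec, ← this, ← mulVec_mulVec, companion_pow_mulVec j j.2]
  have := (e1 h).trans ((congrArg _ h0).trans (e1 h').symm)
  simpa using congrFun this i

lemma aeval_companion_mulVec (hN : 0 < q.natDegree) {g : F[X]} (hg : g.degree < q.degree) :
    aeval (companion F q) g *ᵥ Pi.single ⟨0, hN⟩ 1 = fun i : Fin q.natDegree => g.coeff i := by
  have hg' : g.natDegree < q.natDegree := by
    by_cases h0 : g = 0
    · simpa [h0] using hN
    · exact natDegree_lt_natDegree h0 hg
  rw [aeval_eq_sum_range' hg', sum_mulVec]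
  ext i
  rw [Finset.sum_apply, Finset.sum_eq_single (i : ℕ)]
  · rw [smul_mulVec, companion_pow_mulVec i i.2]; simp
  · intro b hb hbi
    rw [smul_mulVec, companion_pow_mulVec b (Finset.mem_range.1 hb)]
    simp [Fin.ext_iff, hbi.symm]
  · intro h; exact absurd (Finset.mem_range.2 i.2) h

lemma exists_poly_coeff (hq : q.Monic) (v : Fin q.natDegree → F) :
    ∃ g : F[X], g.degree < q.degree ∧ ∀ i : Fin q.natDegree, g.coeff i = v i := by
  refine ⟨∑ i : Fin q.natDegree, monomial (i : ℕ) (v i), ?_, ?_⟩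
  · refine (degree_sum_le _ _).trans_lt ?_
    rw [degree_eq_natDegree hq.ne_zero, Finset.sup_lt_iff (WithBot.bot_lt_coe _)]
    intro i _
    exact (degree_monomial_le _ _).trans_lt (by exact_mod_cast i.2)
  · intro i
    simp only [finsetSum_coeff, coeff_monomial]
    rw [Finset.sum_eq_single i]
    · simp
    · exact fun b _ hb => if_neg fun h => hb (Fin.ext h)
    · simp

lemma aeval_eq_pow_add_eraseLead (hq : q.Monic) {ι : Type} [Fintype ι] [DecidableEq ι]
    (T : Matrix ι ι F) : aeval T q = T ^ q.natDegree + aeval T q.eraseLead := by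
  have hsplit : q.eraseLead + X ^ q.natDegree = q := by
    conv_rhs => rw [← eraseLead_add_C_mul_X_pow q, hq.leadingCoeff]
    simp
  conv_lhs => rw [← hsplit]
  rw [map_add, map_pow, aeval_X, add_comm]

lemma degree_eraseLead_lt_of_pos (hq : 0 < q.natDegree) : q.eraseLead.degree < q.degree :=
  degree_eraseLead_lt (by rintro rfl; simp at hq)

lemma aeval_companion_self (hN : 0 < q.natDegree) (hq : q.Monic) : aeval (companion F q) q = 0 := by
  refine companion_hom_ext hN (T := companion F q) ?_ (by simp) ?_
  · exact (mul_aeval_of_mul_eq rfl q).symm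
  · obtain ⟨N, hN'⟩ : ∃ N, q.natDegree = N + 1 := ⟨q.natDegree - 1, by omega⟩
    rw [aeval_eq_pow_add_eraseLead hq, add_mulVec, aeval_companion_mulVec hN (degree_eraseLead_lt_of_pos hN)]
    have : (companion F q ^ q.natDegree) *ᵥ Pi.single ⟨0, hN⟩ 1 = fun j : Fin q.natDegree => -q.coeff j := by
      have := congrArg (fun n => (companion F q ^ n) *ᵥ
        (Pi.single ⟨0, hN⟩ 1 : Fin q.natDegree → F)) hN'
      refine this.trans ?_
      change (companion F q ^ (N + 1)) *ᵥ _ = _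
      rw [pow_succ', ← mulVec_mulVec, companion_pow_mulVec N (by omega),
        companion_mulVec_last N hN'.symm]
    rw [this, zero_mulVec]
    ext j
    have := j.2
    simp [eraseLead_coeff, this.ne]

lemma aeval_companion_eq_zero_iff (hN : 0 < q.natDegree) (hq : q.Monic) (g : F[X]) :
    aeval (companion F q) g = 0 ↔ q ∣ g := by
  constructor
  · intro h
    rw [← modByMonic_eq_zero_iff_dvd hq]
    have h1 : aeval (companion F q) (g %ₘ q) = 0 := by
      rw [modByMonic_eq_sub_mul_div, map_sub, map_mul, h, aeval_companion_self hN hq]; simp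
    have h2 := aeval_companion_mulVec hN (degree_modByMonic_lt g hq)
    rw [h1, zero_mulVec] at h2
    ext i
    by_cases hi : i < q.natDegree
    · have := congrFun h2 ⟨i, hi⟩
      simpa using this.symm
    · rw [coeff_zero]
      apply coeff_eq_zero_of_degree_lt
      refine (degree_modByMonic_lt g hq).trans_le ?_
      rw [degree_eq_natDegree hq.ne_zero]
      exact_mod_cast not_lt.1 hi
  · rintro ⟨k, rfl⟩
    rw [map_mul, aeval_companion_self hN hq, Matrix.zero_mul]

/-- The commutant of a companion matrix consists of polynomials in it. -/
lemma exists_aeval_of_commute (hN : 0 < q.natDegree) (hq : q.Monic) {C : Mat F q.natDegree}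
    (h : C * companion F q = companion F q * C) : ∃ c : F[X], C = aeval (companion F q) c := by
  obtain ⟨c, hc, hcv⟩ := exists_poly_coeff hq (C *ᵥ Pi.single ⟨0, hN⟩ 1)
  refine ⟨c, companion_hom_ext hN h (mul_aeval_of_mul_eq rfl c).symm ?_⟩
  rw [aeval_companion_mulVec hN hc]
  exact (funext hcv).symm

variable {ι : Type} [Fintype ι] [DecidableEq ι]

/-- The matrix with columns `u, T u, T² u, …`. -/
def krylov (T : Matrix ι ι F) (u : ι → F) (N : ℕ) : Matrix ι (Fin N) F :=
  Matrix.of fun i j => (T ^ (j : ℕ) *ᵥ u) i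

lemma krylov_mulVec_single (T : Matrix ι ι F) (u : ι → F) {N : ℕ} (j : Fin N) :
    krylov T u N *ᵥ Pi.single j 1 = T ^ (j : ℕ) *ᵥ u := by
  ext i; simp [krylov]

lemma mul_krylov (hq : q.Monic) {T : Matrix ι ι F} {u : ι → F} (h : aeval T q *ᵥ u = 0) :
    T * krylov T u q.natDegree = krylov T u q.natDegree * companion F q := by
  refine Matrix.toLin'.injective (LinearMap.pi_ext' fun j => LinearMap.ext_ring ?_)
  simp only [LinearMap.comp_apply, toLin'_apply, ← mulVec_mulVec, LinearMap.single_apply,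
    krylov_mulVec_single]
  rw [mulVec_mulVec, ← pow_succ']
  have hj := j.2
  by_cases hjN : (j : ℕ) + 1 < q.natDegree
  · rw [companion_mulVec_single j hjN, krylov_mulVec_single]
  · have hjN' : (j : ℕ) + 1 = q.natDegree := by omega
    rw [companion_mulVec_last j hjN', hjN']
    have hdeg : q.eraseLead.natDegree < q.natDegree := by
      have := eraseLead_natDegree_le q; omega
    have h2 : (T ^ q.natDegree) *ᵥ u + (aeval T q.eraseLead) *ᵥ u = 0 := by
      rw [← h, ← add_mulVec, aeval_eq_pow_add_eraseLead hq]
    rw [eq_neg_of_add_eq_zero_left h2, aeval_eq_sum_range' hdeg, sum_mulVec]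
    ext i
    simp only [Pi.neg_apply, Finset.sum_apply, smul_mulVec, Pi.smul_apply, smul_eq_mul,
      Matrix.mulVec, dotProduct, krylov, of_apply, mul_neg, Finset.sum_neg_distrib]
    rw [neg_inj, ← Fin.sum_univ_eq_sum_range
      (fun k => q.eraseLead.coeff k * ∑ x, (T ^ k) i x * u x)]
    refine Finset.sum_congr rfl fun k _ => ?_
    rw [eraseLead_coeff_of_ne _ (by have := k.2; omega), mul_comm]

/-- An intertwiner out of the companion matrix of `p ^ l` not killed by `p ^ (l - 1)` is
injective. -/
lemma companion_hom_injective (hN : 0 < q.natDegree) {p : F[X]} (hpi : Irreducible p) {l : ℕ} (hq : q.Monic)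
    (hl : q = p ^ (l + 1)) {T : Matrix ι ι F}
    {H : Matrix ι (Fin q.natDegree) F} (h : H * companion F q = T * H)
    (h0 : H * aeval (companion F q) (p ^ l) ≠ 0) {c : Fin q.natDegree → F} (hc : H *ᵥ c = 0) :
    c = 0 := by
  classical
  by_contra hc0
  obtain ⟨g, hgdeg, hg⟩ := exists_poly_coeff hq c
  have hg0 : g ≠ 0 := by
    rintro rfl
    exact hc0 (funext fun i => by simpa using (hg i).symm)
  have hqg : ¬ q ∣ g := fun hd => hg0 (eq_zero_of_dvd_of_degree_lt hd hgdeg)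
  have hcg : aeval (companion F q) g *ᵥ Pi.single ⟨0, hN⟩ 1 = c := by
    rw [aeval_companion_mulVec hN hgdeg]; exact funext hg
  obtain ⟨a, b, hab⟩ : ∃ a b : F[X], p ^ l = a * g + b * q := by
    have h1 : EuclideanDomain.gcd g q ∣ p ^ (l + 1) := hl ▸ EuclideanDomain.gcd_dvd_right g q
    obtain ⟨i, hi, hassoc⟩ := (dvd_prime_pow hpi.prime (l + 1)).1 h1
    have hil : i ≤ l := by
      by_contra hcon
      obtain rfl : i = l + 1 := by omega
      exact hqg (hl ▸ hassoc.symm.dvd.trans (EuclideanDomain.gcd_dvd_left g q))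
    obtain ⟨k, hk⟩ : EuclideanDomain.gcd g q ∣ p ^ l := hassoc.dvd.trans (pow_dvd_pow _ hil)
    refine ⟨EuclideanDomain.gcdA g q * k, EuclideanDomain.gcdB g q * k, ?_⟩
    rw [hk, EuclideanDomain.gcd_eq_gcd_ab g q]; ring
  apply h0
  refine companion_hom_ext hN (T := T) ?_ (by simp) ?_
  · rw [Matrix.mul_assoc, ← mul_aeval_of_mul_eq rfl (p ^ l), ← Matrix.mul_assoc, h, Matrix.mul_assoc]
  · rw [hab, map_add, map_mul, map_mul, aeval_companion_self hN hq, Matrix.mul_zero, add_zero,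
      ← Matrix.mul_assoc, mul_aeval_of_mul_eq h, Matrix.mul_assoc, ← mulVec_mulVec,
      ← mulVec_mulVec, hcg, hc, mulVec_zero, zero_mulVec]

end Companion

section Splitting

variable {F : Type*} [Field F] [StarRing F]

/-- `f` represents the nontrivial class of selfadjoint elements modulo norms in `F[X] / p`. -/
structure PolyNormRep (p f : F[X]) : Prop where
  star_eq : star f = f
  not_dvd : ¬ p ∣ f
  not_norm : ¬ ∃ a, p ∣ a * star a - f
  class_eq : ∀ c, star c = c → ¬ p ∣ c →
    ∃ a, p ∣ c * (a * star a) - 1 ∨ p ∣ c * (a * star a) - f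
  sum_norm : ∃ a b, p ∣ a * star a + b * star b - f

lemma star_half_add [CharZero F] (c : F[X]) :
    star (C (2⁻¹ : F) * (c + star c)) = C (2⁻¹ : F) * (c + star c) := by
  have h2 : star (2⁻¹ : F) = 2⁻¹ := by rw [star_inv₀]; simp
  rw [star_mul', polyStar_C, h2, star_add, star_star, add_comm]

lemma isCoprime_of_not_dvd {p g : F[X]} (hp : Irreducible p) (h : ¬ p ∣ g) : IsCoprime p g :=
  hp.coprime_iff_not_dvd.2 h

/-- Hensel lifting of square classes of selfadjoint polynomials. -/
lemma exists_sq_mul_sub_dvd [CharZero F] {p g h : F[X]} (hp : Irreducible p) (hps : star p = p)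
    (hg : star g = g) (hh : star h = h) (hpg : ¬ p ∣ g) (hgh : p ∣ g - h) (l : ℕ) :
    ∃ b, star b = b ∧ p ^ (l + 1) ∣ b * b * g - h := by
  induction l with
  | zero => exact ⟨1, by simp, by simpa using hgh⟩
  | succ l ih =>
    obtain ⟨b, hb, s, hs⟩ := ih
    have hpb : ¬ p ∣ b := by
      intro hd
      have h1 : p ∣ b * b * g - h := hs ▸ (dvd_pow_self p (Nat.succ_ne_zero l)).mul_right s
      have h2 : p ∣ h := (dvd_sub_right ((hd.mul_right b).mul_right g)).1 h1
      exact hpg ((dvd_sub_left h2).1 hgh)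
    have hss : star s = s := by
      have h1 := congrArg star hs
      simp only [star_sub, star_mul', star_pow, hps, hb, hg, hh] at h1
      exact mul_left_cancel₀ (pow_ne_zero _ hp.ne_zero) (h1.symm.trans hs)
    have h2 : ¬ p ∣ (2 * (b * g)) := by
      intro hd
      rcases hp.prime.dvd_or_dvd hd with h | h
      · have : IsUnit (2 : F[X]) := by
          rw [show (2 : F[X]) = C 2 from (map_ofNat C 2).symm]
          exact isUnit_C.2 (isUnit_iff_ne_zero.2 two_ne_zero)
        exact hp.not_isUnit (isUnit_of_dvd_unit h this)
      · exact (hp.prime.dvd_or_dvd h).elim hpb hpg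
    obtain ⟨x, y, hxy⟩ := isCoprime_of_not_dvd hp h2
    have hr0 : p ∣ s + 2 * (b * g) * (-s * y) := ⟨s * x, by linear_combination s * (-hxy)⟩
    set r0 := -s * y
    have hr0' : p ∣ s + 2 * (b * g) * star r0 := by
      have := polyStar_dvd_polyStar.2 hr0
      simpa [hps, hss, hb, hg, star_mul'] using this
    set r := C (2⁻¹ : F) * (r0 + star r0) with hr
    have hrs : star r = r := star_half_add r0
    have hC : C (2⁻¹ : F) * 2 = 1 := by
      rw [show (2 : F[X]) = C 2 from (map_ofNat C 2).symm, ← C_mul, inv_mul_cancel₀ two_ne_zero, C_1]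
    have hr1 : p ∣ s + 2 * (b * g) * r := by
      have := (dvd_add hr0 hr0').mul_left (C (2⁻¹ : F))
      convert this using 1
      rw [hr]; linear_combination (-s) * hC
    obtain ⟨t, ht⟩ := hr1
    refine ⟨b + p ^ (l + 1) * r, by simp [hb, hps, hrs, star_mul'],
      t + p ^ l * (r * r * g), ?_⟩
    linear_combination hs + p ^ (l + 1) * ht

variable {ι κ : Type} [Fintype ι] [DecidableEq ι] [Fintype κ] [DecidableEq κ]

lemma exists_star_dotProduct_ne_zero (hne : ∃ a : F, star a ≠ a) {H : Matrix ι ι F}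
    (h0 : H ≠ 0) : ∃ v : ι → F, star v ⬝ᵥ H *ᵥ v ≠ 0 := by
  by_contra! hall
  obtain ⟨a, ha⟩ := hne
  have hpol : ∀ x y : ι → F, star x ⬝ᵥ H *ᵥ y + star y ⬝ᵥ H *ᵥ x = 0 := by
    intro x y
    have := hall (x + y)
    simp only [star_add, mulVec_add, add_dotProduct, dotProduct_add, hall] at this
    linear_combination this
  have hzero : ∀ x y : ι → F, star x ⬝ᵥ H *ᵥ y = 0 := by
    intro x y
    have h1 := hpol x y
    have h2 := hpol x (a • y)
    simp only [star_smul, mulVec_smul, smul_dotProduct, dotProduct_smul, smul_eq_mul] at h2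
    have h3 : (a - star a) * (star x ⬝ᵥ H *ᵥ y) = 0 := by linear_combination h2 - star a * h1
    exact (mul_eq_zero.1 h3).resolve_left (sub_ne_zero.2 ha.symm)
  apply h0
  ext i j
  simpa [Pi.star_single] using hzero (Pi.single i 1) (Pi.single j 1)

/-- A subspace invariant under `A⁻¹ B` on which `A` is nondegenerate splits off. -/
lemma exists_pairSum_of_invariant {A B T : Matrix ι ι F} (hA : Aᴴ = A) (hB : Bᴴ = B)
    (hT : A * T = B) {X : Matrix ι κ F} {Φ : Matrix κ κ F} (hX : T * X = X * Φ)
    (hG : IsUnit (Xᴴ * A * X).det) :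
    ∃ (m : ℕ) (P' : MatPair F (Fin m)), IsHermPair P' ∧
      PairCong (A, B) (pairSum (Xᴴ * A * X, Xᴴ * A * X * Φ) P') := by
  set G := Xᴴ * A * X with hGdef
  have hAT : Tᴴ * A = A * T := by rw [hT, ← hB, ← hT, conjTranspose_mul, hA]
  have hXA : Φᴴ * (Xᴴ * A) = Xᴴ * B := by
    rw [← Matrix.mul_assoc, ← conjTranspose_mul, ← hX, conjTranspose_mul, Matrix.mul_assoc, hAT,
      hT]
  have hGΦ : Φᴴ * G = G * Φ := by
    rw [hGdef, ← Matrix.mul_assoc, hXA, ← hT]; simp only [Matrix.mul_assoc, hX]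
  refine exists_pairSum_of_retract ⟨hA, hB⟩ (X := X) (Y := G⁻¹ * (Xᴴ * A)) ?_ ?_ ?_
  · rw [Matrix.mul_assoc, ← hGdef, Matrix.nonsing_inv_mul _ hG]
  · rw [← Matrix.mul_assoc, Matrix.mul_nonsing_inv _ hG, Matrix.one_mul]
  · change Xᴴ * B = G * Φ * _
    rw [← hGΦ, ← Matrix.mul_assoc, Matrix.mul_assoc Φᴴ, Matrix.mul_nonsing_inv _ hG,
      Matrix.mul_one, hXA]

lemma isUnit_det_of_injective {H : Matrix ι ι F} (h : ∀ c, H *ᵥ c = 0 → c = 0) :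
    IsUnit H.det := by
  rw [isUnit_iff_ne_zero]
  intro h0
  obtain ⟨v, hv, hv0⟩ := exists_mulVec_eq_zero_iff.2 h0
  exact hv (h v hv0)

lemma natDegree_pow_succ_pos {p : F[X]} (hpi : Irreducible p) (l : ℕ) :
    0 < (p ^ (l + 1)).natDegree := by
  rw [natDegree_pow]; exact Nat.mul_pos l.succ_pos hpi.natDegree_pos

lemma minpoly_eq_pow_mul {p : F[X]} (hpi : Irreducible p) {T : Matrix ι ι F}
    (hpT : p ∣ minpoly F T) : ∃ l q, minpoly F T = p ^ (l + 1) * q ∧ ¬ p ∣ q := by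
  have hm0 := minpoly.ne_zero (Matrix.isIntegral T)
  obtain ⟨k, q, hq, hk⟩ := (FiniteMultiplicity.of_prime_left hpi.prime hm0).exists_eq_pow_mul_and_not_dvd
    |> fun ⟨q, h1, h2⟩ => (⟨_, q, h2, h1⟩ : ∃ k q, ¬ p ∣ q ∧ minpoly F T = p ^ k * q)
  cases k with
  | zero => rw [hk] at hpT; exact absurd (by simpa using hpT) hq
  | succ l => exact ⟨l, q, hk, hq⟩

lemma aeval_ne_zero_of_not_dvd {T : Matrix ι ι F} {g : F[X]} (h : ¬ minpoly F T ∣ g) :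
    aeval T g ≠ 0 := fun h0 => h (minpoly.dvd F T h0)

/-- Splitting off a block at a selfconjugate prime. -/
theorem exists_split_self (hne : ∃ a : F, star a ≠ a) {A B : Matrix ι ι F} (hA : Aᴴ = A)
    (hB : Bᴴ = B) {T : Matrix ι ι F} (hT : A * T = B) (hdet : IsUnit A.det)
    {p : F[X]} (hpm : p.Monic) (hpi : Irreducible p) (hps : star p = p) (hpT : p ∣ minpoly F T) :
    ∃ (l : ℕ) (G : Mat F (p ^ (l + 1)).natDegree), IsUnit G.det ∧ Gᴴ = G ∧
      (G * companion F (p ^ (l + 1)))ᴴ = G * companion F (p ^ (l + 1)) ∧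
      ∃ (m : ℕ) (P' : MatPair F (Fin m)), IsHermPair P' ∧
        PairCong (A, B) (pairSum (G, G * companion F (p ^ (l + 1))) P') := by
  obtain ⟨l, q, hmq, hpq⟩ := minpoly_eq_pow_mul hpi hpT
  have hAT : A * T = Tᴴ * A := by rw [hT, ← hB, ← hT, conjTranspose_mul, hA]
  set g := p ^ l * (star q * q) with hg
  have hpq' : ¬ p ∣ star q := by rw [← hps, polyStar_dvd_polyStar]; exact hpq
  have hndvd : ¬ minpoly F T ∣ g := by
    intro hd
    have h1 : p ^ l * p ∣ p ^ l * (star q * q) := by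
      rw [← pow_succ]; exact (Dvd.intro _ hmq.symm).trans hd
    have h2 := (mul_dvd_mul_iff_left (pow_ne_zero l hpi.ne_zero)).1 h1
    exact (hpi.prime.dvd_or_dvd h2).elim hpq' hpq
  have hH0 : A * aeval T g ≠ 0 := by
    intro h0
    have := congrArg (A⁻¹ * ·) h0
    simp only [← Matrix.mul_assoc, Matrix.nonsing_inv_mul _ hdet, Matrix.one_mul,
      Matrix.mul_zero] at this
    exact aeval_ne_zero_of_not_dvd hndvd this
  obtain ⟨v, hv⟩ := exists_star_dotProduct_ne_zero hne hH0
  set u := aeval T q *ᵥ v with hu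
  have hpu : aeval T (p ^ (l + 1)) *ᵥ u = 0 := by
    rw [hu, mulVec_mulVec, ← map_mul, ← hmq, minpoly.aeval, zero_mulVec]
  have hval : star u ⬝ᵥ (A * aeval T (p ^ l)) *ᵥ u ≠ 0 := by
    convert hv using 1
    rw [hu, star_mulVec, ← dotProduct_mulVec, mulVec_mulVec, mulVec_mulVec, hg]
    congr 2
    calc (aeval T q)ᴴ * (A * aeval T (p ^ l)) * aeval T q
        = ((aeval T q)ᴴ * A) * aeval T (p ^ l) * aeval T q := by simp only [Matrix.mul_assoc]
      _ = A * aeval T (star q) * aeval T (p ^ l) * aeval T q := by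
          rw [mul_aeval_eq_conjTranspose_mul hAT (star q), star_star]
      _ = _ := by simp only [Matrix.mul_assoc, ← map_mul]; congr 2; ring
  have hqm : (p ^ (l + 1)).Monic := hpm.pow _
  have hN := natDegree_pow_succ_pos hpi l
  set Φ := companion F (p ^ (l + 1))
  set X := krylov T u (p ^ (l + 1)).natDegree with hXdef
  have hX : T * X = X * Φ := mul_krylov hqm hpu
  have hX0 : X *ᵥ Pi.single ⟨0, hN⟩ 1 = u := by
    rw [hXdef, krylov_mulVec_single]; simp
  have hGΦ : Xᴴ * A * X * Φ = Φᴴ * (Xᴴ * A * X) := by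
    have : Φᴴ * Xᴴ = Xᴴ * Tᴴ := by rw [← conjTranspose_mul, ← hX, conjTranspose_mul]
    calc Xᴴ * A * X * Φ = Xᴴ * (A * T) * X := by simp only [Matrix.mul_assoc, hX]
      _ = Φᴴ * Xᴴ * A * X := by rw [hAT, this]; simp only [Matrix.mul_assoc]
      _ = _ := by simp only [Matrix.mul_assoc]
  have hGs : (Xᴴ * A * X)ᴴ = Xᴴ * A * X := by
    simp only [conjTranspose_mul, conjTranspose_conjTranspose, hA, Matrix.mul_assoc]
  have hdetG : IsUnit (Xᴴ * A * X).det := by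
    refine isUnit_det_of_injective fun c hc =>
      companion_hom_injective hN hpi hqm rfl hGΦ ?_ hc
    intro h0
    apply hval
    have h1 : star (Pi.single ⟨0, hN⟩ 1 : Fin (p ^ (l + 1)).natDegree → F) ⬝ᵥ
        (Xᴴ * A * X * aeval Φ (p ^ l)) *ᵥ Pi.single ⟨0, hN⟩ 1 = 0 := by rw [h0]; simp
    rw [Matrix.mul_assoc, mul_aeval_of_mul_eq hX.symm, ← mulVec_mulVec, ← mulVec_mulVec,
      ← mulVec_mulVec, hX0, dotProduct_mulVec, ← star_mulVec, hX0] at h1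
    rw [← mulVec_mulVec]; exact h1
  obtain ⟨m, P', hP', hc⟩ := exists_pairSum_of_invariant hA hB hT hX hdetG
  exact ⟨l, _, hdetG, hGs, by rw [conjTranspose_mul, hGs, hGΦ], m, P', hP', hc⟩

/-- Splitting off a hyperbolic block at a prime that is not selfconjugate. -/
theorem exists_split_nonself {A B : Matrix ι ι F} (hA : Aᴴ = A)
    (hB : Bᴴ = B) {T : Matrix ι ι F} (hT : A * T = B) (hdet : IsUnit A.det)
    {p : F[X]} (hpm : p.Monic) (hpi : Irreducible p) (hps : star p ≠ p) (hpT : p ∣ minpoly F T) :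
    ∃ (l m : ℕ) (P' : MatPair F (Fin m)), IsHermPair P' ∧
      PairCong (A, B) (pairSum (fromBlocks 0 1 1 0, fromBlocks 0 (companion F (p ^ (l + 1)))ᴴ
        (companion F (p ^ (l + 1))) 0) P') := by
  obtain ⟨l, q, hmq, hpq⟩ := minpoly_eq_pow_mul hpi hpT
  have hAT : A * T = Tᴴ * A := by rw [hT, ← hB, ← hT, conjTranspose_mul, hA]
  have hndvd : ¬ minpoly F T ∣ p ^ l * (q * q) := by
    intro hd
    have h1 : p ^ l * p ∣ p ^ l * (q * q) := by
      rw [← pow_succ]; exact (Dvd.intro _ hmq.symm).trans hd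
    have h2 := (mul_dvd_mul_iff_left (pow_ne_zero l hpi.ne_zero)).1 h1
    exact (hpi.prime.dvd_or_dvd h2).elim hpq hpq
  obtain ⟨i, j, hij⟩ : ∃ i j, aeval T (p ^ l * (q * q)) i j ≠ 0 := by
    by_contra! h
    exact aeval_ne_zero_of_not_dvd hndvd (Matrix.ext h)
  set v := aeval T q *ᵥ Pi.single j 1 with hv
  set f := aeval Tᵀ q *ᵥ Pi.single i 1 with hf
  have hqm : (p ^ (l + 1)).Monic := hpm.pow _
  have hN := natDegree_pow_succ_pos hpi l
  have htr : ∀ g : F[X], aeval Tᵀ g = (aeval T g)ᵀ := by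
    intro g
    induction g using Polynomial.induction_on' with
    | add g h hg hh => simp [hg, hh]
    | monomial n a =>
      rw [← C_mul_X_pow_eq_monomial]
      simp [transpose_pow, Algebra.algebraMap_eq_smul_one]
  have hpv : aeval T (p ^ (l + 1)) *ᵥ v = 0 := by
    rw [hv, mulVec_mulVec, ← map_mul, ← hmq, minpoly.aeval, zero_mulVec]
  have hpf : aeval Tᵀ (p ^ (l + 1)) *ᵥ f = 0 := by
    rw [hf, mulVec_mulVec, ← map_mul, ← hmq, htr, minpoly.aeval, transpose_zero, zero_mulVec]
  have hfv : f ⬝ᵥ aeval T (p ^ l) *ᵥ v ≠ 0 := by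
    convert hij using 1
    rw [hf, hv, htr, mulVec_transpose, ← dotProduct_mulVec, mulVec_mulVec, mulVec_mulVec,
      ← map_mul, ← map_mul, single_one_dotProduct, mulVec_single_one, col_apply,
      show q * p ^ l * q = p ^ l * (q * q) by ring]
  set Φ := companion F (p ^ (l + 1))
  set X₁ := krylov T v (p ^ (l + 1)).natDegree with hX₁def
  set R := (krylov Tᵀ f (p ^ (l + 1)).natDegree)ᵀ with hRdef
  have hX₁ : T * X₁ = X₁ * Φ := mul_krylov hqm hpv
  have hR : R * T = Φᵀ * R := by
    have := congrArg transpose (mul_krylov hqm hpf)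
    simpa only [transpose_mul, transpose_transpose] using this
  have hX0 : X₁ *ᵥ Pi.single ⟨0, hN⟩ 1 = v := by
    rw [hX₁def, krylov_mulVec_single]; simp
  have hR0 : Pi.single ⟨0, hN⟩ 1 ᵥ* R = f := by
    rw [hRdef, vecMul_transpose, krylov_mulVec_single]; simp
  have hHΦ : R * X₁ * Φ = Φᵀ * (R * X₁) := by
    rw [Matrix.mul_assoc, ← hX₁, ← Matrix.mul_assoc, hR, Matrix.mul_assoc]
  have hdetH : IsUnit (R * X₁).det := by
    refine isUnit_det_of_injective fun c hc =>
      companion_hom_injective hN hpi hqm rfl hHΦ ?_ hc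
    intro h0
    apply hfv
    have h1 : (Pi.single ⟨0, hN⟩ 1 : Fin (p ^ (l + 1)).natDegree → F) ⬝ᵥ
        (R * X₁ * aeval Φ (p ^ l)) *ᵥ Pi.single ⟨0, hN⟩ 1 = 0 := by rw [h0]; simp
    rw [Matrix.mul_assoc, mul_aeval_of_mul_eq hX₁.symm, ← mulVec_mulVec, ← mulVec_mulVec, hX0,
      dotProduct_mulVec, hR0] at h1
    exact h1
  set H := R * X₁ with hH
  have hHinv : H⁻¹ * Φᵀ = Φ * H⁻¹ := by
    have := congrArg (fun M => H⁻¹ * M * H⁻¹) hHΦ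
    simp only [Matrix.mul_assoc, Matrix.mul_nonsing_inv _ hdetH, Matrix.mul_one] at this
    rw [← Matrix.mul_assoc, Matrix.nonsing_inv_mul _ hdetH, Matrix.one_mul] at this
    exact this.symm
  set X₂ := (H⁻¹ * R * A⁻¹)ᴴ with hX₂def
  have hX₂A : X₂ᴴ * A = H⁻¹ * R := by
    rw [hX₂def, conjTranspose_conjTranspose, Matrix.mul_assoc, Matrix.nonsing_inv_mul _ hdet,
      Matrix.mul_one]
  have hX₂ : T * X₂ = X₂ * Φᴴ := by
    have h1 : X₂ᴴ * Tᴴ * A = Φ * X₂ᴴ * A := by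
      rw [Matrix.mul_assoc, ← hAT, ← Matrix.mul_assoc, hX₂A, Matrix.mul_assoc, hR,
        ← Matrix.mul_assoc, hHinv, Matrix.mul_assoc, Matrix.mul_assoc, hX₂A]
    have h2 := congrArg (· * A⁻¹) h1
    simp only [Matrix.mul_assoc, Matrix.mul_nonsing_inv _ hdet, Matrix.mul_one] at h2
    have h3 := congrArg conjTranspose h2
    simpa only [conjTranspose_mul, conjTranspose_conjTranspose] using h3
  have hcop : IsCoprime (p ^ (l + 1)) (star (p ^ (l + 1))) := by
    rw [star_pow]
    refine IsCoprime.pow (isCoprime_of_not_dvd hpi fun hd => hps ?_)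
    exact (dvd_of_irreducible_of_dvd hpm hpi (polyStar_monic hpm) (polyStar_irreducible hpi)
      hd).symm
  have hΦ0 : aeval Φ (p ^ (l + 1)) = 0 := aeval_companion_self hN hqm
  have hΦ0' : aeval Φᴴ (star (p ^ (l + 1))) = 0 := by
    rw [← aeval_conjTranspose, hΦ0, conjTranspose_zero]
  obtain ⟨a, b, hab⟩ := hcop
  have hvanish : ∀ {Ψ Ψ' S : Mat F (p ^ (l + 1)).natDegree} {g h : F[X]}, a * g + b * h = 1 ∨
      b * g + a * h = 1 → S * Ψ = Ψ' * S → aeval Ψ g = 0 → aeval Ψ' h = 0 → S = 0 := by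
    intro Ψ Ψ' S g h hgh hS hg hh
    have h1 : ∀ x y : F[X], x * g + y * h = 1 → S = 0 := by
      intro x y hxy
      calc S = S * aeval Ψ (x * g + y * h) := by rw [hxy]; simp
        _ = aeval Ψ' (y * h) * S := by
          rw [map_add, map_mul _ x, hg, Matrix.mul_zero, zero_add, mul_aeval_of_mul_eq hS]
        _ = 0 := by rw [map_mul, hh]; simp
    exact hgh.elim (h1 _ _) (h1 _ _)
  have h11 : X₁ᴴ * A * X₁ = 0 := by
    refine hvanish (Or.inl hab) (Ψ := Φ) (Ψ' := Φᴴ) ?_ hΦ0 hΦ0'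
    have : Φᴴ * X₁ᴴ = X₁ᴴ * Tᴴ := by rw [← conjTranspose_mul, ← hX₁, conjTranspose_mul]
    rw [Matrix.mul_assoc, ← hX₁, ← Matrix.mul_assoc, Matrix.mul_assoc X₁ᴴ, hAT,
      ← Matrix.mul_assoc, ← this]
    simp only [Matrix.mul_assoc]
  have h22 : X₂ᴴ * A * X₂ = 0 := by
    refine hvanish (Or.inr (by linear_combination hab)) (Ψ := Φᴴ) (Ψ' := Φ) ?_ hΦ0' hΦ0
    have : Φ * X₂ᴴ = X₂ᴴ * Tᴴ := by
      rw [← conjTranspose_conjTranspose Φ, ← conjTranspose_mul, ← hX₂, conjTranspose_mul]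
    rw [Matrix.mul_assoc, ← hX₂, ← Matrix.mul_assoc, Matrix.mul_assoc X₂ᴴ, hAT,
      ← Matrix.mul_assoc, ← this]
    simp only [Matrix.mul_assoc]
  have h21 : X₂ᴴ * A * X₁ = 1 := by
    rw [hX₂A, Matrix.mul_assoc, ← hH, Matrix.nonsing_inv_mul _ hdetH]
  have h12 : X₁ᴴ * A * X₂ = 1 := by
    have := congrArg conjTranspose h21
    simpa [conjTranspose_mul, hA, Matrix.mul_assoc] using this
  have hG : (fromCols X₁ X₂)ᴴ * A * fromCols X₁ X₂ = fromBlocks 0 1 1 0 := by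
    rw [conjTranspose_fromCols_eq_fromRows_conjTranspose, fromRows_mul, fromRows_mul_fromCols,
      h11, h12, h21, h22]
  have hXX : T * fromCols X₁ X₂ = fromCols X₁ X₂ * fromBlocks Φ 0 0 Φᴴ := by
    rw [mul_fromCols, fromCols_mul_fromBlocks, hX₁, hX₂]; simp
  have hGdet : IsUnit ((fromCols X₁ X₂)ᴴ * A * fromCols X₁ X₂).det := by
    rw [hG]
    refine (Matrix.isUnit_iff_isUnit_det _).1 ⟨⟨fromBlocks 0 1 1 0, fromBlocks 0 1 1 0, ?_, ?_⟩,
      rfl⟩ <;> simp [fromBlocks_multiply]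
  obtain ⟨m, P', hP', hc⟩ := exists_pairSum_of_invariant hA hB hT hXX hGdet
  rw [hG, fromBlocks_multiply] at hc
  simp only [Matrix.zero_mul, Matrix.mul_zero, Matrix.one_mul, add_zero, zero_add] at hc
  exact ⟨l, m, P', hP', hc⟩

end Splitting

section NormalForm

variable {F : Type*} [Field F] [StarRing F]
variable {ι κ μ : Type} [Fintype ι] [DecidableEq ι] [Fintype κ] [DecidableEq κ]
  [Fintype μ] [DecidableEq μ]

lemma aeval_eq_of_dvd {T : Matrix ι ι F} {q g h : F[X]} (hq : aeval T q = 0) (hgh : q ∣ g - h) :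
    aeval T g = aeval T h := by
  obtain ⟨k, hk⟩ := hgh
  have := congrArg (aeval T) hk
  rw [map_sub, map_mul, hq, zero_mul] at this
  exact sub_eq_zero.1 this

lemma aeval_mul_comm (T : Matrix ι ι F) (g h : F[X]) :
    aeval T g * aeval T h = aeval T h * aeval T g := by
  rw [← map_mul, ← map_mul, mul_comm]

lemma exists_inverse_aeval {T : Matrix ι ι F} {q s : F[X]} (hq : aeval T q = 0)
    (h : IsCoprime q s) : ∃ k : F[X], aeval T s * aeval T k = 1 ∧ aeval T k * aeval T s = 1 := by
  obtain ⟨x, y, hxy⟩ := h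
  have h1 : aeval T y * aeval T s = 1 := by
    rw [← map_mul, aeval_eq_of_dvd hq (h := 1) ⟨-x, by linear_combination hxy⟩, map_one]
  exact ⟨y, by rw [aeval_mul_comm, h1], h1⟩

/-- The pair of forms `(N, N T) g(T)`. -/
def polyPair (N T : Matrix ι ι F) (g : F[X]) : MatPair F ι := (N * aeval T g, N * T * aeval T g)

lemma polyPair_one (N T : Matrix ι ι F) : polyPair N T 1 = (N, N * T) := by simp [polyPair]

lemma conjTranspose_aeval_mul_mul {N T : Matrix ι ι F} (h : N * T = Tᴴ * N) (s g : F[X]) :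
    (aeval T s)ᴴ * (N * aeval T g) = N * aeval T (star s * g) := by
  rw [← Matrix.mul_assoc, ← star_star s, ← mul_aeval_eq_conjTranspose_mul h, Matrix.mul_assoc,
    ← map_mul, star_star]

lemma polyPair_snd (N T : Matrix ι ι F) (g : F[X]) :
    (polyPair N T g).2 = N * aeval T (X * g) := by
  simp [polyPair, Matrix.mul_assoc]

lemma polyPair_cong {N T : Matrix ι ι F} (h : N * T = Tᴴ * N) {q : F[X]} (hq : aeval T q = 0)
    {s g g' : F[X]} (hs : IsCoprime q s) (hg : q ∣ star s * g * s - g') :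
    PairCong (polyPair N T g) (polyPair N T g') := by
  obtain ⟨k, h1, h2⟩ := exists_inverse_aeval hq hs
  refine ⟨aeval T s, aeval T k, h1, h2, ?_, ?_⟩
  · change (aeval T s)ᴴ * (N * aeval T g) * aeval T s = N * aeval T g'
    rw [conjTranspose_aeval_mul_mul h, Matrix.mul_assoc, ← map_mul, aeval_eq_of_dvd hq hg]
  · rw [polyPair_snd, polyPair_snd, conjTranspose_aeval_mul_mul h, Matrix.mul_assoc, ← map_mul]
    rw [aeval_eq_of_dvd hq (hg.mul_left X |> fun h => (show q ∣ star s * (X * g) * s - X * g' by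
      convert h using 1; ring))]

/-- Two copies of the twisted form are two copies of the untwisted one. -/
lemma polyPair_fusion {N T : Matrix ι ι F} (h : N * T = Tᴴ * N) {q : F[X]} (hq : aeval T q = 0)
    {f a b : F[X]} (hf : IsCoprime q f) (hab : q ∣ a * star a + b * star b - f) :
    PairCong (pairSum (polyPair N T 1) (polyPair N T 1))
      (pairSum (polyPair N T f) (polyPair N T f)) := by
  obtain ⟨k, h1, h2⟩ := exists_inverse_aeval hq hf
  have hf1 : aeval T (a * star a + b * star b) = aeval T f := aeval_eq_of_dvd hq hab
  set φ := aeval T (R := F)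
  have key : ∀ g : F[X], (fromBlocks (φ a) (φ (-star b)) (φ b) (φ (star a)))ᴴ *
      fromBlocks (N * φ g) 0 0 (N * φ g) * fromBlocks (φ a) (φ (-star b)) (φ b) (φ (star a)) =
      fromBlocks (N * φ (g * (a * star a + b * star b))) 0 0
        (N * φ (g * (a * star a + b * star b))) := by
    intro g
    rw [fromBlocks_conjTranspose, fromBlocks_multiply, fromBlocks_multiply]
    simp only [conjTranspose_aeval_mul_mul h, φ, Matrix.mul_zero, zero_add, add_zero]
    simp only [Matrix.mul_assoc, ← map_mul, ← Matrix.mul_add, ← map_add, star_neg, star_star]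
    congr 2
    · congr 1; ring
    · rw [show star a * g * -star b + star b * g * star a = 0 by ring]; simp
    · rw [show -b * g * a + a * g * b = 0 by ring]; simp
    · congr 1; ring
  have hgf : ∀ g, φ (g * (a * star a + b * star b)) = φ (g * f) := by
    intro g; rw [map_mul, hf1, map_mul]
  have hf1' : φ a * φ (star a) + φ b * φ (star b) = φ f := by rw [← hf1]; simp
  have c1 : ∀ g h, φ g * φ h = φ h * φ g := aeval_mul_comm T
  have hinv : fromBlocks (φ a) (φ (-star b)) (φ b) (φ (star a)) *
      fromBlocks (φ (star a * k)) (φ (star b * k)) (φ (-b * k)) (φ (a * k)) = 1 := by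
    rw [fromBlocks_multiply, ← fromBlocks_one]
    simp only [← map_mul, ← map_add]
    congr 1
    · rw [show a * (star a * k) + -star b * (-b * k) = (a * star a + b * star b) * k by ring,
        map_mul, hf1, h1]
    · rw [show a * (star b * k) + -star b * (a * k) = 0 by ring, map_zero]
    · rw [show b * (star a * k) + star a * (-b * k) = 0 by ring, map_zero]
    · rw [show b * (star b * k) + star a * (a * k) = (a * star a + b * star b) * k by ring,
        map_mul, hf1, h1]
  refine ⟨fromBlocks (φ a) (φ (-star b)) (φ b) (φ (star a)),
    fromBlocks (φ (star a * k)) (φ (star b * k)) (φ (-b * k)) (φ (a * k)), hinv,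
    mul_eq_one_comm.1 hinv, ?_, ?_⟩
  · have := key 1
    rw [hgf, one_mul] at this
    exact this
  · have := key X
    rw [hgf] at this
    change _ᴴ * fromBlocks (polyPair N T 1).2 0 0 (polyPair N T 1).2 * _ =
      fromBlocks (polyPair N T f).2 0 0 (polyPair N T f).2
    rw [polyPair_snd, polyPair_snd, mul_one]
    exact this

lemma mul_eq_conjTranspose_mul_of_herm {N T : Matrix ι ι F} (hN : Nᴴ = N)
    (hNT : (N * T)ᴴ = N * T) : N * T = Tᴴ * N := by
  rw [← hNT, conjTranspose_mul, hN]

section AtPrime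

variable [CharZero F] {p f : F[X]} {N : Matrix ι ι F} {T : Matrix ι ι F} {l : ℕ}

lemma isCoprime_pow_of_not_dvd {p g : F[X]} (hp : Irreducible p) (h : ¬ p ∣ g) (k : ℕ) :
    IsCoprime (p ^ k) g := (isCoprime_of_not_dvd hp h).pow_left

/-- Selfadjoint multipliers reduce to one of the two representatives. -/
lemma PolyNormRep.polyPair_cong (hf : PolyNormRep p f) (hpi : Irreducible p) (hps : star p = p)
    (h : N * T = Tᴴ * N) (hq : aeval T (p ^ (l + 1)) = 0) {c : F[X]} (hc : star c = c)
    (hpc : ¬ p ∣ c) :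
    PairCong (polyPair N T c) (polyPair N T 1) ∨ PairCong (polyPair N T c) (polyPair N T f) := by
  have key : ∀ a g, star g = g → ¬ p ∣ g → p ∣ c * (a * star a) - g →
      PairCong (polyPair N T c) (polyPair N T g) := by
    intro a g hgs hpg hd
    have hp1 : ¬ p ∣ c * (a * star a) := fun h' => hpg ((dvd_sub_right h').1 hd)
    obtain ⟨b, hb, hbd⟩ := exists_sq_mul_sub_dvd hpi hps (g := c * (a * star a)) (h := g)
      (by simp [star_mul', hc, mul_comm]) hgs hp1 hd l
    have hpa : ¬ p ∣ a := fun h' => hp1 ((h'.mul_right _).mul_left _)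
    have hpb : ¬ p ∣ b := fun h' => hpg ((dvd_sub_right ((h'.mul_right b).mul_right _)).1
      ((dvd_pow_self p l.succ_ne_zero).trans hbd))
    refine Can.polyPair_cong h hq (s := a * b) (isCoprime_pow_of_not_dvd hpi ?_ _) ?_
    · exact fun h' => (hpi.prime.dvd_or_dvd h').elim hpa hpb
    · convert hbd using 1
      rw [star_mul', hb]; ring
  obtain ⟨a, ha | ha⟩ := hf.class_eq c hc hpc
  · exact Or.inl (key a 1 (by simp) (fun h' => hpi.not_isUnit (isUnit_of_dvd_one h')) ha)
  · exact Or.inr (key a f hf.star_eq hf.not_dvd ha)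

lemma PolyNormRep.polyPair_fusion (hf : PolyNormRep p f) (hpi : Irreducible p) (hps : star p = p)
    (h : N * T = Tᴴ * N) (hq : aeval T (p ^ (l + 1)) = 0) :
    PairCong (pairSum (polyPair N T f) (polyPair N T f))
      (pairSum (polyPair N T 1) (polyPair N T 1)) := by
  obtain ⟨a, b, hab⟩ := hf.sum_norm
  have hg : ¬ p ∣ a * star a + b * star b := fun h' => hf.not_dvd ((dvd_sub_right h').1 hab)
  obtain ⟨c, hc, hcd⟩ := exists_sq_mul_sub_dvd hpi hps (g := a * star a + b * star b) (h := f)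
    (by simp [star_mul', mul_comm]) hf.star_eq hg hab l
  refine (Can.polyPair_fusion h hq (a := c * a) (b := c * b)
    (isCoprime_pow_of_not_dvd hpi hf.not_dvd _) ?_).symm
  convert hcd using 1
  rw [star_mul', star_mul', hc]; ring

end AtPrime

section Companion

variable [CharZero F] {p f : F[X]} {l : ℕ}

/-- Any two nonsingular Hermitian forms adapted to a companion block agree up to a twist. -/
theorem PolyNormRep.pairCong_normal (hf : PolyNormRep p f) (hpm : p.Monic) (hpi : Irreducible p)
    (hps : star p = p) {N G : Mat F (p ^ (l + 1)).natDegree}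
    (hN : IsUnit N.det) (hNs : Nᴴ = N)
    (hNΦ : (N * companion F (p ^ (l + 1)))ᴴ = N * companion F (p ^ (l + 1)))
    (hG : IsUnit G.det) (hGs : Gᴴ = G)
    (hGΦ : (G * companion F (p ^ (l + 1)))ᴴ = G * companion F (p ^ (l + 1))) :
    PairCong (G, G * companion F (p ^ (l + 1))) (polyPair N (companion F (p ^ (l + 1))) 1) ∨
    PairCong (G, G * companion F (p ^ (l + 1))) (polyPair N (companion F (p ^ (l + 1))) f) := by
  have hpos := natDegree_pow_succ_pos hpi l
  have hqm : (p ^ (l + 1)).Monic := hpm.pow _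
  have hq := aeval_companion_self hpos hqm
  set Φ := companion F (p ^ (l + 1))
  have hN1 := mul_eq_conjTranspose_mul_of_herm hNs hNΦ
  have hG1 := mul_eq_conjTranspose_mul_of_herm hGs hGΦ
  have hcomm : (N⁻¹ * G) * Φ = Φ * (N⁻¹ * G) := by
    have h1 : N⁻¹ * Φᴴ = Φ * N⁻¹ := by
      have := congrArg (fun M => N⁻¹ * M * N⁻¹) hN1
      simp only [← Matrix.mul_assoc, Matrix.nonsing_inv_mul _ hN, Matrix.one_mul] at this
      rw [this, Matrix.mul_assoc, Matrix.mul_nonsing_inv _ hN, Matrix.mul_one]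
    rw [Matrix.mul_assoc, hG1, ← Matrix.mul_assoc, h1, Matrix.mul_assoc]
  obtain ⟨c0, hc0⟩ := exists_aeval_of_commute hpos hqm hcomm
  have hGc0 : G = N * aeval Φ c0 := by
    rw [← hc0, ← Matrix.mul_assoc, Matrix.mul_nonsing_inv _ hN, Matrix.one_mul]
  have hGc0' : G = N * aeval Φ (star c0) := by
    rw [← hGs, hGc0, conjTranspose_mul, hNs, mul_aeval_eq_conjTranspose_mul hN1, star_star]
  set c := C (2⁻¹ : F) * (c0 + star c0) with hcdef
  have hc : star c = c := star_half_add c0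
  have hGc : G = N * aeval Φ c := by
    rw [hcdef, map_mul, map_add, aeval_C, Algebra.algebraMap_eq_smul_one, smul_mul_assoc,
      Matrix.one_mul, Matrix.mul_smul, Matrix.mul_add, ← hGc0, ← hGc0', ← two_smul F G, smul_smul,
      inv_mul_cancel₀ two_ne_zero, one_smul]
  have hpc : ¬ p ∣ c := by
    intro hd
    have h1 : aeval Φ (c ^ (l + 1)) = 0 := by
      obtain ⟨k, hk⟩ := pow_dvd_pow_of_dvd hd (l + 1)
      rw [hk, map_mul, hq, zero_mul]
    have h2 : IsUnit (aeval Φ c).det := by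
      rw [hGc, det_mul] at hG
      exact isUnit_of_mul_isUnit_right hG
    have h3 := congrArg Matrix.det h1
    have : Nonempty (Fin (p ^ (l + 1)).natDegree) := ⟨⟨0, hpos⟩⟩
    rw [map_pow, det_pow, det_zero] at h3
    exact (h2.pow (l + 1)).ne_zero h3
  have hpair : ((G, G * Φ) : MatPair F _) = polyPair N Φ c := by
    have h1 : Φ * aeval Φ c = aeval Φ c * Φ := mul_aeval_of_mul_eq rfl c
    rw [polyPair, Matrix.mul_assoc, h1, ← Matrix.mul_assoc, ← hGc]
  rw [hpair]
  exact hf.polyPair_cong hpi hps hN1 hq hc hpc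

end Companion

end NormalForm

section Infinity

variable {F : Type*} [Field F] [StarRing F]
variable {ι κ μ : Type} [Fintype ι] [DecidableEq ι] [Fintype κ] [DecidableEq κ]
  [Fintype μ] [DecidableEq μ]

lemma exists_fin_pairCong (P : MatPair F ι) : ∃ (m : ℕ) (P' : MatPair F (Fin m)), PairCong P P' := by
  refine ⟨Fintype.card ι, (P.1.submatrix (Fintype.equivFin ι).symm (Fintype.equivFin ι).symm,
    P.2.submatrix (Fintype.equivFin ι).symm (Fintype.equivFin ι).symm), ?_⟩
  exact PairCong.of_equiv (Fintype.equivFin ι) (by simp) (by simp)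

/-- A change of basis of the pencil spanned by the pair. -/
lemma PairCong.shear {P : MatPair F ι} {Q : MatPair F κ} (h : PairCong P Q) (c : F) :
    PairCong (P.2, P.1 + c • P.2) (Q.2, Q.1 + c • Q.2) := by
  obtain ⟨S, S', h1, h2, h3, h4⟩ := h
  refine ⟨S, S', h1, h2, h4, ?_⟩
  simp only [Matrix.mul_add, Matrix.add_mul, Matrix.mul_smul, Matrix.smul_mul, h3, h4]

lemma X_dvd_minpoly {T : Matrix ι ι F} (h : ¬ IsUnit T.det) : X ∣ minpoly F T := by
  rw [isUnit_iff_ne_zero, not_not] at h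
  obtain ⟨v, hv, hv0⟩ := exists_mulVec_eq_zero_iff.2 h
  rw [X_dvd_iff]
  have h1 : aeval T (minpoly F T) *ᵥ v = 0 := by rw [minpoly.aeval, zero_mulVec]
  rw [← divX_mul_X_add (minpoly F T), map_add, map_mul, aeval_X, aeval_C, add_mulVec,
    ← mulVec_mulVec, hv0, mulVec_zero, zero_add, Algebra.algebraMap_eq_smul_one, smul_mulVec,
    one_mulVec] at h1
  exact (smul_eq_zero.1 h1).resolve_right hv

lemma irreducible_X_pow_natDegree (l : ℕ) : ((X : F[X]) ^ (l + 1)).natDegree = l + 1 :=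
  natDegree_X_pow _

/-- The antidiagonal identity matrix. -/
def antidiag (F : Type*) [Field F] (n : ℕ) : Mat F n :=
  Matrix.of fun i j => if (i : ℕ) + (j : ℕ) + 1 = n then 1 else 0

lemma antidiag_eq (n : ℕ) : antidiag F n = (1 : Mat F n).submatrix Fin.rev id := by
  ext i j
  simp only [antidiag, of_apply, submatrix_apply, one_apply, Fin.ext_iff, Fin.val_rev, id]
  congr 1
  exact propext (by omega)

lemma antidiag_mul (n : ℕ) {ρ : Type} [Fintype ρ] (M : Matrix (Fin n) ρ F) :
    antidiag F n * M = M.submatrix Fin.rev id := by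
  rw [antidiag_eq]
  ext i j
  simp [Matrix.mul_apply, one_apply]

lemma antidiag_mul_self (n : ℕ) : antidiag F n * antidiag F n = 1 := by
  rw [antidiag_mul, antidiag_eq]; ext i j; simp; rw [Fin.rev_rev]; rfl

lemma isUnit_det_antidiag (n : ℕ) : IsUnit (antidiag F n).det :=
  IsUnit.of_mul_eq_one (antidiag F n).det (by rw [← det_mul, antidiag_mul_self, det_one])

lemma antidiag_conjTranspose (n : ℕ) : (antidiag F n)ᴴ = antidiag F n := by
  ext i j
  simp only [antidiag, conjTranspose_apply, of_apply, add_comm (i : ℕ)]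
  split_ifs <;> simp

lemma antidiag_mul_companion (l : ℕ) (i j : Fin ((X : F[X]) ^ (l + 1)).natDegree) :
    (antidiag F ((X : F[X]) ^ (l + 1)).natDegree * companion F ((X : F[X]) ^ (l + 1))) i j =
      if (i : ℕ) + (j : ℕ) + 2 = l + 1 then 1 else 0 := by
  have h := irreducible_X_pow_natDegree (F := F) l
  have hi := i.2
  have hj := j.2
  rw [antidiag_mul]
  simp only [submatrix_apply, companion, of_apply, id, Fin.val_rev, coeff_X_pow]
  split_ifs <;> first | rfl | omega | simp

lemma antidiag_mul_companion_conjTranspose (l : ℕ) :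
    (antidiag F ((X : F[X]) ^ (l + 1)).natDegree * companion F ((X : F[X]) ^ (l + 1)))ᴴ =
      antidiag F ((X : F[X]) ^ (l + 1)).natDegree * companion F ((X : F[X]) ^ (l + 1)) := by
  ext i j
  rw [conjTranspose_apply, antidiag_mul_companion, antidiag_mul_companion, add_comm (j : ℕ)]
  split_ifs <;> simp

/-- The swapped pair attached to the eigenvalue at infinity. -/
lemma polyPair_antidiag_cong (l : ℕ) (t : F) :
    PairCong (polyPair (antidiag F ((X : F[X]) ^ (l + 1)).natDegree)
      (companion F ((X : F[X]) ^ (l + 1))) (C t)).swap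
      (t • (Bpair F (l + 1)).1, t • (Bpair F (l + 1)).2) := by
  refine PairCong.of_equiv (finCongr (irreducible_X_pow_natDegree l)) ?_ ?_ <;> intro i j
  · simp only [polyPair, aeval_C, Algebra.algebraMap_eq_smul_one, Matrix.mul_smul, Matrix.mul_one,
      Prod.fst_swap, Matrix.smul_apply, antidiag_mul_companion, Bpair, of_apply, finCongr_apply,
      Fin.val_cast]
  · have h := irreducible_X_pow_natDegree (F := F) l
    simp only [polyPair, aeval_C, Algebra.algebraMap_eq_smul_one, Matrix.mul_smul, Matrix.mul_one,
      Prod.snd_swap, Matrix.smul_apply, antidiag, Bpair, of_apply, finCongr_apply,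
      Fin.val_cast, h]

lemma IsHermPair.of_cong_sum {P : MatPair F ι} {Q : MatPair F κ} {R : MatPair F μ}
    (hP : IsHermPair P) (h : PairCong P (pairSum Q R)) : IsHermPair R :=
  (hP.cong h).of_sum.2

/-- Splitting off a block at infinity from a regular pair. -/
theorem exists_split_infty [CharZero F] (hne : ∃ a : F, star a ≠ a) {A B : Matrix ι ι F}
    (hA : Aᴴ = A) (hB : Bᴴ = B) {c : F} (hc : star c = c) (hreg : IsUnit (B - c • A).det)
    (hsing : ¬ IsUnit A.det) {t : F} (ht : PolyNormRep (X : F[X]) (C t)) :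
    ∃ (n m : ℕ) (P' : MatPair F (Fin m)), 0 < n ∧ IsHermPair P' ∧
      (PairCong (A, B) (pairSum (Bpair F n) P') ∨
        PairCong (A, B) (pairSum (t • (Bpair F n).1, t • (Bpair F n).2) P')) := by
  set D := B - c • A with hD
  have hDs : Dᴴ = D := by rw [hD, conjTranspose_sub, conjTranspose_smul, hA, hB, hc]
  have hT : D * (D⁻¹ * A) = A := by
    rw [← Matrix.mul_assoc, Matrix.mul_nonsing_inv _ hreg, Matrix.one_mul]
  have hXT : X ∣ minpoly F (D⁻¹ * A) := by
    refine X_dvd_minpoly fun h => hsing ?_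
    rw [det_mul] at h
    exact isUnit_of_mul_isUnit_right h
  obtain ⟨l, G, hG, hGs, hGΦ, m, P', hP', hcong⟩ :=
    exists_split_self hne hDs hA hT hreg monic_X irreducible_X polyStar_X hXT
  have hq := aeval_companion_self (natDegree_pow_succ_pos (F := F) irreducible_X l) (monic_X.pow _)
  have hpos := natDegree_pow_succ_pos (F := F) irreducible_X l
  set Φ := companion F ((X : F[X]) ^ (l + 1))
  have hsh := hcong.shear c
  have hAB : ((A, D + c • A) : MatPair F ι) = (A, B) := by rw [hD, sub_add_cancel]
  rw [hAB] at hsh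
  set A₁ := G + c • (G * Φ) with hA₁
  have hsum : PairCong (A, B) (pairSum (G * Φ, A₁) (P'.2, P'.1 + c • P'.2)) := by
    convert hsh using 1
    simp [pairSum, fromBlocks_add, fromBlocks_smul, hA₁]
  have hA₁s : A₁ᴴ = A₁ := by rw [hA₁, conjTranspose_add, conjTranspose_smul, hGΦ, hGs, hc]
  have hA₁' : A₁ = G * aeval Φ (1 + C c * X) := by
    rw [hA₁, map_add, map_one, map_mul, aeval_C, aeval_X, Algebra.algebraMap_eq_smul_one,
      smul_mul_assoc, Matrix.one_mul, Matrix.mul_add, Matrix.mul_one, Matrix.mul_smul]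
  have hcop : IsCoprime ((X : F[X]) ^ (l + 1)) (1 + C c * X) := by
    refine isCoprime_pow_of_not_dvd irreducible_X ?_ _
    rw [X_dvd_iff]; simp
  obtain ⟨k, hk1, hk2⟩ := exists_inverse_aeval hq hcop
  have hA₁d : IsUnit A₁.det := by
    rw [hA₁', det_mul]
    exact hG.mul (IsUnit.of_mul_eq_one (aeval Φ k).det (by rw [← det_mul, hk1, det_one]))
  have hT₁ : A₁ * (aeval Φ k * Φ) = G * Φ := by
    rw [hA₁', Matrix.mul_assoc, ← Matrix.mul_assoc _ _ Φ, hk1, Matrix.one_mul]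
  have hXT₁ : X ∣ minpoly F (aeval Φ k * Φ) := by
    refine X_dvd_minpoly fun h => ?_
    rw [det_mul] at h
    have h1 := isUnit_of_mul_isUnit_right h
    have h2 : Φ ^ (l + 1) = 0 := by simpa using hq
    have h3 := congrArg Matrix.det h2
    have : Nonempty (Fin ((X : F[X]) ^ (l + 1)).natDegree) := ⟨⟨0, hpos⟩⟩
    rw [det_pow, det_zero] at h3
    exact (h1.pow (l + 1)).ne_zero h3
  obtain ⟨l₁, G₁, hG₁, hG₁s, hG₁Φ, m₁, P₁, hP₁, hcong₁⟩ :=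
    exists_split_self hne hA₁s hGΦ hT₁ hA₁d monic_X irreducible_X polyStar_X hXT₁
  obtain ⟨m₂, P₂, hP₂⟩ := exists_fin_pairCong (pairSum P₁.swap (P'.2, P'.1 + c • P'.2))
  have htot : PairCong (A, B) (pairSum (G₁, G₁ * companion F (X ^ (l₁ + 1))).swap P₂) :=
    hsum.trans (((show PairCong (G * Φ, A₁)
      (pairSum (G₁, G₁ * companion F (X ^ (l₁ + 1))).swap P₁.swap) from hcong₁.swap).sum
      (.refl _)).trans ((pairSum_assoc _ _ _).trans ((PairCong.refl _).sum hP₂)))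
  have key : ∀ s : F, PairCong (G₁, G₁ * companion F (X ^ (l₁ + 1)))
      (polyPair (antidiag F _) (companion F (X ^ (l₁ + 1))) (C s)) →
      PairCong (A, B)
        (pairSum (s • (Bpair F (l₁ + 1)).1, s • (Bpair F (l₁ + 1)).2) P₂) := fun s hs =>
    htot.trans ((hs.swap.trans (polyPair_antidiag_cong l₁ s)).sum (.refl _))
  refine ⟨l₁ + 1, m₂, P₂, l₁.succ_pos, IsHermPair.of_cong_sum ⟨hA, hB⟩ htot, ?_⟩
  rcases ht.pairCong_normal monic_X irreducible_X polyStar_X (isUnit_det_antidiag _)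
    (antidiag_conjTranspose _) (antidiag_mul_companion_conjTranspose l₁) hG₁ hG₁s hG₁Φ with h | h
  · have := key 1 (by simpa using h)
    simp only [one_smul] at this
    exact Or.inl this
  · exact Or.inr (key t h)

end Infinity

section Singular

variable {F : Type*} [Field F] [StarRing F]
variable {ι : Type} [Fintype ι] [DecidableEq ι]

/-- The matrix `[I | 0]`. -/
def initMat (F : Type*) [Field F] (ε : ℕ) : Matrix (Fin ε) (Fin (ε + 1)) F :=
  Matrix.of fun i j => if (i : ℕ) = (j : ℕ) then 1 else 0

/-- The matrix `[0 | I]`. -/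
def tailMat (F : Type*) [Field F] (ε : ℕ) : Matrix (Fin ε) (Fin (ε + 1)) F :=
  Matrix.of fun i j => if (i : ℕ) + 1 = (j : ℕ) then 1 else 0

/-- The minimal singular pair of size `2 ε + 1`. -/
def singPair (F : Type*) [Field F] [StarRing F] (ε : ℕ) : MatPair F (Fin (ε + 1) ⊕ Fin ε) :=
  (fromBlocks 0 (initMat F ε)ᴴ (initMat F ε) 0, fromBlocks 0 (tailMat F ε)ᴴ (tailMat F ε) 0)

lemma star_mulVec_dotProduct {A : Matrix ι ι F} (hA : Aᴴ = A) (x y : ι → F) :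
    star (A *ᵥ x) ⬝ᵥ y = star x ⬝ᵥ A *ᵥ y := by
  rw [star_mulVec, hA, dotProduct_mulVec]

lemma star_dotProduct_star (x y : ι → F) : star (star x ⬝ᵥ y) = star y ⬝ᵥ x := by
  rw [star_dotProduct, star_star]

lemma initMat_mul (ε : ℕ) {κ : Type} [Fintype κ] (Y : Matrix (Fin (ε + 1)) κ F) :
    initMat F ε * Y = Y.submatrix Fin.castSucc id := by
  ext i j
  have : ∀ k : Fin (ε + 1), (i : ℕ) = (k : ℕ) ↔ Fin.castSucc i = k := by
    intro k; rw [Fin.ext_iff]; rfl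
  simp only [Matrix.mul_apply, initMat, of_apply, this]
  rw [Finset.sum_eq_single (Fin.castSucc i)] <;> simp +contextual [eq_comm]

lemma tailMat_mul (ε : ℕ) {κ : Type} [Fintype κ] (Y : Matrix (Fin (ε + 1)) κ F) :
    tailMat F ε * Y = Y.submatrix Fin.succ id := by
  ext i j
  have : ∀ k : Fin (ε + 1), (i : ℕ) + 1 = (k : ℕ) ↔ Fin.succ i = k := by
    intro k; rw [Fin.ext_iff]; rfl
  simp only [Matrix.mul_apply, tailMat, of_apply, this]
  rw [Finset.sum_eq_single (Fin.succ i)] <;> simp +contextual [eq_comm]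

lemma initMat_conjTranspose_mul (ε : ℕ) {κ : Type} [Fintype κ] (Y : ℕ → κ → F) (i : Fin (ε + 1)) :
    ((initMat F ε)ᴴ * Matrix.of fun (j : Fin ε) => Y j) i = if (i : ℕ) < ε then Y i else 0 := by
  ext k
  simp only [Matrix.mul_apply, conjTranspose_apply, initMat, of_apply]
  split_ifs with h
  · rw [Finset.sum_eq_single (⟨i, h⟩ : Fin ε)]
    · simp
    · intro b _ hb
      have : (b : ℕ) ≠ i := fun h' => hb (Fin.ext h')
      simp [this]
    · simp
  · refine Finset.sum_eq_zero fun b _ => ?_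
    have : (b : ℕ) ≠ i := fun h' => h (h' ▸ b.2)
    simp [this]

lemma tailMat_conjTranspose_mul (ε : ℕ) {κ : Type} [Fintype κ] (Y : ℕ → κ → F) (i : Fin (ε + 1)) :
    ((tailMat F ε)ᴴ * Matrix.of fun (j : Fin ε) => Y j) i =
      if (i : ℕ) = 0 then 0 else Y (i - 1) := by
  ext k
  simp only [Matrix.mul_apply, conjTranspose_apply, tailMat, of_apply]
  split_ifs with h
  · refine Finset.sum_eq_zero fun b _ => ?_
    have : (b : ℕ) + 1 ≠ i := by omega
    simp [this]
  · rw [Finset.sum_eq_single (⟨i - 1, by omega⟩ : Fin ε)]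
    · have : (i : ℕ) - 1 + 1 = i := by omega
      simp [this]
    · intro b _ hb
      have : (b : ℕ) + 1 ≠ i := fun h' => hb (Fin.ext (by simp; omega))
      simp [this]
    · simp

/-- Chains dual to each other split off a minimal singular pair. -/
lemma exists_split_of_chains {A B : Matrix ι ι F} (hA : Aᴴ = A) (hB : Bᴴ = B) {ε : ℕ}
    {z w α : ℕ → ι → F} (hz0 : B *ᵥ z 0 = 0) (hz : ∀ i < ε, A *ᵥ z i = B *ᵥ z (i + 1))
    (hzε : A *ᵥ z ε = 0) (hα1 : ∀ i < ε, A *ᵥ w i = α i) (hα2 : ∀ i < ε, B *ᵥ w i = α (i + 1))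
    (hzz : ∀ i j, star (z i) ⬝ᵥ A *ᵥ z j = 0)
    (hαz : ∀ i ≤ ε, ∀ j ≤ ε, star (α i) ⬝ᵥ z j = if i = j then 1 else 0)
    (hαw : ∀ i ≤ ε, ∀ j < ε, star (α i) ⬝ᵥ w j = 0) :
    ∃ (m : ℕ) (P' : MatPair F (Fin m)), IsHermPair P' ∧
      PairCong (A, B) (pairSum (singPair F ε) P') := by
  have hvec : ∀ {k : ℕ} (v : ℕ → ι → F) {M : Matrix ι ι F}, Mᴴ = M → ∀ i : Fin k,
      ((Matrix.of fun i : Fin k => star (v i)) * M) i = star (M *ᵥ v i) := by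
    intro k v M hM i
    rw [star_mulVec, hM]; rfl
  have hdot : ∀ {k k' : ℕ} (v u : ℕ → ι → F) (i : Fin k) (j : Fin k'),
      ((Matrix.of fun i : Fin k => star (v i)) * (Matrix.of fun j : Fin k' => star (u j))ᴴ) i j =
        star (v i) ⬝ᵥ u j := by
    intro k k' v u i j
    rw [Matrix.mul_apply]
    simp [dotProduct]
  set Zs : Matrix (Fin (ε + 1)) ι F := Matrix.of fun i => star (z i) with hZs
  set Ws : Matrix (Fin ε) ι F := Matrix.of fun i => star (w i) with hWs
  set Y1 : Matrix (Fin (ε + 1)) ι F := Matrix.of fun i => star (α i) with hY1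
  set Y2 : Matrix (Fin ε) ι F := Matrix.of fun i => star (A *ᵥ z i) with hY2
  have hX : (fromCols Zsᴴ Wsᴴ)ᴴ = fromRows Zs Ws := by
    rw [conjTranspose_fromCols_eq_fromRows_conjTranspose, conjTranspose_conjTranspose,
      conjTranspose_conjTranspose]
  have hY2' : ∀ i : Fin (ε + 1), A *ᵥ z i = if (i : ℕ) < ε then A *ᵥ z i else 0 := by
    intro i
    split_ifs with h
    · rfl
    · rw [show (i : ℕ) = ε by omega, hzε]
  refine exists_pairSum_of_retract ⟨hA, hB⟩ (G := singPair F ε) (X := fromCols Zsᴴ Wsᴴ)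
    (Y := fromRows Y1 Y2) ?_ ?_ ?_
  · rw [fromRows_mul_fromCols, ← fromBlocks_one]
    congr 1
    · ext i j
      rw [hdot α z, hαz i (by omega) j (by omega), one_apply]
      simp only [Fin.ext_iff]
    · ext i j
      rw [hdot α w, hαw i (by omega) j (by omega)]; rfl
    · ext i j
      rw [hdot (fun i => A *ᵥ z i) z, star_mulVec_dotProduct hA, hzz]; rfl
    · ext i j
      rw [hdot (fun i => A *ᵥ z i) w, star_mulVec_dotProduct hA, hα1 j j.2,
        ← star_dotProduct_star, hαz j (by omega) i (by omega), one_apply]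
      simp only [Fin.ext_iff, eq_comm]
      split_ifs <;> simp
  · rw [hX]
    simp only [singPair]
    rw [fromRows_mul, fromBlocks_mul_fromRows]
    congr 1
    · rw [Matrix.zero_mul, zero_add]
      funext i
      rw [hvec z hA, initMat_conjTranspose_mul ε (fun i => star (A *ᵥ z i)), hY2' i]
      split_ifs <;> simp
    · rw [Matrix.zero_mul, add_zero]
      refine Eq.trans ?_ (initMat_mul ε Y1).symm
      funext i
      rw [hvec w hA, hα1 i i.2]; rfl
  · rw [hX]
    simp only [singPair]
    rw [fromRows_mul, fromBlocks_mul_fromRows]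
    congr 1
    · rw [Matrix.zero_mul, zero_add]
      funext i
      rw [hvec z hB, tailMat_conjTranspose_mul ε (fun i => star (A *ᵥ z i))]
      split_ifs with h
      · rw [h, hz0, star_zero]
      · rw [hz _ (by omega), Nat.sub_add_cancel (by omega)]
    · rw [Matrix.zero_mul, add_zero]
      refine Eq.trans ?_ (tailMat_mul ε Y1).symm
      funext i
      rw [hvec w hB, hα2 i i.2]; rfl

/-- A polynomial kernel vector of the pencil, recorded by its coefficients. -/
structure IsKerSeq (A B : Matrix ι ι F) (ε : ℕ) (z : ℕ → ι → F) : Prop where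
  ne_zero : z 0 ≠ 0
  zero : B *ᵥ z 0 = 0
  succ : ∀ i, A *ᵥ z i = B *ᵥ z (i + 1)
  eq_zero : ∀ i, ε < i → z i = 0

lemma IsKerSeq.last {A B : Matrix ι ι F} {ε : ℕ} {z : ℕ → ι → F} (h : IsKerSeq A B ε z) {i : ℕ}
    (hi : ε ≤ i) : A *ᵥ z i = 0 := by
  rw [h.succ, h.eq_zero _ (by omega), mulVec_zero]

lemma IsKerSeq.orth {A B : Matrix ι ι F} (hA : Aᴴ = A) (hB : Bᴴ = B) {ε : ℕ} {z : ℕ → ι → F}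
    (h : IsKerSeq A B ε z) (i j : ℕ) : star (z i) ⬝ᵥ A *ᵥ z j = 0 := by
  induction i generalizing j with
  | zero => rw [h.succ, ← star_mulVec_dotProduct hB, h.zero, star_zero, zero_dotProduct]
  | succ i ih =>
    rw [h.succ, ← star_mulVec_dotProduct hB, ← h.succ, star_mulVec_dotProduct hA, ih]

lemma exists_isKerSeq {A B : Matrix ι ι F} (h : ((X : F[X]) • A.map (C : F →+* F[X]) - B.map (C : F →+* F[X])).det = 0) :
    ∃ ε z, IsKerSeq A B ε z := by
  obtain ⟨v, hv, hv0⟩ := exists_mulVec_eq_zero_iff.2 h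
  have hco : ∀ (M : Matrix ι ι F) (k : ℕ) (i : ι),
      ((M.map (C : F →+* F[X]) *ᵥ v) i).coeff k = (M *ᵥ fun i => (v i).coeff k) i := by
    intro M k i
    simp [mulVec, dotProduct]
  rw [sub_mulVec, smul_mulVec, sub_eq_zero] at hv0
  set z : ℕ → ι → F := fun k i => (v i).coeff k with hz
  have h0 : B *ᵥ z 0 = 0 := by
    ext i
    have := congrArg (fun g => (g i).coeff 0) hv0
    simp only [Pi.smul_apply, smul_eq_mul, coeff_X_mul_zero, hco] at this
    exact this.symm
  have hs : ∀ k, A *ᵥ z k = B *ᵥ z (k + 1) := by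
    intro k
    ext i
    have := congrArg (fun g => (g i).coeff (k + 1)) hv0
    simpa only [Pi.smul_apply, smul_eq_mul, coeff_X_mul, hco] using this
  have hex : ∃ k, z k ≠ 0 := by
    by_contra! hall
    apply hv
    ext i k
    exact congrFun (hall k) i
  classical
  set s := Nat.find hex with hsdef
  have hs0 : z s ≠ 0 := Nat.find_spec hex
  refine ⟨Finset.univ.sup fun i => (v i).natDegree, fun k => z (k + s), by simpa using hs0, ?_,
    fun k => by simpa [add_right_comm] using hs (k + s), ?_⟩
  · simp only [zero_add]
    cases hk : s with
    | zero => exact h0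
    | succ t =>
      have : z t = 0 := not_not.1 (Nat.find_min hex (m := t) (by omega))
      rw [← hs, this, mulVec_zero]
  · intro k hk
    ext i
    refine coeff_eq_zero_of_natDegree_lt ?_
    have : (v i).natDegree ≤ _ :=
      Finset.le_sup (f := fun i => (v i).natDegree) (Finset.mem_univ i)
    omega

/-- A minimal kernel sequence pairs nontrivially with a chain of the pencil. -/
lemma exists_dual_chain {A B : Matrix ι ι F} (hA : Aᴴ = A) (hB : Bᴴ = B) {m : ℕ} {z : ℕ → ι → F}
    (h : IsKerSeq A B (m + 1) z) (hmin : ∀ z', ¬ IsKerSeq A B m z') :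
    ∃ w : ℕ → ι → F, (∀ i < m, A *ᵥ w (i + 1) = B *ᵥ w i) ∧ star (w 0) ⬝ᵥ A *ᵥ z 0 = 1 := by
  let L : (Fin (m + 1) → ι → F) →ₗ[F] (Fin m → ι → F) := LinearMap.pi fun i =>
    A.mulVecLin ∘ₗ LinearMap.proj i.succ - B.mulVecLin ∘ₗ LinearMap.proj i.castSucc
  let φ : Module.Dual F (Fin (m + 1) → ι → F) :=
    (dotProductBilin F F (star (z 0))) ∘ₗ A.mulVecLin ∘ₗ LinearMap.proj 0
  have hφ : ∀ w, φ w = star (z 0) ⬝ᵥ A *ᵥ w 0 := fun w => rfl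
  by_cases hker : ∃ w, L w = 0 ∧ φ w ≠ 0
  · obtain ⟨w, hw, hφw⟩ := hker
    refine ⟨fun i => if hi : i < m + 1 then (φ w)⁻¹ • w ⟨i, hi⟩ else 0, ?_, ?_⟩
    · intro i hi
      have := congrFun hw ⟨i, hi⟩
      have h1 : A *ᵥ w (Fin.succ ⟨i, hi⟩) - B *ᵥ w (Fin.castSucc ⟨i, hi⟩) = 0 := this
      simp only [add_lt_add_iff_right, hi, dif_pos, show i < m + 1 by omega, mulVec_smul]
      rw [sub_eq_zero.1 (show A *ᵥ w ⟨i + 1, by omega⟩ - B *ᵥ w ⟨i, by omega⟩ = 0 from h1)]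
    · rw [← star_mulVec_dotProduct hA, ← star_dotProduct_star]
      simp only [Nat.zero_lt_succ, dif_pos, mulVec_smul, dotProduct_smul, smul_eq_mul]
      rw [show star (z 0) ⬝ᵥ A *ᵥ w ⟨0, m.zero_lt_succ⟩ = φ w from rfl, inv_mul_cancel₀ hφw,
        star_one]
  · exfalso
    push Not at hker
    have hmem : φ ∈ LinearMap.range L.dualMap := by
      rw [LinearMap.range_dualMap_eq_dualAnnihilator_ker, Submodule.mem_dualAnnihilator]
      exact fun w hw => hker w hw
    obtain ⟨ψ, hψ⟩ := hmem
    let y : Fin m → ι → F := fun i j => star (ψ (Pi.single i (Pi.single j 1)))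
    have hψy : ∀ u, ψ u = ∑ i, star (y i) ⬝ᵥ u i := by
      intro u
      conv_lhs => rw [← Finset.univ_sum_single u, map_sum]
      refine Finset.sum_congr rfl fun i _ => ?_
      have : u i = ∑ j, u i j • Pi.single j (1 : F) := by
        ext k; simp [Finset.sum_apply, Pi.single_apply]
      have h2 : Pi.single i (u i) = ∑ j, u i j • (Pi.single i (Pi.single j (1 : F)) :
          Fin m → ι → F) := by
        conv_lhs => rw [this]
        change LinearMap.single F (fun _ : Fin m => ι → F) i _ = _
        rw [map_sum]
        exact Finset.sum_congr rfl fun j _ => by rw [map_smul]; rfl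
      rw [h2, map_sum]
      simp [dotProduct, y, mul_comm]
    have hmain : ∀ w : Fin (m + 1) → ι → F, star (z 0) ⬝ᵥ A *ᵥ w 0 =
        ∑ i : Fin m, star (y i) ⬝ᵥ (A *ᵥ w i.succ - B *ᵥ w i.castSucc) := by
      intro w
      rw [← hφ, ← hψ]
      exact hψy (L w)
    have hext : ∀ x y : ι → F, (∀ u, star x ⬝ᵥ u = star y ⬝ᵥ u) → x = y := by
      intro x y hxy
      refine star_injective (funext fun j => ?_)
      simpa using hxy (Pi.single j 1)
    set z' : ℕ → ι → F := fun i => if i = 0 then z 0 else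
      if hi : i - 1 < m then -y ⟨i - 1, hi⟩ else 0 with hz'
    refine hmin z' ⟨by simpa [hz'] using h.ne_zero, by simpa [hz'] using h.zero, ?_, ?_⟩
    · intro i
      apply hext
      intro u
      rw [star_mulVec_dotProduct hA, star_mulVec_dotProduct hB]
      by_cases him : i < m + 1
      · have h1 := hmain (Pi.single ⟨i, him⟩ u)
        have hsucc : ∑ k : Fin m, star (y k) ⬝ᵥ
            (A *ᵥ (Pi.single (⟨i, him⟩ : Fin (m + 1)) u : Fin (m + 1) → ι → F) k.succ) =
            if hi : 0 < i then star (y ⟨i - 1, by omega⟩) ⬝ᵥ A *ᵥ u else 0 := by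
          split_ifs with hi
          · rw [Finset.sum_eq_single (⟨i - 1, by omega⟩ : Fin m)]
            · congr 2
              rw [show (Fin.succ ⟨i - 1, by omega⟩ : Fin (m + 1)) = ⟨i, him⟩ from
                Fin.ext (by simp; omega), Pi.single_eq_same]
            · intro k _ hk
              rw [Pi.single_eq_of_ne, mulVec_zero, dotProduct_zero]
              intro h'
              apply hk
              have := congrArg Fin.val h'
              simp only [Fin.val_succ] at this
              exact Fin.ext (by simp; omega)
            · simp
          · refine Finset.sum_eq_zero fun k _ => ?_
            rw [Pi.single_eq_of_ne, mulVec_zero, dotProduct_zero]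
            intro h'
            have := congrArg Fin.val h'
            simp only [Fin.val_succ] at this
            omega
        have hcast : ∑ k : Fin m, star (y k) ⬝ᵥ
            (B *ᵥ (Pi.single (⟨i, him⟩ : Fin (m + 1)) u : Fin (m + 1) → ι → F) k.castSucc) =
            if hi : i < m then star (y ⟨i, hi⟩) ⬝ᵥ B *ᵥ u else 0 := by
          split_ifs with hi
          · rw [Finset.sum_eq_single (⟨i, hi⟩ : Fin m)]
            · congr 2
              rw [show (Fin.castSucc ⟨i, hi⟩ : Fin (m + 1)) = ⟨i, him⟩ from rfl,
                Pi.single_eq_same]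
            · intro k _ hk
              rw [Pi.single_eq_of_ne, mulVec_zero, dotProduct_zero]
              intro h'
              apply hk
              have := congrArg Fin.val h'
              simp only [Fin.val_castSucc] at this
              exact Fin.ext this
            · simp
          · refine Finset.sum_eq_zero fun k _ => ?_
            rw [Pi.single_eq_of_ne, mulVec_zero, dotProduct_zero]
            intro h'
            have := congrArg Fin.val h'
            simp only [Fin.val_castSucc] at this
            have := k.2
            omega
        simp only [dotProduct_sub, Finset.sum_sub_distrib] at h1
        rw [hsucc, hcast] at h1
        have hz1 : star (z' (i + 1)) ⬝ᵥ B *ᵥ u =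
            - if hi : i < m then star (y ⟨i, hi⟩) ⬝ᵥ B *ᵥ u else 0 := by
          simp only [hz', Nat.succ_ne_zero, if_false, Nat.add_sub_cancel]
          split_ifs <;> simp
        rw [hz1]
        rcases Nat.eq_zero_or_pos i with rfl | hi
        · rw [dif_neg (lt_irrefl _), zero_sub] at h1
          rw [← h1]
          simp only [hz', if_true]
          congr 2
        · have hz2 : star (z' i) ⬝ᵥ A *ᵥ u = - (star (y ⟨i - 1, by omega⟩) ⬝ᵥ A *ᵥ u) := by
            simp only [hz', hi.ne', if_false]
            rw [dif_pos (by omega)]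
            simp
          rw [Pi.single_eq_of_ne (by rw [Ne, Fin.ext_iff]; simp; omega), mulVec_zero,
            dotProduct_zero, dif_pos hi] at h1
          rw [hz2]
          rw [eq_comm, sub_eq_zero] at h1
          rw [h1]
      · have h1 : z' i = 0 := by
          simp only [hz', show i ≠ 0 by omega, if_false]
          rw [dif_neg (by omega)]
        have h2 : z' (i + 1) = 0 := by
          simp only [hz', show i + 1 ≠ 0 by omega, if_false]
          rw [dif_neg (by omega)]
        rw [h1, h2]; simp
    · intro i hi
      simp only [hz', show i ≠ 0 by omega, if_false]
      rw [dif_neg (by omega)]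

lemma IsKerSeq.dual_pairing {A B : Matrix ι ι F} (hA : Aᴴ = A) (hB : Bᴴ = B) {m : ℕ}
    {z w : ℕ → ι → F} (h : IsKerSeq A B (m + 1) z) (hw : ∀ i < m, A *ᵥ w (i + 1) = B *ᵥ w i)
    (hw0 : star (w 0) ⬝ᵥ A *ᵥ z 0 = 1) {i : ℕ} (hi : i ≤ m) (j : ℕ) :
    star (w i) ⬝ᵥ A *ᵥ z j = if i = j then 1 else 0 := by
  have hstep : ∀ i < m, ∀ j, star (w i) ⬝ᵥ A *ᵥ z j = star (w (i + 1)) ⬝ᵥ A *ᵥ z (j + 1) := by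
    intro i hi j
    rw [h.succ, ← star_mulVec_dotProduct hB, ← hw i hi, star_mulVec_dotProduct hA]
  have hsh : ∀ k i j, i + k ≤ m →
      star (w i) ⬝ᵥ A *ᵥ z j = star (w (i + k)) ⬝ᵥ A *ᵥ z (j + k) := by
    intro k
    induction k with
    | zero => intro i j _; rfl
    | succ k ih => intro i j hk; rw [ih i j (by omega), hstep _ (by omega)]; rfl
  rcases lt_trichotomy i j with hij | rfl | hij
  · rw [if_neg hij.ne, hsh (m - i) i j (by omega), h.last (by omega), dotProduct_zero]
  · rw [if_pos rfl, ← hw0, hsh i 0 0 (by omega), zero_add]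
  · rw [if_neg hij.ne']
    have h1 := hsh j (i - j) 0 (by omega)
    rw [Nat.sub_add_cancel hij.le, zero_add] at h1
    rw [← h1]
    obtain ⟨r, hr⟩ : ∃ r, i - j = r + 1 := ⟨i - j - 1, by omega⟩
    rw [hr, ← star_mulVec_dotProduct hA, hw r (by omega), star_mulVec_dotProduct hB, h.zero,
      dotProduct_zero]

lemma IsKerSeq.orth_right {A B : Matrix ι ι F} (hA : Aᴴ = A) (hB : Bᴴ = B) {ε : ℕ}
    {z : ℕ → ι → F} (h : IsKerSeq A B ε z) (i j : ℕ) : star (z i) ⬝ᵥ B *ᵥ z j = 0 := by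
  cases j with
  | zero => rw [h.zero, dotProduct_zero]
  | succ j => rw [← h.succ, h.orth hA hB]

lemma IsKerSeq.dual_pairing_right {A B : Matrix ι ι F} (hA : Aᴴ = A) (hB : Bᴴ = B) {m : ℕ}
    {z w : ℕ → ι → F} (h : IsKerSeq A B (m + 1) z) (hw : ∀ i < m, A *ᵥ w (i + 1) = B *ᵥ w i)
    (hw0 : star (w 0) ⬝ᵥ A *ᵥ z 0 = 1) {i : ℕ} (hi : i ≤ m) (j : ℕ) :
    star (w i) ⬝ᵥ B *ᵥ z j = if i + 1 = j then 1 else 0 := by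
  cases j with
  | zero => rw [h.zero, dotProduct_zero, if_neg (by omega)]
  | succ j => rw [← h.succ, h.dual_pairing hA hB hw hw0 hi]; simp

/-- The Gram matrix of a chain is a Hankel matrix with fixed entries. -/
lemma exists_hankel {A B : Matrix ι ι F} (hA : Aᴴ = A) (hB : Bᴴ = B) {m : ℕ} {w : ℕ → ι → F}
    (hw : ∀ i < m, A *ᵥ w (i + 1) = B *ᵥ w i) :
    ∃ g : ℕ → F, (∀ i ≤ m, ∀ j ≤ m, star (w i) ⬝ᵥ A *ᵥ w j = g (i + j)) ∧
      star (w m) ⬝ᵥ B *ᵥ w m = g (2 * m + 1) ∧ ∀ k ≤ 2 * m + 1, star (g k) = g k := by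
  set H : ℕ → ℕ → F := fun i j => star (w i) ⬝ᵥ A *ᵥ w j with hH
  have hstep : ∀ i < m, ∀ j < m, H i (j + 1) = H (i + 1) j := by
    intro i hi j hj
    simp only [hH]
    rw [hw j hj, ← star_mulVec_dotProduct hB, ← hw i hi, star_mulVec_dotProduct hA]
  have hsh : ∀ k i j, i + k ≤ m → j + k ≤ m → H (i + k) j = H i (j + k) := by
    intro k
    induction k with
    | zero => intro i j _ _; rfl
    | succ k ih =>
      intro i j h1 h2
      rw [← add_assoc, ← hstep _ (by omega) _ (by omega), ih i (j + 1) (by omega) (by omega),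
        add_right_comm, add_assoc]
  have hst : ∀ i j, star (H i j) = H j i := by
    intro i j
    simp only [hH]
    rw [star_dotProduct_star, star_mulVec_dotProduct hA]
  have hg : ∀ i ≤ m, ∀ j ≤ m, H i j = H (i + j - m) (min (i + j) m) := by
    intro i hi j hj
    have h1 := hsh (min i (m - j)) (i - min i (m - j)) j (by omega) (by omega)
    rw [Nat.sub_add_cancel (min_le_left _ _)] at h1
    rw [h1]
    congr 1 <;> omega
  refine ⟨fun k => if k = 2 * m + 1 then star (w m) ⬝ᵥ B *ᵥ w m else H (k - m) (min k m),
    ?_, ?_, ?_⟩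
  · intro i hi j hj
    simp only
    rw [if_neg (by omega)]
    exact hg i hi j hj
  · simp
  · intro k hk
    simp only
    split_ifs with h
    · rw [star_dotProduct_star, star_mulVec_dotProduct hB]
    · rw [hst, hg _ (by omega) _ (by omega)]
      congr 1 <;> omega

/-- A Hermitian pair with a singular pencil splits off a minimal singular pair. -/
theorem exists_split_singular [CharZero F] {A B : Matrix ι ι F} (hA : Aᴴ = A) (hB : Bᴴ = B)
    (hdet : ((X : F[X]) • A.map (C : F →+* F[X]) - B.map (C : F →+* F[X])).det = 0) :
    ∃ (ε m : ℕ) (P' : MatPair F (Fin m)), IsHermPair P' ∧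
      PairCong (A, B) (pairSum (singPair F ε) P') := by
  classical
  have hex := exists_isKerSeq hdet
  obtain ⟨z, h⟩ := Nat.find_spec hex
  have hmin := fun {k} => Nat.find_min hex (m := k)
  generalize Nat.find hex = ε at h hmin
  refine ⟨ε, ?_⟩
  cases ε with
  | zero =>
    obtain ⟨i, hi⟩ := Function.ne_iff.1 h.ne_zero
    refine exists_split_of_chains hA hB (z := z) (w := 0)
      (α := fun _ => Pi.single i (star (z 0 i))⁻¹) h.zero (fun i _ => h.succ i) (h.last le_rfl)
      (by simp) (by simp) (h.orth hA hB) ?_ (by simp)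
    intro k hk j hj
    obtain rfl : k = 0 := by omega
    obtain rfl : j = 0 := by omega
    rw [← star_dotProduct_star, dotProduct_single, if_pos rfl, Pi.star_apply,
      mul_inv_cancel₀ (by simpa using hi), star_one]
  | succ m =>
    obtain ⟨w, hw, hw0⟩ := exists_dual_chain hA hB h
      (fun z' hz' => hmin (Nat.lt_succ_self m) ⟨z', hz'⟩)
    obtain ⟨g, hg1, hg2, hg3⟩ := exists_hankel hA hB hw
    set c : ℕ → F := fun k => -(g k) / 2 with hc
    have hcs : ∀ k ≤ 2 * m + 1, g k + c k + star (c k) = 0 := by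
      intro k hk
      have h2 : star (2 : F) = 2 := star_ofNat 2
      simp only [hc, star_div₀, star_neg, hg3 k hk, h2]
      ring
    set s : ℕ → ι → F := fun i => ∑ j ∈ Finset.range (m + 2), c (i + j) • z j with hs
    have hss : ∀ i j, star (s i) ⬝ᵥ A *ᵥ s j = 0 := by
      intro i j
      simp only [hs, mulVec_sum, mulVec_smul, star_sum, star_smul, sum_dotProduct, dotProduct_sum,
        smul_dotProduct, dotProduct_smul, h.orth hA hB, smul_zero, Finset.sum_const_zero]
    have hssB : ∀ i j, star (s i) ⬝ᵥ B *ᵥ s j = 0 := by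
      intro i j
      simp only [hs, mulVec_sum, mulVec_smul, star_sum, star_smul, sum_dotProduct, dotProduct_sum,
        smul_dotProduct, dotProduct_smul, h.orth_right hA hB, smul_zero, Finset.sum_const_zero]
    have hws : ∀ i ≤ m, ∀ j, star (w i) ⬝ᵥ A *ᵥ s j = c (i + j) := by
      intro i hi j
      simp only [hs, mulVec_sum, mulVec_smul, dotProduct_sum, dotProduct_smul,
        h.dual_pairing hA hB hw hw0 hi, smul_eq_mul, mul_ite, mul_one, mul_zero,
        Finset.sum_ite_eq]
      rw [if_pos (by rw [Finset.mem_range]; omega), add_comm]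
    have hwsB : star (w m) ⬝ᵥ B *ᵥ s m = c (2 * m + 1) := by
      simp only [hs, mulVec_sum, mulVec_smul, dotProduct_sum, dotProduct_smul,
        h.dual_pairing_right hA hB hw hw0 le_rfl, smul_eq_mul, mul_ite, mul_one, mul_zero,
        Finset.sum_ite_eq]
      rw [if_pos (by rw [Finset.mem_range]; omega)]
      congr 1; omega
    have hsA : ∀ i, A *ᵥ s (i + 1) = B *ᵥ s i := by
      intro i
      simp only [hs, mulVec_sum, mulVec_smul]
      rw [Finset.sum_range_succ, h.last le_rfl, smul_zero, add_zero, Finset.sum_range_succ' _ (m + 1),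
        h.zero, smul_zero, add_zero]
      refine Finset.sum_congr rfl fun j _ => ?_
      rw [h.succ, add_right_comm, add_assoc]
    set w' : ℕ → ι → F := fun i => w i + s i with hw'd
    have hw' : ∀ i < m, A *ᵥ w' (i + 1) = B *ᵥ w' i := by
      intro i hi
      simp only [hw'd, mulVec_add, hw i hi, hsA]
    have hsz : ∀ i j, star (s i) ⬝ᵥ A *ᵥ z j = 0 := by
      intro i j
      simp only [hs, star_sum, star_smul, sum_dotProduct, smul_dotProduct, h.orth hA hB, smul_zero,
        Finset.sum_const_zero]
    have hw0' : star (w' 0) ⬝ᵥ A *ᵥ z 0 = 1 := by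
      simp only [hw'd, star_add, add_dotProduct, hw0, hsz, add_zero]
    have hgram : ∀ i ≤ m, ∀ j ≤ m, star (w' i) ⬝ᵥ A *ᵥ w' j = 0 := by
      intro i hi j hj
      have h1 : star (s i) ⬝ᵥ A *ᵥ w j = star (c (i + j)) := by
        rw [← star_mulVec_dotProduct hA, ← star_dotProduct_star, hws j hj, add_comm]
      simp only [hw'd, mulVec_add, star_add, add_dotProduct, dotProduct_add, hss, hws i hi, h1,
        hg1 i hi j hj]
      rw [add_zero]
      exact (add_right_comm _ _ _).trans (hcs (i + j) (by omega))
    have hgramB : star (w' m) ⬝ᵥ B *ᵥ w' m = 0 := by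
      have h1 : star (s m) ⬝ᵥ B *ᵥ w m = star (c (2 * m + 1)) := by
        rw [← star_mulVec_dotProduct hB, ← star_dotProduct_star, hwsB]
      simp only [hw'd, mulVec_add, star_add, add_dotProduct, dotProduct_add, hssB, hwsB, h1, hg2]
      rw [add_zero]
      exact (add_right_comm _ _ _).trans (hcs (2 * m + 1) le_rfl)
    refine exists_split_of_chains hA hB (z := z) (w := w')
      (α := fun i => i.casesOn (A *ᵥ w' 0) fun i => B *ᵥ w' i) h.zero (fun i _ => h.succ i)
      (h.last le_rfl) ?_ (fun _ _ => rfl) (h.orth hA hB) ?_ ?_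
    · intro i hi
      cases i with
      | zero => rfl
      | succ i => exact hw' i (by omega)
    · intro i hi j hj
      cases i with
      | zero =>
        change star (A *ᵥ w' 0) ⬝ᵥ _ = _
        rw [star_mulVec_dotProduct hA, h.dual_pairing hA hB hw' hw0' (by omega)]
      | succ i =>
        change star (B *ᵥ w' i) ⬝ᵥ _ = _
        rw [star_mulVec_dotProduct hB, h.dual_pairing_right hA hB hw' hw0' (by omega)]
    · intro i hi j hj
      cases i with
      | zero =>
        change star (A *ᵥ w' 0) ⬝ᵥ _ = _
        rw [star_mulVec_dotProduct hA, hgram _ (by omega) _ (by omega)]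
      | succ i =>
        change star (B *ᵥ w' i) ⬝ᵥ _ = _
        rcases Nat.lt_or_ge j m with hjm | hjm
        · rw [star_mulVec_dotProduct hB, ← hw' j hjm]
          exact hgram _ (by omega) _ (by omega)
        · obtain rfl : j = m := by omega
          rcases Nat.lt_or_ge i j with him | him
          · rw [← hw' i him, star_mulVec_dotProduct hA]
            exact hgram _ (by omega) _ le_rfl
          · obtain rfl : i = j := by omega
            rw [star_mulVec_dotProduct hB]
            exact hgramB

end Singular

section Codes

/-- Labels of the indecomposable summands; exponents and sizes are shifted by one. -/
inductive Code (F : Type*) [Field F]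
  | sing (n : ℕ)
  | skew (p : F[X]) (l : ℕ)
  | self (p : F[X]) (l : ℕ) (b : Bool)
  | infty (n : ℕ) (b : Bool)

variable {F : Type*} [Field F] [StarRing F]

/-- The choices on which the canonical summands depend. -/
structure CanonData (F : Type*) [Field F] [StarRing F] where
  phi : (q : F[X]) → Mat F q.natDegree
  rep : F[X] → F[X]
  unit : F
  exists_star_ne : ∃ a : F, star a ≠ a
  isUnit_det_phi : ∀ p l, p.Monic → Irreducible p → star p = p → IsUnit (phi (p ^ (l + 1))).det
  phi_herm : ∀ p l, p.Monic → Irreducible p → star p = p →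
    (phi (p ^ (l + 1)))ᴴ = phi (p ^ (l + 1))
  phi_mul_herm : ∀ p l, p.Monic → Irreducible p → star p = p →
    (phi (p ^ (l + 1)) * companion F (p ^ (l + 1)))ᴴ = phi (p ^ (l + 1)) * companion F (p ^ (l + 1))
  isNormRep_rep : ∀ p, p.Monic → Irreducible p → star p = p → PolyNormRep p (rep p)
  isNormRep_unit : PolyNormRep (X : F[X]) (C unit)

namespace CanonData

variable (D : CanonData F)

/-- The summand with a given label. -/
def blk : Code F → PBlock F
  | .sing n => ⟨(n + 1) + (n + 1 - 1),
      (skewSum (Fmat F (n + 1)) (ctr (starRingEnd F) (Fmat F (n + 1))),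
        skewSum (Gmat F (n + 1)) (ctr (starRingEnd F) (Gmat F (n + 1))))⟩
  | .skew p l => pairStar9 (starRingEnd F) (p ^ (l + 1))
  | .self p l false => ⟨(p ^ (l + 1)).natDegree,
      (D.phi (p ^ (l + 1)), D.phi (p ^ (l + 1)) * companion F (p ^ (l + 1)))⟩
  | .self p l true => ⟨(p ^ (l + 1)).natDegree,
      (D.phi (p ^ (l + 1)) * aeval (companion F (p ^ (l + 1))) (D.rep p),
        D.phi (p ^ (l + 1)) * companion F (p ^ (l + 1)) *
          aeval (companion F (p ^ (l + 1))) (D.rep p))⟩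
  | .infty n false => ⟨n + 1, Bpair F (n + 1)⟩
  | .infty n true => ⟨n + 1, (D.unit • (Bpair F (n + 1)).1, D.unit • (Bpair F (n + 1)).2)⟩

end CanonData

/-- The conditions on the polynomial of a label. -/
def Code.Valid : Code F → Prop
  | .sing _ => True
  | .skew p _ => p.Monic ∧ Irreducible p ∧ star p ≠ p
  | .self p _ _ => p.Monic ∧ Irreducible p ∧ star p = p
  | .infty _ _ => True

variable {ι : Type} [Fintype ι] [DecidableEq ι]

lemma pairCong_skewSum {k l : ℕ} (A A' : Matrix (Fin k) (Fin l) F) (B B' : Matrix (Fin l) (Fin k) F) :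
    PairCong (fromBlocks 0 B A 0, fromBlocks 0 B' A' 0) (skewSum A B, skewSum A' B') :=
  PairCong.of_equiv finSumFinEquiv (fun i j => by simp [skewSum]) (fun i j => by simp [skewSum])

namespace CanonData

variable (D : CanonData F)

lemma pairCong_blk_sing (n : ℕ) : PairCong (singPair F n) (D.blk (.sing n)).2 :=
  pairCong_skewSum (F := F) (k := n) (l := n + 1) (initMat F n) (tailMat F n) (initMat F n)ᴴ
    (tailMat F n)ᴴ

lemma pairCong_blk_skew (p : F[X]) (l : ℕ) :
    PairCong (fromBlocks 0 1 1 0, fromBlocks 0 (companion F (p ^ (l + 1)))ᴴ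
        (companion F (p ^ (l + 1))) 0) (D.blk (.skew p l)).2 :=
  pairCong_skewSum _ _ _ _

lemma pairCong_blk_self (p : F[X]) (l : ℕ) (b : Bool) :
    PairCong (polyPair (D.phi (p ^ (l + 1))) (companion F (p ^ (l + 1))) (if b then D.rep p else 1))
      (D.blk (.self p l b)).2 := by
  cases b
  · have : polyPair (D.phi (p ^ (l + 1))) (companion F (p ^ (l + 1))) (if false then D.rep p else 1)
        = (D.blk (.self p l false)).2 := polyPair_one _ _
    rw [← this]
    exact PairCong.refl _
  · exact PairCong.refl _

lemma pairCong_blk_infty (n : ℕ) (b : Bool) :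
    PairCong (polyPair (antidiag F ((X : F[X]) ^ (n + 1)).natDegree)
      (companion F ((X : F[X]) ^ (n + 1))) (C (if b then D.unit else 1))).swap
      (D.blk (.infty n b)).2 := by
  refine (polyPair_antidiag_cong n _).trans ?_
  cases b
  · have : ((1 : F) • (Bpair F (n + 1)).1, (1 : F) • (Bpair F (n + 1)).2) =
        (D.blk (.infty n false)).2 := by
      rw [one_smul, one_smul]; rfl
    change PairCong ((1 : F) • (Bpair F (n + 1)).1, (1 : F) • (Bpair F (n + 1)).2) _
    rw [this]
    exact PairCong.refl _
  · exact PairCong.refl _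

lemma blk_pos {c : Code F} (hc : c.Valid) : 0 < (D.blk c).1 := by
  cases c with
  | sing n => exact Nat.add_pos_left n.succ_pos _
  | skew p l => exact Nat.add_pos_left (natDegree_pow_succ_pos hc.2.1 l) _
  | self p l b => cases b <;> exact natDegree_pow_succ_pos hc.2.1 l
  | infty n b => cases b <;> exact n.succ_pos

lemma exists_monic_irreducible_dvd_minpoly [Nonempty ι] (T : Matrix ι ι F) :
    ∃ p : F[X], p.Monic ∧ Irreducible p ∧ p ∣ minpoly F T := by
  classical
  obtain ⟨q, hq, hd⟩ := WfDvdMonoid.exists_irreducible_factor (minpoly.not_isUnit F T)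
    (minpoly.ne_zero (Matrix.isIntegral T))
  refine ⟨normalize q, monic_normalize hq.ne_zero, ?_, ?_⟩
  · exact (associated_normalize q).irreducible hq
  · exact (normalize_dvd_iff).2 hd

lemma exists_split [CharZero F] [Nonempty ι] {P : MatPair F ι} (hP : IsHermPair P) :
    ∃ c : Code F, c.Valid ∧ ∃ (m : ℕ) (P' : MatPair F (Fin m)), IsHermPair P' ∧
      PairCong P (pairSum (D.blk c).2 P') := by
  obtain ⟨A, B⟩ := P
  obtain ⟨hA, hB⟩ := hP
  simp only at hA hB
  by_cases hdet : ∀ n : ℕ, ¬ IsUnit (B - (n : F) • A).det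
  · have h0 : ((X : F[X]) • A.map (C : F →+* F[X]) - B.map (C : F →+* F[X])).det = 0 := by
      refine Polynomial.eq_of_infinite_eval_eq _ _
        (Set.infinite_of_injective_forall_mem (f := fun n : ℕ => (n : F)) Nat.cast_injective ?_)
      intro n
      have := hdet n
      rw [isUnit_iff_ne_zero, not_not] at this
      have h2 : (A.map (C : F →+* F[X])).map (eval (n : F)) = A := by ext; simp
      have h3 : ((X : F[X]) • A.map (C : F →+* F[X]) - B.map (C : F →+* F[X])).map
          (evalRingHom (n : F)) = -(B - (n : F) • A) := by
        ext i j; simp [mul_comm (A i j)]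
      rw [Set.mem_ofPred_eq, eval_zero, ← coe_evalRingHom, RingHom.map_det, RingHom.mapMatrix_apply,
        h3, det_neg, this, mul_zero]
    obtain ⟨ε, m, P', hP', h⟩ := exists_split_singular hA hB h0
    exact ⟨.sing ε, trivial, m, P', hP', h.trans ((D.pairCong_blk_sing ε).sum (.refl _))⟩
  · push Not at hdet
    obtain ⟨n, hn⟩ := hdet
    by_cases hAu : IsUnit A.det
    · obtain ⟨p, hpm, hpi, hpd⟩ := exists_monic_irreducible_dvd_minpoly (A⁻¹ * B)
      have hT : A * (A⁻¹ * B) = B := mul_nonsing_inv_cancel_left _ _ hAu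
      by_cases hps : star p = p
      · obtain ⟨l, G, hGu, hG, hGΦ, m, P', hP', h⟩ :=
          exists_split_self D.exists_star_ne hA hB hT hAu hpm hpi hps hpd
        rcases (D.isNormRep_rep p hpm hpi hps).pairCong_normal hpm hpi hps
          (D.isUnit_det_phi p l hpm hpi hps) (D.phi_herm p l hpm hpi hps)
          (D.phi_mul_herm p l hpm hpi hps) hGu hG hGΦ with h' | h'
        · exact ⟨.self p l false, ⟨hpm, hpi, hps⟩, m, P', hP',
            h.trans ((h'.trans (D.pairCong_blk_self p l false)).sum (.refl _))⟩
        · exact ⟨.self p l true, ⟨hpm, hpi, hps⟩, m, P', hP',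
            h.trans ((h'.trans (D.pairCong_blk_self p l true)).sum (.refl _))⟩
      · obtain ⟨l, m, P', hP', h⟩ := exists_split_nonself hA hB hT hAu hpm hpi hps hpd
        exact ⟨.skew p l, ⟨hpm, hpi, hps⟩, m, P', hP',
          h.trans ((D.pairCong_blk_skew p l).sum (.refl _))⟩
    · obtain ⟨n, m, P', hn, hP', h⟩ := exists_split_infty D.exists_star_ne hA hB (star_natCast n) hn
        hAu D.isNormRep_unit
      obtain ⟨k, rfl⟩ : ∃ k, n = k + 1 := ⟨n - 1, by omega⟩
      rcases h with h | h
      · exact ⟨.infty k false, trivial, m, P', hP', h⟩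
      · exact ⟨.infty k true, trivial, m, P', hP', h⟩

lemma exists_codes [CharZero F] (m : ℕ) (P : MatPair F (Fin m)) (hP : IsHermPair P) :
    ∃ L : List (Code F), (∀ c ∈ L, c.Valid) ∧ PairCong P (psum (L.map D.blk)).2 := by
  induction m using Nat.strong_induction_on with
  | _ m ih =>
    rcases Nat.eq_zero_or_pos m with rfl | hm
    · have : ∀ Q : MatPair F (Fin 0), PairCong P Q := fun Q =>
        ⟨1, 1, Subsingleton.elim _ _, Subsingleton.elim _ _, Subsingleton.elim _ _,
          Subsingleton.elim _ _⟩
      exact ⟨[], by simp, this _⟩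
    · have : Nonempty (Fin m) := ⟨⟨0, hm⟩⟩
      obtain ⟨c, hc, m', P', hP', h⟩ := D.exists_split hP
      have hcard := h.card_eq
      rw [Fintype.card_sum, Fintype.card_fin, Fintype.card_fin, Fintype.card_fin] at hcard
      have := D.blk_pos hc
      obtain ⟨L, hL, hL'⟩ := ih m' (by omega) P' hP'
      refine ⟨c :: L, ?_, ?_⟩
      · simpa using ⟨hc, hL⟩
      · exact h.trans ((PairCong.sum (.refl _) hL').trans (psum_cons_cong _ _).symm)

end CanonData

/-- The labels of scaled summands. -/
def Code.IsScaled : Code F → Prop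
  | .sing _ => False
  | .skew _ _ => False
  | .self _ _ b => b = true
  | .infty _ b => b = true

/-- The label of the corresponding unscaled summand. -/
def Code.unscale : Code F → Code F
  | .sing n => .sing n
  | .skew p l => .skew p l
  | .self p l _ => .self p l false
  | .infty n _ => .infty n false

lemma Code.not_isScaled_unscale (c : Code F) : ¬ c.unscale.IsScaled := by
  cases c <;> simp [Code.unscale, Code.IsScaled]

lemma Code.Valid.unscale {c : Code F} (h : c.Valid) : c.unscale.Valid := by
  cases c <;> exact h

namespace CanonData

variable (D : CanonData F)

lemma fusion [CharZero F] {c : Code F} (hc : c.Valid) (hs : c.IsScaled) :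
    PairCong (pairSum (D.blk c).2 (D.blk c).2)
      (pairSum (D.blk c.unscale).2 (D.blk c.unscale).2) := by
  cases c with
  | sing n => exact hs.elim
  | skew p l => exact hs.elim
  | self p l b =>
    obtain rfl : b = true := hs
    obtain ⟨hpm, hpi, hps⟩ := hc
    refine ((D.pairCong_blk_self p l true).sum (D.pairCong_blk_self p l true)).symm.trans
      (PairCong.trans ?_ ((D.pairCong_blk_self p l false).sum (D.pairCong_blk_self p l false)))
    exact (D.isNormRep_rep p hpm hpi hps).polyPair_fusion hpi hps
      (mul_eq_conjTranspose_mul_of_herm (D.phi_herm p l hpm hpi hps) (D.phi_mul_herm p l hpm hpi hps))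
      (aeval_companion_self (natDegree_pow_succ_pos hpi l) (hpm.pow _))
  | infty n b =>
    obtain rfl : b = true := hs
    refine ((D.pairCong_blk_infty n true).sum (D.pairCong_blk_infty n true)).symm.trans
      (PairCong.trans ?_ ((D.pairCong_blk_infty n false).sum (D.pairCong_blk_infty n false)))
    exact (D.isNormRep_unit.polyPair_fusion irreducible_X (polyStar_X)
      (mul_eq_conjTranspose_mul_of_herm (antidiag_conjTranspose _)
        (antidiag_mul_companion_conjTranspose n))
      (aeval_companion_self (natDegree_pow_succ_pos irreducible_X n) (monic_X.pow _))).swap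

open Classical in
lemma exists_reduced [CharZero F] (L : List (Code F)) (hL : ∀ c ∈ L, c.Valid) :
    ∃ L' : List (Code F), (∀ c ∈ L', c.Valid) ∧ (∀ c, c.IsScaled → L'.count c ≤ 1) ∧
      PairCong (psum (L.map D.blk)).2 (psum (L'.map D.blk)).2 := by
  induction hk : L.countP (fun c => c.IsScaled) using Nat.strong_induction_on generalizing L with
  | _ k ih =>
    by_cases h : ∀ c : Code F, c.IsScaled → L.count c ≤ 1
    · exact ⟨L, hL, h, .refl _⟩
    · push Not at h
      obtain ⟨c, hc, hcL⟩ := h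
      obtain ⟨L₁, hL₁⟩ : ∃ L₁, L.Perm (c :: c :: L₁) := by
        have h1 : List.Sublist [c, c] L := List.replicate_sublist_iff.2 hcL
        exact h1.exists_perm_append
      have hv : ∀ d ∈ c :: c :: L₁, d.Valid := fun d hd => hL d (hL₁.mem_iff.2 hd)
      have hcv : c.Valid := hv c (by simp)
      have hcount : L.countP (fun c => c.IsScaled) = _ := hL₁.countP_eq _
      have hlt : (c.unscale :: c.unscale :: L₁).countP (fun c => c.IsScaled) < k := by
        rw [← hk, hcount]
        simp [hc, c.not_isScaled_unscale]
      have hv' : ∀ d ∈ c.unscale :: c.unscale :: L₁, d.Valid := by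
        intro d hd
        simp only [List.mem_cons] at hd
        rcases hd with rfl | rfl | hd
        · exact hcv.unscale
        · exact hcv.unscale
        · exact hv d (by simp [hd])
      obtain ⟨L', h1, h2, h3⟩ := ih _ hlt _ hv' rfl
      refine ⟨L', h1, h2, (psum_perm (hL₁.map _)).trans (PairCong.trans ?_ h3)⟩
      have key : ∀ d : Code F, PairCong (psum ((d :: d :: L₁).map D.blk)).2
          (pairSum (pairSum (D.blk d).2 (D.blk d).2) (psum (L₁.map D.blk)).2) := fun d =>
        (psum_cons_cong _ _).trans ((PairCong.sum (.refl _) (psum_cons_cong _ _)).trans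
          (pairSum_assoc _ _ _).symm)
      exact (key c).trans (((D.fusion hcv hc).sum (.refl _)).trans (key _).symm)

end CanonData

end Codes

section Forms

variable {F : Type*} [Field F] [StarRing F]
variable {ι ι' : Type} [Fintype ι] [DecidableEq ι] [Fintype ι'] [DecidableEq ι']

lemma dvd_dotProduct {g : F[X]} {u v : ι → F[X]} (h : ∀ i, g ∣ v i) : g ∣ u ⬝ᵥ v :=
  Finset.dvd_sum fun i _ => (h i).mul_left _

lemma dotProduct_dvd {g : F[X]} {u v : ι → F[X]} (h : ∀ i, g ∣ u i) : g ∣ u ⬝ᵥ v :=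
  Finset.dvd_sum fun i _ => (h i).mul_right _

lemma mul_dvd_dotProduct {g g' : F[X]} {u v : ι → F[X]} (h : ∀ i, g ∣ u i) (h' : ∀ i, g' ∣ v i) :
    g * g' ∣ u ⬝ᵥ v :=
  Finset.dvd_sum fun i _ => mul_dvd_mul (h i) (h' i)

/-- Dual bases of the pairing induced by `M` on the vectors annihilated by `M` modulo `p ^ l`. -/
structure IsForm (p : F[X]) (l : ℕ) (M : Matrix ι ι F[X]) {κ : Type} [Fintype κ] [DecidableEq κ]
    (y z : κ → ι → F[X]) (d : κ → F[X]) : Prop where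
  right : ∀ k i, p ^ l ∣ (M *ᵥ z k) i
  left : ∀ k i, p ^ l ∣ (y k ᵥ* M) i
  orth : ∀ j k, p ^ (l + 1) ∣ y j ⬝ᵥ M *ᵥ z k - p ^ l * if j = k then d j else 0
  not_dvd : ∀ k, ¬ p ∣ d k
  span : ∀ w, (∀ i, p ^ l ∣ (M *ᵥ w) i) → ∃ a : κ → F[X], ∀ y', (∀ i, p ^ l ∣ (y' ᵥ* M) i) →
    p ^ (l + 1) ∣ y' ⬝ᵥ M *ᵥ (w - ∑ k, a k • z k)

/-- The pairing induced by `M` at `p ^ l` has rank `r` and, in the Hermitian case,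
discriminant `δ`. -/
def HasForm (h : Prop) (p : F[X]) (l : ℕ) (M : Matrix ι ι F[X]) (r : ℕ) (δ : F[X]) : Prop :=
  ∃ (κ : Type) (_ : Fintype κ) (_ : DecidableEq κ) (y z : κ → ι → F[X]) (d : κ → F[X]),
    IsForm p l M y z d ∧ Fintype.card κ = r ∧ ∏ k, d k = δ ∧ (h → ∀ k, y k = star (z k))

/-- The pairing induced by `M` at `p ^ l` is zero. -/
def Degen (p : F[X]) (l : ℕ) (M : Matrix ι ι F[X]) : Prop :=
  ∀ y z, (∀ i, p ^ l ∣ (y ᵥ* M) i) → (∀ i, p ^ l ∣ (M *ᵥ z) i) → p ^ (l + 1) ∣ y ⬝ᵥ M *ᵥ z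

lemma Degen.hasForm {p : F[X]} {l : ℕ} {M : Matrix ι ι F[X]} (hM : Degen p l M) (h : Prop) :
    HasForm h p l M 0 1 := by
  refine ⟨Fin 0, inferInstance, inferInstance, 0, 0, 0, ⟨by simp, by simp, by simp, by simp, ?_⟩,
    by simp, by simp, by simp⟩
  intro w hw
  refine ⟨0, fun y' hy' => ?_⟩
  simpa using hM y' w hy' hw

lemma Degen.equiv {p : F[X]} {l : ℕ} {M : Matrix ι ι F[X]} (hM : Degen p l M)
    {U : Matrix ι' ι F[X]} {U' : Matrix ι ι' F[X]} {V : Matrix ι ι' F[X]} {V' : Matrix ι' ι F[X]}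
    (hU' : U' * U = 1) (hV : V * V' = 1) : Degen p l (U * M * V) := by
  intro y z hy hz
  have h1 := hM (y ᵥ* U) (V *ᵥ z) ?_ ?_
  · simpa [← mulVec_mulVec, dotProduct_mulVec, ← vecMul_vecMul] using h1
  · intro i
    have : y ᵥ* U ᵥ* M = (y ᵥ* (U * M * V)) ᵥ* V' := by
      rw [vecMul_vecMul, vecMul_vecMul, Matrix.mul_assoc _ V, hV, Matrix.mul_one]
    rw [this]
    exact dotProduct_dvd hy
  · intro i
    have : M *ᵥ (V *ᵥ z) = U' *ᵥ ((U * M * V) *ᵥ z) := by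
      rw [mulVec_mulVec, mulVec_mulVec, Matrix.mul_assoc U, ← Matrix.mul_assoc U', hU',
        Matrix.one_mul]
    rw [this]
    exact dvd_dotProduct hz

lemma HasForm.equiv {h : Prop} {p : F[X]} {l : ℕ} {M : Matrix ι ι F[X]} {r : ℕ} {δ : F[X]}
    (hM : HasForm h p l M r δ)
    {U : Matrix ι' ι F[X]} {U' : Matrix ι ι' F[X]} {V : Matrix ι ι' F[X]} {V' : Matrix ι' ι F[X]}
    (hU : U * U' = 1) (hU' : U' * U = 1) (hV : V * V' = 1) (hV' : V' * V = 1)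
    (hUV : h → U = Vᴴ) : HasForm h p l (U * M * V) r δ := by
  obtain ⟨κ, _, _, y, z, d, hf, hr, hδ, hs⟩ := hM
  have hMz : ∀ z, (U * M * V) *ᵥ (V' *ᵥ z) = U *ᵥ (M *ᵥ z) := by
    intro z
    rw [mulVec_mulVec, mulVec_mulVec, Matrix.mul_assoc _ V, hV, Matrix.mul_one]
  have hyM : ∀ y, (y ᵥ* U') ᵥ* (U * M * V) = (y ᵥ* M) ᵥ* V := by
    intro y
    rw [vecMul_vecMul, vecMul_vecMul, Matrix.mul_assoc U, ← Matrix.mul_assoc U', hU',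
      Matrix.one_mul]
  have hyMz : ∀ y z, (y ᵥ* U') ⬝ᵥ (U * M * V) *ᵥ (V' *ᵥ z) = y ⬝ᵥ M *ᵥ z := by
    intro y z
    rw [hMz, ← dotProduct_mulVec, mulVec_mulVec, hU', one_mulVec]
  refine ⟨κ, _, _, fun k => y k ᵥ* U', fun k => V' *ᵥ z k, d, ⟨?_, ?_, ?_, hf.not_dvd, ?_⟩, hr, hδ,
    ?_⟩
  · intro k i
    rw [hMz]
    exact dvd_dotProduct (hf.right k)
  · intro k i
    rw [hyM]
    exact dotProduct_dvd (hf.left k)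
  · intro j k
    rw [hyMz]
    exact hf.orth j k
  · intro w hw
    have hVw : ∀ i, p ^ l ∣ (M *ᵥ (V *ᵥ w)) i := by
      intro i
      have : M *ᵥ (V *ᵥ w) = U' *ᵥ ((U * M * V) *ᵥ w) := by
        rw [mulVec_mulVec, mulVec_mulVec, Matrix.mul_assoc U, ← Matrix.mul_assoc U', hU',
          Matrix.one_mul]
      rw [this]
      exact dvd_dotProduct hw
    obtain ⟨a, ha⟩ := hf.span (V *ᵥ w) hVw
    refine ⟨a, fun y' hy' => ?_⟩
    have h1 := ha (y' ᵥ* U) fun i => by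
      have : y' ᵥ* U ᵥ* M = (y' ᵥ* (U * M * V)) ᵥ* V' := by
        rw [vecMul_vecMul, vecMul_vecMul, Matrix.mul_assoc _ V, hV, Matrix.mul_one]
      rw [this]
      exact dotProduct_dvd hy'
    have h2 : w - ∑ k, a k • V' *ᵥ z k = V' *ᵥ (V *ᵥ w - ∑ k, a k • z k) := by
      rw [mulVec_sub, mulVec_mulVec, hV', one_mulVec, mulVec_sum]
      simp only [mulVec_smul]
    have h3 : y' = (y' ᵥ* U) ᵥ* U' := by rw [vecMul_vecMul, hU, vecMul_one]
    rw [h2, h3, hyMz]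
    exact h1
  · intro hh k
    have h1 : U' = V'ᴴ := by
      have h2 : V'ᴴ * U = 1 := by rw [hUV hh, ← conjTranspose_mul, hV, conjTranspose_one]
      calc U' = V'ᴴ * U * U' := by rw [h2, Matrix.one_mul]
        _ = V'ᴴ := by rw [Matrix.mul_assoc, hU, Matrix.mul_one]
    simp only
    rw [star_mulVec, hs hh, h1]

lemma HasForm.sum {h : Prop} {p : F[X]} {l : ℕ} {M : Matrix ι ι F[X]} {M' : Matrix ι' ι' F[X]}
    {r r' : ℕ} {δ δ' : F[X]} (hM : HasForm h p l M r δ) (hM' : HasForm h p l M' r' δ') :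
    HasForm h p l (fromBlocks M 0 0 M') (r + r') (δ * δ') := by
  obtain ⟨κ, _, _, y, z, d, hf, rfl, rfl, hs⟩ := hM
  obtain ⟨κ', _, _, y', z', d', hf', rfl, rfl, hs'⟩ := hM'
  refine ⟨κ ⊕ κ', inferInstance, inferInstance, Sum.elim (fun k => Sum.elim (y k) 0)
    (fun k => Sum.elim 0 (y' k)), Sum.elim (fun k => Sum.elim (z k) 0)
    (fun k => Sum.elim 0 (z' k)), Sum.elim d d', ⟨?_, ?_, ?_, ?_, ?_⟩, by simp, by simp, ?_⟩
  · rintro (k | k) (i | i)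
    · simpa [fromBlocks_mulVec] using hf.right k i
    · simp [fromBlocks_mulVec]
    · simp [fromBlocks_mulVec]
    · simpa [fromBlocks_mulVec] using hf'.right k i
  · rintro (k | k) (i | i)
    · simpa [vecMul_fromBlocks] using hf.left k i
    · simp [vecMul_fromBlocks]
    · simp [vecMul_fromBlocks]
    · simpa [vecMul_fromBlocks] using hf'.left k i
  · rintro (j | j) (k | k)
    · simpa [fromBlocks_mulVec] using hf.orth j k
    · simp [fromBlocks_mulVec]
    · simp [fromBlocks_mulVec]
    · simpa [fromBlocks_mulVec] using hf'.orth j k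
  · rintro (k | k)
    · exact hf.not_dvd k
    · exact hf'.not_dvd k
  · intro w hw
    obtain ⟨a, ha⟩ := hf.span (w ∘ Sum.inl) fun i => by
      simpa [fromBlocks_mulVec] using hw (Sum.inl i)
    obtain ⟨a', ha'⟩ := hf'.span (w ∘ Sum.inr) fun i => by
      simpa [fromBlocks_mulVec] using hw (Sum.inr i)
    refine ⟨Sum.elim a a', fun v hv => ?_⟩
    have h1 := ha (v ∘ Sum.inl) fun i => by simpa [vecMul_fromBlocks] using hv (Sum.inl i)
    have h2 := ha' (v ∘ Sum.inr) fun i => by simpa [vecMul_fromBlocks] using hv (Sum.inr i)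
    set u : ι ⊕ ι' → F[X] := w - ∑ k, Sum.elim a a' k • Sum.elim (fun k => Sum.elim (z k) 0)
      (fun k => Sum.elim 0 (z' k)) k with hu
    have hu1 : u ∘ Sum.inl = w ∘ Sum.inl - ∑ k, a k • z k := by
      ext1 i
      simp [hu, Fintype.sum_sum_type, Finset.sum_apply]
    have hu2 : u ∘ Sum.inr = w ∘ Sum.inr - ∑ k, a' k • z' k := by
      ext1 i
      simp [hu, Fintype.sum_sum_type, Finset.sum_apply]
    rw [fromBlocks_mulVec, hu1, hu2, zero_mulVec, zero_mulVec, add_zero, zero_add]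
    have : v ⬝ᵥ Sum.elim (M *ᵥ (w ∘ Sum.inl - ∑ k, a k • z k))
        (M' *ᵥ (w ∘ Sum.inr - ∑ k, a' k • z' k)) =
        (v ∘ Sum.inl) ⬝ᵥ (M *ᵥ (w ∘ Sum.inl - ∑ k, a k • z k)) +
        (v ∘ Sum.inr) ⬝ᵥ (M' *ᵥ (w ∘ Sum.inr - ∑ k, a' k • z' k)) := by
      simp [dotProduct, Fintype.sum_sum_type]
    rw [this]
    exact dvd_add h1 h2
  · rintro hh (k | k)
    · ext1 (i | i) <;> simp [hs hh k]
    · ext1 (i | i) <;> simp [hs' hh k]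

lemma Degen.of_not_dvd_det {p : F[X]} (hp : Irreducible p) {l : ℕ} {M : Matrix ι ι F[X]}
    (h : ¬ p ^ l ∣ M.det) : Degen p l M := by
  intro y z hy hz
  have h1 : ∀ i, p ∣ z i := by
    intro i
    by_contra hzi
    refine h (((isCoprime_of_not_dvd hp hzi).pow_left (m := l)).dvd_of_dvd_mul_right ?_)
    have h2 : (M.adjugate *ᵥ M *ᵥ z) i = M.det * z i := by
      rw [mulVec_mulVec, adjugate_mul, smul_mulVec, one_mulVec]; rfl
    rw [← h2]
    exact dvd_dotProduct hz
  rw [dotProduct_mulVec, pow_succ]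
  exact mul_dvd_dotProduct hy h1

lemma Degen.of_rightInverse {p : F[X]} {l : ℕ} (hl : 0 < l) {E : Matrix ι ι' F[X]}
    {E' : Matrix ι' ι F[X]} (h : E * E' = 1) : Degen p l (fromBlocks 0 Eᴴ E 0) := by
  intro y z hy hz
  have hz1 : ∀ i, p ^ l ∣ (E *ᵥ (z ∘ Sum.inl)) i := fun i => by
    simpa [fromBlocks_mulVec] using hz (Sum.inr i)
  have hz2 : ∀ i, p ^ l ∣ (Eᴴ *ᵥ (z ∘ Sum.inr)) i := fun i => by
    simpa [fromBlocks_mulVec] using hz (Sum.inl i)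
  have hy1 : ∀ i, p ^ l ∣ ((y ∘ Sum.inl) ᵥ* Eᴴ) i := fun i => by
    simpa [vecMul_fromBlocks] using hy (Sum.inr i)
  have hy2 : ∀ i, p ^ l ∣ ((y ∘ Sum.inr) ᵥ* E) i := fun i => by
    simpa [vecMul_fromBlocks] using hy (Sum.inl i)
  have hz3 : ∀ i, p ^ l ∣ (z ∘ Sum.inr) i := by
    have : z ∘ Sum.inr = E'ᴴ *ᵥ (Eᴴ *ᵥ (z ∘ Sum.inr)) := by
      rw [mulVec_mulVec, ← conjTranspose_mul, h, conjTranspose_one, one_mulVec]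
    intro i
    rw [this]
    exact dvd_dotProduct hz2
  have hy3 : ∀ i, p ^ l ∣ (y ∘ Sum.inr) i := by
    have : y ∘ Sum.inr = ((y ∘ Sum.inr) ᵥ* E) ᵥ* E' := by
      rw [vecMul_vecMul, h, vecMul_one]
    intro i
    rw [this]
    exact dotProduct_dvd hy2
  have : y ⬝ᵥ fromBlocks 0 Eᴴ E 0 *ᵥ z =
      ((y ∘ Sum.inl) ᵥ* Eᴴ) ⬝ᵥ (z ∘ Sum.inr) + (y ∘ Sum.inr) ⬝ᵥ (E *ᵥ (z ∘ Sum.inl)) := by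
    rw [fromBlocks_mulVec, ← dotProduct_mulVec]
    simp [dotProduct, Fintype.sum_sum_type]
  rw [this]
  have hle : p ^ (l + 1) ∣ p ^ l * p ^ l := by
    rw [← pow_add]
    exact pow_dvd_pow _ (by omega)
  exact dvd_add (hle.trans (mul_dvd_dotProduct hy1 hz3)) (hle.trans (mul_dvd_dotProduct hy3 hz1))

end Forms

section FormInvariants

variable {F : Type*} [Field F] [StarRing F]
variable {ι : Type} [Fintype ι] [DecidableEq ι]
variable {κ κ' : Type} [Fintype κ] [DecidableEq κ] [Fintype κ'] [DecidableEq κ']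
variable {p : F[X]} {l : ℕ} {M : Matrix ι ι F[X]}

lemma HasForm.exists_fin {h : Prop} {r : ℕ} {δ : F[X]} (hM : HasForm h p l M r δ) :
    ∃ (y z : Fin r → ι → F[X]) (d : Fin r → F[X]), IsForm p l M y z d ∧ ∏ k, d k = δ ∧
      (h → ∀ k, y k = star (z k)) := by
  obtain ⟨κ, _, _, y, z, d, hf, rfl, rfl, hs⟩ := hM
  let e := (Fintype.equivFin κ).symm
  refine ⟨y ∘ e, z ∘ e, d ∘ e, ⟨fun k => hf.right _, fun k => hf.left _, fun j k => ?_,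
    fun k => hf.not_dvd _, fun w hw => ?_⟩, Equiv.prod_comp e d, fun hh k => hs hh _⟩
  · simpa using hf.orth (e j) (e k)
  · obtain ⟨a, ha⟩ := hf.span w hw
    refine ⟨a ∘ e, fun y' hy' => ?_⟩
    have : ∑ k, (a ∘ e) k • (z ∘ e) k = ∑ k, a k • z k := Equiv.sum_comp e fun k => a k • z k
    rw [this]
    exact ha y' hy'

lemma dotProduct_mulVec_sum_smul (y : ι → F[X]) (a : κ → F[X]) (z : κ → ι → F[X]) :
    y ⬝ᵥ M *ᵥ (∑ k, a k • z k) = ∑ k, a k * (y ⬝ᵥ M *ᵥ z k) := by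
  rw [mulVec_sum, dotProduct_sum]
  simp [mulVec_smul]

lemma dvd_of_pow_succ_dvd_pow_mul {p : F[X]} (hp : p ≠ 0) {l : ℕ} {g : F[X]}
    (h : p ^ (l + 1) ∣ p ^ l * g) : p ∣ g := by
  rw [pow_succ] at h
  exact (mul_dvd_mul_iff_left (pow_ne_zero _ hp)).1 h

/-- The matrix of a second form in terms of the first one. -/
lemma IsForm.exists_mul_eq (hp : p ≠ 0) {y z : κ → ι → F[X]} {d : κ → F[X]}
    {y' z' : κ' → ι → F[X]} {d' : κ' → F[X]} (hf : IsForm p l M y z d)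
    (hf' : IsForm p l M y' z' d') :
    ∃ (a : κ' → κ → F[X]) (b : κ' → κ → F[X]),
      (∀ j i, y' j ⬝ᵥ M *ᵥ z i = p ^ l * b j i) ∧
      (∀ j i, p ^ (l + 1) ∣ y i ⬝ᵥ M *ᵥ z' j - p ^ l * (a j i * d i)) ∧
      ∀ j k, p ∣ (if j = k then d' j else 0) - ∑ i, b j i * a k i := by
  choose a ha using fun k => hf.span (z' k) (hf'.right k)
  choose b hb using fun j i => dvd_dotProduct (u := y' j) (hf.right i)
  refine ⟨a, b, hb, fun j i => ?_, fun j k => ?_⟩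
  · have h1 := ha j (y i) (hf.left i)
    rw [mulVec_sub, dotProduct_sub, dotProduct_mulVec_sum_smul] at h1
    have h2 : p ^ (l + 1) ∣ ∑ k, a j k * (y i ⬝ᵥ M *ᵥ z k) -
        ∑ k, a j k * (p ^ l * if i = k then d i else 0) := by
      rw [← Finset.sum_sub_distrib]
      refine Finset.dvd_sum fun k _ => ?_
      rw [← mul_sub]
      exact (hf.orth i k).mul_left _
    have h3 : ∑ k, a j k * (p ^ l * if i = k then d i else 0) = p ^ l * (a j i * d i) := by
      simp; ring
    rw [h3] at h2
    have := dvd_add h1 h2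
    rwa [sub_add_sub_cancel] at this
  · have h1 := ha k (y' j) (hf'.left j)
    rw [mulVec_sub, dotProduct_sub, dotProduct_mulVec_sum_smul] at h1
    have h2 := dvd_sub h1 (hf'.orth j k)
    refine dvd_of_pow_succ_dvd_pow_mul hp (l := l) ?_
    rw [mul_sub, Finset.mul_sum]
    have h3 : ∑ i, p ^ l * (b j i * a k i) = ∑ i, a k i * (y' j ⬝ᵥ M *ᵥ z i) :=
      Finset.sum_congr rfl fun i _ => by rw [hb]; ring
    rw [h3]
    convert h2 using 1
    ring

lemma IsForm.card_le (hp : Irreducible p) {y z : κ → ι → F[X]} {d : κ → F[X]}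
    {y' z' : κ' → ι → F[X]} {d' : κ' → F[X]} (hf : IsForm p l M y z d)
    (hf' : IsForm p l M y' z' d') : Fintype.card κ' ≤ Fintype.card κ := by
  obtain ⟨a, b, -, -, hab⟩ := hf.exists_mul_eq hp.ne_zero hf'
  have _ : Fact (Irreducible p) := ⟨hp⟩
  let φ := AdjoinRoot.mk p
  let A : Matrix κ κ' (AdjoinRoot p) := of fun i k => φ (a k i)
  let B : Matrix κ' κ (AdjoinRoot p) := of fun j i => φ (b j i)
  have h1 : B * A = diagonal fun k => φ (d' k) := by
    ext j k
    have h2 := AdjoinRoot.mk_eq_mk.2 (hab j k)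
    rw [map_sum] at h2
    simp only [map_mul] at h2
    rw [mul_apply, diagonal_apply]
    change ∑ i, φ (b j i) * φ (a k i) = _
    rw [← h2]
    split_ifs <;> simp [φ]
  have h2 : IsUnit (B * A) := by
    rw [isUnit_iff_isUnit_det, h1, det_diagonal, isUnit_iff_ne_zero, Finset.prod_ne_zero_iff]
    intro k _ h
    exact hf'.not_dvd k (AdjoinRoot.mk_eq_zero.1 h)
  calc Fintype.card κ' = (B * A).rank := (rank_of_isUnit _ h2).symm
    _ ≤ B.rank := rank_mul_le_left _ _
    _ ≤ Fintype.card κ := rank_le_card_width _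

lemma HasForm.rank_unique (hp : Irreducible p) {h h' : Prop} {r r' : ℕ} {δ δ' : F[X]}
    (hM : HasForm h p l M r δ) (hM' : HasForm h' p l M r' δ') : r = r' := by
  obtain ⟨κ, _, _, y, z, d, hf, rfl, -⟩ := hM
  obtain ⟨κ', _, _, y', z', d', hf', rfl, -⟩ := hM'
  exact le_antisymm (hf'.card_le hp hf) (hf.card_le hp hf')

lemma star_dotProduct_mulVec (y z : ι → F[X]) :
    star (y ⬝ᵥ M *ᵥ z) = star z ⬝ᵥ Mᴴ *ᵥ star y := by
  rw [← star_vecMul, Matrix.star_dotProduct_star, dotProduct_mulVec]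

lemma HasForm.disc_unique (hp : Irreducible p) (hs : star p = p) (hM : Mᴴ = M) {r r' : ℕ}
    {δ δ' : F[X]} (h : HasForm True p l M r δ) (h' : HasForm True p l M r' δ') :
    r = r' ∧ ∃ g, p ∣ δ' - δ * (g * star g) := by
  have hr := h.rank_unique hp h'
  subst hr
  refine ⟨rfl, ?_⟩
  obtain ⟨y, z, d, hf, rfl, hy⟩ := h.exists_fin
  obtain ⟨y', z', d', hf', rfl, hy'⟩ := h'.exists_fin
  replace hy := hy trivial
  replace hy' := hy' trivial
  obtain ⟨a, b, hb, ha, hab⟩ := hf.exists_mul_eq hp.ne_zero hf'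
  have hstar : ∀ {k : ℕ} {g : F[X]}, p ^ k ∣ g → p ^ k ∣ star g := by
    intro k g h
    rwa [← polyStar_dvd_polyStar, star_pow, hs] at h
  have hstar1 : ∀ {g : F[X]}, p ∣ g → p ∣ star g := by
    intro g h
    simpa using hstar (k := 1) (by simpa using h)
  have hd : ∀ i, p ∣ star (d i) - d i := by
    intro i
    have h1 := hf.orth i i
    have h2 := hstar h1
    rw [star_sub, star_dotProduct_mulVec, hM, ← hy, hy, star_star, star_mul', star_pow, hs] at h2
    rw [hy] at h1
    have h3 := dvd_sub h1 h2
    rw [if_pos rfl, sub_sub_sub_cancel_left, ← mul_sub] at h3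
    exact dvd_of_pow_succ_dvd_pow_mul hp.ne_zero h3
  have hba : ∀ j i, p ∣ b j i - star (a j i) * d i := by
    intro j i
    have h1 := ha j i
    have h2 : y i ⬝ᵥ M *ᵥ z' j = p ^ l * star (b j i) := by
      rw [← congrArg (· ^ l) hs, ← star_pow, ← star_mul', ← hb, star_dotProduct_mulVec, hM, hy' j, star_star,
        ← hy]
    rw [h2, ← mul_sub] at h1
    have h3 := hstar1 (dvd_of_pow_succ_dvd_pow_mul hp.ne_zero h1)
    rw [star_sub, star_star, star_mul'] at h3
    have h4 := dvd_add h3 ((hd i).mul_left (star (a j i)))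
    convert h4 using 1
    ring
  let φ := AdjoinRoot.mk p
  let A : Matrix (Fin r) (Fin r) F[X] := of a
  refine ⟨A.det, AdjoinRoot.mk_eq_mk.1 ?_⟩
  have h1 : (diagonal fun k => φ (d' k)) =
      φ.mapMatrix ((starRingEnd F[X]).mapMatrix A) * diagonal (fun k => φ (d k)) *
        (φ.mapMatrix A)ᵀ := by
    ext j k
    have h2 := AdjoinRoot.mk_eq_mk.2 (hab j k)
    rw [map_sum] at h2
    rw [mul_apply, diagonal_apply]
    simp only [mul_diagonal, transpose_apply]
    change _ = ∑ i, φ (star (a j i)) * φ (d i) * φ (a k i)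
    have h3 : ∀ i, φ (star (a j i)) * φ (d i) * φ (a k i) = φ (b j i * a k i) := by
      intro i
      rw [map_mul φ (b j i), ← map_mul, AdjoinRoot.mk_eq_mk.2 (hba j i)]
    refine Eq.trans ?_ (h2.trans (Finset.sum_congr rfl fun i _ => (h3 i).symm))
    split_ifs <;> simp [φ]
  have h2 := congrArg det h1
  rw [det_mul, det_mul, det_diagonal, det_diagonal, det_transpose, ← RingHom.map_det,
    ← RingHom.map_det, ← RingHom.map_det, ← map_prod, ← map_prod, ← map_mul, ← map_mul] at h2
  rw [h2]
  congr 1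
  change star A.det * _ * _ = _
  ring

lemma IsForm.left_span (hp : Irreducible p) {y z : κ → ι → F[X]} {d : κ → F[X]}
    (hf : IsForm p l M y z d) (w : ι → F[X]) (hw : ∀ i, p ^ l ∣ (w ᵥ* M) i) :
    ∃ b : κ → F[X], ∀ z', (∀ i, p ^ l ∣ (M *ᵥ z') i) →
      p ^ (l + 1) ∣ (w - ∑ k, b k • y k) ⬝ᵥ M *ᵥ z' := by
  choose β hβ using fun k => dvd_dotProduct (u := w) (hf.right k)
  have hex : ∀ k, ∃ b, p ∣ β k - b * d k := by
    intro k
    obtain ⟨s, t, hst⟩ := isCoprime_of_not_dvd hp (hf.not_dvd k)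
    exact ⟨β k * t, β k * s, by linear_combination (-β k) * hst⟩
  choose b hb using hex
  refine ⟨b, fun z' hz' => ?_⟩
  obtain ⟨a, ha⟩ := hf.span z' hz'
  have hsum : ∀ v, (∑ k, b k • y k) ⬝ᵥ v = ∑ k, b k * (y k ⬝ᵥ v) := by
    intro v
    rw [sum_dotProduct]
    simp
  have h1 := ha (w - ∑ k, b k • y k) fun i => by
    rw [sub_vecMul, Pi.sub_apply, sum_vecMul, Finset.sum_apply]
    refine dvd_sub (hw i) (Finset.dvd_sum fun k _ => ?_)
    rw [smul_vecMul]
    exact (hf.left k i).mul_left _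
  rw [mulVec_sub, dotProduct_sub, dotProduct_mulVec_sum_smul] at h1
  refine (dvd_sub_comm.1 h1 |> fun h => (dvd_sub_right (Finset.dvd_sum fun k _ => ?_)).1 h)
  refine Dvd.dvd.mul_left ?_ _
  rw [sub_dotProduct, hsum, hβ]
  have h2 : p ^ (l + 1) ∣ ∑ j, b j * (y j ⬝ᵥ M *ᵥ z k) - p ^ l * (b k * d k) := by
    have : p ^ l * (b k * d k) = ∑ j, b j * (p ^ l * if j = k then d j else 0) := by
      simp; ring
    rw [this, ← Finset.sum_sub_distrib]
    refine Finset.dvd_sum fun j _ => ?_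
    rw [← mul_sub]
    exact (hf.orth j k).mul_left _
  have h3 : p ^ (l + 1) ∣ p ^ l * (β k - b k * d k) := by
    rw [pow_succ]
    exact mul_dvd_mul_left _ (hb k)
  have h4 := dvd_sub h3 h2
  convert h4 using 1
  ring

lemma HasForm.conj (hp : Irreducible p) {h : Prop} {r : ℕ} {δ : F[X]} (hM : HasForm h p l M r δ) :
    HasForm False (star p) l Mᴴ r (star δ) := by
  obtain ⟨κ, _, _, y, z, d, hf, hr, rfl, -⟩ := hM
  have hstar : ∀ {k : ℕ} {g : F[X]}, p ^ k ∣ g → star p ^ k ∣ star g := by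
    intro k g h
    rw [← star_pow]
    exact map_dvd (starRingEnd F[X]) h
  have hstar' : ∀ {k : ℕ} {g : F[X]}, star p ^ k ∣ g → p ^ k ∣ star g := by
    intro k g h
    rwa [← star_pow, ← polyStar_dvd_polyStar, star_star] at h
  refine ⟨κ, _, _, fun k => star (z k), fun k => star (y k), fun k => star (d k), ⟨?_, ?_, ?_, ?_,
    ?_⟩, hr, (map_prod (starRingEnd F[X]) _ _).symm, fun h => h.elim⟩
  · intro k i
    rw [← star_vecMul]
    exact hstar (hf.left k i)
  · intro k i
    rw [← star_mulVec]
    exact hstar (hf.right k i)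
  · intro j k
    have := hstar (hf.orth k j)
    rw [star_sub, star_dotProduct_mulVec, star_mul', star_pow] at this
    convert this using 3
    by_cases hjk : j = k
    · subst hjk; simp
    · simp [hjk, Ne.symm hjk]
  · intro k hk
    refine hf.not_dvd k ?_
    have := hstar' (k := 1) (by simpa using hk)
    simpa using this
  · intro w hw
    obtain ⟨b, hb⟩ := hf.left_span hp (star w) fun i => by
      have := hstar' (hw i)
      change p ^ l ∣ (star (Mᴴ *ᵥ w)) i at this
      rwa [star_mulVec, conjTranspose_conjTranspose] at this
    refine ⟨fun k => star (b k), fun y' hy' => ?_⟩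
    have h1 := hstar (hb (star y') fun i => by
      have := hstar' (hy' i)
      change p ^ l ∣ (star (y' ᵥ* Mᴴ)) i at this
      rwa [star_vecMul, conjTranspose_conjTranspose] at this)
    rw [star_dotProduct_mulVec, star_star] at h1
    convert h1 using 4
    rw [star_sub, star_star, star_sum]
    simp [star_smul]

end FormInvariants

section CompanionCharmatrix

variable {F : Type*} [Field F] {q : F[X]}

lemma coeff_iterate_divX (f : F[X]) (n k : ℕ) : (divX^[n] f).coeff k = f.coeff (k + n) := by
  induction n generalizing f with
  | zero => rfl
  | succ n ih => rw [Function.iterate_succ_apply, ih, coeff_divX, add_assoc]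

lemma iterate_divX_succ_mul_X (f : F[X]) (n : ℕ) :
    X * divX^[n + 1] f = divX^[n] f - C (f.coeff n) := by
  have h := divX_mul_X_add (divX^[n] f)
  rw [coeff_iterate_divX, zero_add] at h
  rw [Function.iterate_succ_apply']
  linear_combination h

lemma iterate_divX_natDegree (hq : q.Monic) : divX^[q.natDegree] q = 1 := by
  ext k
  rw [coeff_iterate_divX, coeff_one]
  rcases k with _ | k
  · simpa using hq.leadingCoeff
  · rw [coeff_eq_zero_of_natDegree_lt (by omega)]
    simp

variable {ι : Type} [Fintype ι] [DecidableEq ι]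

lemma charmatrix_mulVec (T : Matrix ι ι F) (v : ι → F[X]) :
    charmatrix T *ᵥ v = (X : F[X]) • v - T.map C *ᵥ v := by
  rw [charmatrix, sub_mulVec, scalar_apply, ← smul_one_eq_diagonal, smul_mulVec, one_mulVec]
  rfl

lemma vecMul_charmatrix (T : Matrix ι ι F) (v : ι → F[X]) :
    v ᵥ* charmatrix T = (X : F[X]) • v - v ᵥ* T.map C := by
  rw [charmatrix, vecMul_sub, scalar_apply, ← smul_one_eq_diagonal, vecMul_smul, vecMul_one]
  rfl

lemma charmatrix_companion_mulVec_zero (hN : 0 < q.natDegree) (v : Fin q.natDegree → F[X]) :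
    (charmatrix (companion F q) *ᵥ v) ⟨0, hN⟩ =
      X * v ⟨0, hN⟩ + C (q.coeff 0) * v ⟨q.natDegree - 1, by omega⟩ := by
  rw [charmatrix_mulVec]
  have : (((companion F q).map C) *ᵥ v) ⟨0, hN⟩ =
      ∑ j, if j = ⟨q.natDegree - 1, by omega⟩ then -(C (q.coeff 0) * v j) else 0 := by
    rw [mulVec, dotProduct]
    refine Finset.sum_congr rfl fun j _ => ?_
    have hj := j.2
    simp only [companion, map_apply, of_apply, Fin.ext_iff]
    rw [if_neg (by omega)]
    split_ifs <;> first | omega | simp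
  rw [Pi.sub_apply, this]
  simp

lemma charmatrix_companion_mulVec_succ {i : ℕ} (hi : i + 1 < q.natDegree)
    (v : Fin q.natDegree → F[X]) :
    (charmatrix (companion F q) *ᵥ v) ⟨i + 1, hi⟩ =
      X * v ⟨i + 1, hi⟩ - v ⟨i, by omega⟩ +
        C (q.coeff (i + 1)) * v ⟨q.natDegree - 1, by omega⟩ := by
  rw [charmatrix_mulVec]
  have : (((companion F q).map C) *ᵥ v) ⟨i + 1, hi⟩ =
      ∑ j, ((if j = ⟨i, by omega⟩ then v j else 0) +
        if j = ⟨q.natDegree - 1, by omega⟩ then -(C (q.coeff (i + 1)) * v j) else 0) := by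
    rw [mulVec, dotProduct]
    refine Finset.sum_congr rfl fun j _ => ?_
    have hj := j.2
    simp only [companion, map_apply, of_apply, Fin.ext_iff]
    split_ifs <;> first | omega | simp
  rw [Pi.sub_apply, this, Finset.sum_add_distrib]
  simp
  ring

lemma vecMul_charmatrix_companion {j : ℕ} (hj : j + 1 < q.natDegree)
    (v : Fin q.natDegree → F[X]) :
    (v ᵥ* charmatrix (companion F q)) ⟨j, by omega⟩ =
      X * v ⟨j, by omega⟩ - v ⟨j + 1, hj⟩ := by
  rw [vecMul_charmatrix]
  have : (v ᵥ* ((companion F q).map C)) ⟨j, by omega⟩ =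
      ∑ i, if i = ⟨j + 1, hj⟩ then v i else 0 := by
    rw [vecMul, dotProduct]
    refine Finset.sum_congr rfl fun i _ => ?_
    have hi := i.2
    simp only [companion, map_apply, of_apply, Fin.ext_iff]
    split_ifs <;> first | omega | simp
  rw [Pi.sub_apply, this]
  simp

lemma vecMul_charmatrix_companion_last (hN : 0 < q.natDegree) (v : Fin q.natDegree → F[X]) :
    (v ᵥ* charmatrix (companion F q)) ⟨q.natDegree - 1, by omega⟩ =
      X * v ⟨q.natDegree - 1, by omega⟩ + ∑ i : Fin q.natDegree, C (q.coeff i) * v i := by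
  rw [vecMul_charmatrix]
  have : (v ᵥ* ((companion F q).map C)) ⟨q.natDegree - 1, by omega⟩ =
      ∑ i : Fin q.natDegree, -(C (q.coeff i) * v i) := by
    rw [vecMul, dotProduct]
    refine Finset.sum_congr rfl fun i _ => ?_
    have hi := i.2
    simp only [companion, map_apply, of_apply]
    split_ifs <;> first | omega | (simp; ring)
  rw [Pi.sub_apply, this, Finset.sum_neg_distrib, sub_neg_eq_add]
  rfl

lemma charpoly_companion (hN : 0 < q.natDegree) (hq : q.Monic) :
    (charmatrix (companion F q)).det = q :=
  eq_of_monic_of_dvd_of_natDegree_le hq (charpoly_monic _)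
    ((aeval_companion_eq_zero_iff hN hq _).1 (aeval_self_charpoly _))
    ((charpoly_natDegree_eq_dim (companion F q)).trans_le (by simp))

variable (q) in
/-- The iterated quotients of `q` by `X`, the column solution of the companion pencil. -/
def hornerVec : Fin q.natDegree → F[X] := fun i => divX^[(i : ℕ) + 1] q

lemma hornerVec_last (hN : 0 < q.natDegree) (hq : q.Monic) :
    hornerVec q ⟨q.natDegree - 1, by omega⟩ = 1 := by
  simp only [hornerVec]
  rw [Nat.sub_add_cancel hN, iterate_divX_natDegree hq]

lemma charmatrix_companion_hornerVec (hN : 0 < q.natDegree) (hq : q.Monic) :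
    charmatrix (companion F q) *ᵥ hornerVec q = Pi.single ⟨0, hN⟩ q := by
  ext1 ⟨i, hi⟩
  rcases i with _ | i
  · rw [charmatrix_companion_mulVec_zero hN, hornerVec_last hN hq]
    simp only [hornerVec]
    rw [iterate_divX_succ_mul_X]
    simp
  · rw [charmatrix_companion_mulVec_succ hi, hornerVec_last hN hq]
    simp only [hornerVec]
    rw [iterate_divX_succ_mul_X]
    simp

lemma pow_vecMul_charmatrix_companion (hN : 0 < q.natDegree) (hq : q.Monic) :
    (fun i : Fin q.natDegree => (X : F[X]) ^ (i : ℕ)) ᵥ* charmatrix (companion F q) =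
      Pi.single ⟨q.natDegree - 1, by omega⟩ q := by
  ext1 ⟨j, hj⟩
  by_cases h : j + 1 = q.natDegree
  · obtain rfl : j = q.natDegree - 1 := by omega
    rw [vecMul_charmatrix_companion_last hN, Pi.single_eq_same]
    conv_rhs => rw [hq.as_sum]
    rw [← pow_succ', Nat.sub_add_cancel hN, Fin.sum_univ_eq_sum_range fun i => C (q.coeff i) * X ^ i]
  · rw [vecMul_charmatrix_companion (by omega)]
    simp only [Pi.single_apply, Fin.mk.injEq]
    rw [if_neg (by omega), ← pow_succ', sub_self]

lemma dvd_single {g f : F[X]} (h : g ∣ f) (i j : ι) : g ∣ (Pi.single i f : ι → F[X]) j := by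
  rw [Pi.single_apply]
  split_ifs
  exacts [h, dvd_zero _]

lemma dvd_sub_smul_hornerVec (hN : 0 < q.natDegree) (hq : q.Monic) {g : F[X]} (hg : g ∣ q)
    {z : Fin q.natDegree → F[X]} (hz : ∀ i, g ∣ (charmatrix (companion F q) *ᵥ z) i)
    (i : Fin q.natDegree) :
    g ∣ (z - z ⟨q.natDegree - 1, by omega⟩ • hornerVec q) i := by
  set w := z - z ⟨q.natDegree - 1, by omega⟩ • hornerVec q with hw
  have hlast : w ⟨q.natDegree - 1, by omega⟩ = 0 := by
    rw [hw, Pi.sub_apply, Pi.smul_apply, hornerVec_last hN hq]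
    simp
  have hMw : ∀ i, g ∣ (charmatrix (companion F q) *ᵥ w) i := by
    intro i
    rw [hw, mulVec_sub, mulVec_smul, charmatrix_companion_hornerVec hN hq]
    refine dvd_sub (hz i) (Dvd.dvd.mul_left (dvd_single hg _ i) _)
  have key : ∀ k (hk : k < q.natDegree), g ∣ w ⟨q.natDegree - 1 - k, by omega⟩ := by
    intro k
    induction k with
    | zero => intro _; exact hlast ▸ dvd_zero _
    | succ k ih =>
      intro hk
      have h1 := hMw ⟨q.natDegree - 1 - (k + 1) + 1, by omega⟩
      rw [charmatrix_companion_mulVec_succ (by omega), hlast, mul_zero, add_zero] at h1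
      refine (dvd_sub_right (Dvd.dvd.mul_left ?_ _)).1 h1
      convert ih (by omega) using 3
      omega
  convert key (q.natDegree - 1 - i) (by omega)
  omega

lemma dvd_of_dvd_vecMul_charmatrix_companion (hN : 0 < q.natDegree) {g : F[X]}
    {v : Fin q.natDegree → F[X]} (hv : ∀ i, g ∣ (v ᵥ* charmatrix (companion F q)) i)
    (h0 : g ∣ v ⟨0, hN⟩) (i : Fin q.natDegree) : g ∣ v i := by
  obtain ⟨i, hi⟩ := i
  induction i with
  | zero => exact h0
  | succ i ih =>
    have h1 := hv ⟨i, by omega⟩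
    rw [vecMul_charmatrix_companion hi] at h1
    exact (dvd_sub_right ((ih (by omega)).mul_left _)).1 h1

lemma dvd_vecMul_aeval_sub {T : Matrix ι ι F} {g : F[X]} {v : ι → F[X]}
    (hv : ∀ i, g ∣ (v ᵥ* charmatrix T) i) (f : F[X]) (i : ι) :
    g ∣ (v ᵥ* (aeval T f).map C - f • v) i := by
  induction f using Polynomial.induction_on generalizing i with
  | C a =>
    rw [aeval_C, Matrix.algebraMap_eq_diagonal, diagonal_map (map_zero C), Pi.sub_apply,
      vecMul_diagonal]
    simp [mul_comm]
  | add f f' ih ih' =>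
    have := dvd_add (ih i) (ih' i)
    rw [map_add, Matrix.map_add _ (map_add C), vecMul_add, add_smul]
    convert this using 1
    simp only [Pi.sub_apply, Pi.add_apply]
    ring
  | monomial n a ih =>
    have h1 : v ᵥ* (aeval T (C a * X ^ (n + 1))).map C - (C a * X ^ (n + 1)) • v =
        (v ᵥ* (aeval T (C a * X ^ n)).map C - (C a * X ^ n) • v) ᵥ* T.map C -
          (C a * X ^ n) • (v ᵥ* charmatrix T) := by
      rw [vecMul_charmatrix, pow_succ, ← mul_assoc, map_mul, aeval_X, Matrix.map_mul,
        ← vecMul_vecMul, sub_vecMul, smul_vecMul, smul_sub, smul_smul]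
      abel
    rw [h1]
    exact dvd_sub (Finset.dvd_sum fun j _ => (ih j).mul_right _) ((hv i).mul_left _)

end CompanionCharmatrix

section CompanionForms

variable {F : Type*} [Field F] [StarRing F] {q : F[X]}

lemma dvd_dotProduct_companion (hN : 0 < q.natDegree) (hq : q.Monic) {g : F[X]} (hg : g ∣ q)
    {y z : Fin q.natDegree → F[X]} (hy : ∀ i, g ∣ (y ᵥ* charmatrix (companion F q)) i)
    (hz : ∀ i, g ∣ (charmatrix (companion F q) *ᵥ z) i) :
    g * g ∣ y ⬝ᵥ charmatrix (companion F q) *ᵥ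
      (z - z ⟨q.natDegree - 1, by omega⟩ • hornerVec q) := by
  rw [dotProduct_mulVec]
  exact mul_dvd_dotProduct hy (dvd_sub_smul_hornerVec hN hq hg hz)

lemma Degen.charmatrix_companion (hN : 0 < q.natDegree) (hq : q.Monic) {p : F[X]} {l : ℕ}
    (hl : 0 < l) (h : p ^ (l + 1) ∣ q) : Degen p l (charmatrix (companion F q)) := by
  intro y z hy hz
  have h1 : p ^ (l + 1) ∣ p ^ l * p ^ l := by
    rw [← pow_add]
    exact pow_dvd_pow _ (by omega)
  have h2 := h1.trans (dvd_dotProduct_companion hN hq ((pow_dvd_pow _ (by omega)).trans h) hy hz)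
  rw [mulVec_sub, dotProduct_sub, mulVec_smul, charmatrix_companion_hornerVec hN hq] at h2
  refine (dvd_sub_left ?_).1 h2
  rw [dotProduct_smul]
  exact (dvd_dotProduct (dvd_single h _)).mul_left _

lemma eq_and_le_of_pow_dvd_pow {p p' : F[X]} (hm : p.Monic) (hi : Irreducible p)
    (hm' : p'.Monic) (hi' : Irreducible p') {l m : ℕ} (hl : 0 < l) (h : p ^ l ∣ p' ^ m) :
    p = p' ∧ l ≤ m := by
  have h1 : p ∣ p' := hi.prime.dvd_of_dvd_pow ((dvd_pow_self p hl.ne').trans h)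
  have h2 : p = p' := eq_of_monic_of_associated hm hm' (hi.associated_of_dvd hi' h1)
  subst h2
  exact ⟨rfl, (pow_dvd_pow_iff hi.ne_zero hi.not_isUnit).1 h⟩

lemma Degen.charmatrix_companion_pow {p p' : F[X]} (hm : p.Monic) (hi : Irreducible p)
    (hm' : p'.Monic) (hi' : Irreducible p') {l m : ℕ} (hl : 0 < l) (hm0 : 0 < m)
    (h : ¬ (p = p' ∧ l = m)) : Degen p l (charmatrix (companion F (p' ^ m))) := by
  have hN : 0 < (p' ^ m).natDegree := by
    rw [natDegree_pow]
    exact Nat.mul_pos hm0 hi'.natDegree_pos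
  by_cases hd : p ^ l ∣ p' ^ m
  · obtain ⟨rfl, hle⟩ := eq_and_le_of_pow_dvd_pow hm hi hm' hi' hl hd
    exact Degen.charmatrix_companion hN (hm.pow m) hl
      (pow_dvd_pow _ (lt_of_le_of_ne hle fun hh => h ⟨rfl, hh⟩))
  · refine Degen.of_not_dvd_det hi ?_
    rwa [charpoly_companion hN (hm'.pow m)]

lemma hasForm_charmatrix_companion {p : F[X]} (hm : p.Monic) (hi : Irreducible p) {l : ℕ}
    (hl : 0 < l) : HasForm False p l (charmatrix (companion F (p ^ l))) 1 1 := by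
  have hN : 0 < (p ^ l).natDegree := by
    rw [natDegree_pow]
    exact Nat.mul_pos hl hi.natDegree_pos
  have hq := hm.pow l
  refine ⟨Unit, inferInstance, inferInstance, fun _ i => X ^ (i : ℕ), fun _ => hornerVec _,
    fun _ => 1, ⟨?_, ?_, ?_, ?_, ?_⟩, by simp, by simp, fun h => h.elim⟩
  · intro k i
    rw [charmatrix_companion_hornerVec hN hq]
    exact dvd_single dvd_rfl _ _
  · intro k i
    rw [pow_vecMul_charmatrix_companion hN hq]
    exact dvd_single dvd_rfl _ _
  · intro j k
    rw [charmatrix_companion_hornerVec hN hq, dotProduct_single]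
    simp
  · exact fun _ h => hi.not_isUnit (isUnit_of_dvd_one h)
  · intro w hw
    refine ⟨fun _ => w ⟨(p ^ l).natDegree - 1, by omega⟩, fun y' hy' => ?_⟩
    have h1 := dvd_dotProduct_companion hN hq dvd_rfl hy' hw
    rw [← pow_add] at h1
    simpa using (pow_dvd_pow p (by omega)).trans h1

open Classical in
lemma HasForm.charmatrix_companion_pow {p p' : F[X]} (hm : p.Monic) (hi : Irreducible p)
    (hm' : p'.Monic) (hi' : Irreducible p') {l m : ℕ} (hl : 0 < l) (hm0 : 0 < m) :
    HasForm False p l (charmatrix (companion F (p' ^ m))) (if p = p' ∧ l = m then 1 else 0) 1 := by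
  split_ifs with h
  · obtain ⟨rfl, rfl⟩ := h
    exact hasForm_charmatrix_companion hm hi hl
  · exact (Degen.charmatrix_companion_pow hm hi hm' hi' hl hm0 h).hasForm _

/-- The discriminant of the pencil `(G, G * Φ)` for a Frobenius block `Φ` with characteristic
polynomial `q`. -/
def companionDisc (q : F[X]) (hN : 0 < q.natDegree) (G : Mat F q.natDegree) : F[X] :=
  (star (hornerVec q) ᵥ* G.map C) ⟨0, hN⟩

lemma star_map_C {m n : Type} (G : Matrix m n F) :
    (G.map (C : F →+* F[X]))ᴴ = Gᴴ.map C := by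
  ext i j : 2
  simp [polyStar_C]

lemma charmatrix_conjTranspose {ι : Type} [Fintype ι] [DecidableEq ι] (T : Matrix ι ι F) :
    (charmatrix T)ᴴ = charmatrix Tᴴ := by
  rw [charmatrix, conjTranspose_sub, scalar_apply, diagonal_conjTranspose]
  change _ - (T.map (C : F →+* F[X]))ᴴ = _
  rw [star_map_C, charmatrix, scalar_apply]
  congr 2
  ext1 i
  simp [polyStar_X]

lemma map_mul_charmatrix_herm {ι : Type} [Fintype ι] [DecidableEq ι] {G T : Matrix ι ι F}
    (hG : Gᴴ = G) (hGT : G * T = Tᴴ * G) :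
    (G.map (C : F →+* F[X]) * charmatrix T)ᴴ = G.map (C : F →+* F[X]) * charmatrix T := by
  rw [conjTranspose_mul, star_map_C, charmatrix_conjTranspose, hG, charmatrix, charmatrix, sub_mul,
    mul_sub, RingHom.mapMatrix_apply, RingHom.mapMatrix_apply, ← Matrix.map_mul, ← hGT,
    Matrix.map_mul]
  congr 1
  exact scalar_commute _ (fun _ => Commute.all _ _) _

section
variable (hN : 0 < q.natDegree) (hq : q.Monic) (hqs : star q = q) {G : Mat F q.natDegree}
  (hG : Gᴴ = G) (hGT : G * companion F q = (companion F q)ᴴ * G)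
include hN hq hqs hG hGT

lemma dvd_star_hornerVec_vecMul (i : Fin q.natDegree) :
    q ∣ ((star (hornerVec q) ᵥ* G.map C) ᵥ* charmatrix (companion F q)) i := by
  have : (star (hornerVec q) ᵥ* G.map C) ᵥ* charmatrix (companion F q) =
      star (G.map C *ᵥ Pi.single ⟨0, hN⟩ q) := by
    rw [vecMul_vecMul, ← map_mul_charmatrix_herm hG hGT, ← star_mulVec, ← mulVec_mulVec,
      charmatrix_companion_hornerVec hN hq]
  rw [this]
  change q ∣ star _
  have h : q ∣ (G.map C *ᵥ Pi.single ⟨0, hN⟩ q) i := dvd_dotProduct (dvd_single dvd_rfl _)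
  exact hqs.symm.dvd.trans (polyStar_dvd_polyStar.2 h)

lemma not_dvd_companionDisc {p : F[X]} (hp : Irreducible p) (hpq : p ∣ q) (hdet : IsUnit G.det) :
    ¬ p ∣ companionDisc q hN G := by
  intro h
  have h1 := dvd_of_dvd_vecMul_charmatrix_companion hN
    (fun i => hpq.trans (dvd_star_hornerVec_vecMul hN hq hqs hG hGT i)) h
  have h2 : star (hornerVec q) = (star (hornerVec q) ᵥ* G.map C) ᵥ* (G⁻¹).map C := by
    rw [vecMul_vecMul, ← Matrix.map_mul, mul_nonsing_inv _ hdet, Matrix.map_one _ C_0 C_1,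
      vecMul_one]
  have h3 : p ∣ star (hornerVec q) ⟨q.natDegree - 1, by omega⟩ := by
    rw [h2]
    exact dotProduct_dvd h1
  rw [Pi.star_apply, hornerVec_last hN hq, star_one] at h3
  exact hp.not_isUnit (isUnit_of_dvd_one h3)

lemma companionDisc_mul_aeval (f : F[X]) :
    q ∣ companionDisc q hN (G * aeval (companion F q) f) - companionDisc q hN G * f := by
  have := dvd_vecMul_aeval_sub (dvd_star_hornerVec_vecMul hN hq hqs hG hGT) f ⟨0, hN⟩
  rw [vecMul_vecMul, ← Matrix.map_mul] at this
  rwa [companionDisc, companionDisc, mul_comm _ f]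

end

lemma hasForm_map_mul_charmatrix {p : F[X]} (hm : p.Monic) (hi : Irreducible p) (hs : star p = p)
    {l : ℕ} (hl : 0 < l) (hN : 0 < (p ^ l).natDegree) {G : Mat F (p ^ l).natDegree} (hG : Gᴴ = G)
    (hGT : G * companion F (p ^ l) = (companion F (p ^ l))ᴴ * G) (hdet : IsUnit G.det) {d : F[X]}
    (hd : p ∣ companionDisc _ hN G - d) :
    HasForm True p l (G.map C * charmatrix (companion F (p ^ l))) 1 d := by
  have hq := hm.pow l
  have hqs : star (p ^ l) = p ^ l := by rw [star_pow, hs]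
  have hright : ∀ i, p ^ l ∣
      ((G.map C * charmatrix (companion F (p ^ l))) *ᵥ hornerVec (p ^ l)) i := by
    intro i
    rw [← mulVec_mulVec, charmatrix_companion_hornerVec hN hq]
    exact dvd_dotProduct (dvd_single dvd_rfl _)
  refine ⟨Unit, inferInstance, inferInstance, fun _ => star (hornerVec _), fun _ => hornerVec _,
    fun _ => d, ⟨fun _ => hright, ?_, ?_, ?_, ?_⟩, by simp, by simp, fun _ _ => rfl⟩
  · intro k i
    rw [← vecMul_vecMul]
    exact dvd_star_hornerVec_vecMul hN hq hqs hG hGT i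
  · intro j k
    have : star (hornerVec (p ^ l)) ⬝ᵥ
        (G.map C * charmatrix (companion F (p ^ l))) *ᵥ hornerVec (p ^ l) =
        p ^ l * companionDisc _ hN G := by
      rw [← mulVec_mulVec, charmatrix_companion_hornerVec hN hq, dotProduct_mulVec,
        dotProduct_single, companionDisc, mul_comm]
    rw [this, if_pos rfl, ← mul_sub, pow_succ]
    exact mul_dvd_mul_left _ hd
  · intro k hk
    exact not_dvd_companionDisc hN hq hqs hG hGT hi (dvd_pow_self _ hl.ne') hdet
      ((dvd_sub_left hk).1 hd)
  · intro w hw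
    refine ⟨fun _ => w ⟨(p ^ l).natDegree - 1, by omega⟩, fun y' hy' => ?_⟩
    have h0 : ∀ i, p ^ l ∣ (charmatrix (companion F (p ^ l)) *ᵥ w) i := by
      intro i
      have : charmatrix (companion F (p ^ l)) *ᵥ w =
          (G⁻¹).map C *ᵥ ((G.map C * charmatrix (companion F (p ^ l))) *ᵥ w) := by
        rw [← mulVec_mulVec, mulVec_mulVec, ← Matrix.map_mul, nonsing_inv_mul _ hdet,
          Matrix.map_one _ C_0 C_1, one_mulVec]
      rw [this]
      exact dvd_dotProduct hw
    have h1 := dvd_dotProduct_companion hN hq dvd_rfl (y := y' ᵥ* G.map C) (fun i => by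
      rw [vecMul_vecMul]; exact hy' i) h0
    rw [← pow_add, ← dotProduct_mulVec, mulVec_mulVec] at h1
    simpa using (pow_dvd_pow p (by omega)).trans h1

lemma Degen.map_mul {ι : Type} [Fintype ι] [DecidableEq ι] {p : F[X]} {l : ℕ}
    {M : Matrix ι ι F[X]} (hM : Degen p l M) {G : Matrix ι ι F} (hG : IsUnit G.det) :
    Degen p l (G.map C * M) := by
  have := hM.equiv (U := G.map C) (U' := (G⁻¹).map C) (V := 1) (V' := 1)
    (by rw [← Matrix.map_mul, nonsing_inv_mul _ hG, Matrix.map_one _ C_0 C_1]) (one_mul 1)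
  rwa [Matrix.mul_one] at this

end CompanionForms

section Pencils

variable {F : Type*} [Field F] [StarRing F]
variable {ι κ : Type} [Fintype ι] [DecidableEq ι] [Fintype κ] [DecidableEq κ]

/-- The matrix pencil of a pair. -/
def pencil (P : MatPair F ι) : Matrix ι ι F[X] :=
  (X : F[X]) • P.1.map (C : F →+* F[X]) - P.2.map (C : F →+* F[X])

lemma PairCong.hasForm {h : Prop} {p : F[X]} {l r : ℕ} {δ : F[X]} {P : MatPair F ι}
    {Q : MatPair F κ} (hPQ : PairCong P Q) (hP : HasForm h p l (pencil P) r δ) :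
    HasForm h p l (pencil Q) r δ := by
  obtain ⟨S, S', h1, h2, h3, h4⟩ := hPQ
  have e : pencil Q = (S.map (C : F →+* F[X]))ᴴ * pencil P * S.map (C : F →+* F[X]) := by
    rw [pencil, pencil, ← h3, ← h4, star_map_C, Matrix.mul_sub, Matrix.sub_mul, Matrix.mul_smul,
      Matrix.smul_mul]
    simp only [Matrix.map_mul]
  have k1 : S.map (C : F →+* F[X]) * S'.map (C : F →+* F[X]) = 1 := by
    rw [← Matrix.map_mul, h1, Matrix.map_one _ C_0 C_1]
  have k2 : S'.map (C : F →+* F[X]) * S.map (C : F →+* F[X]) = 1 := by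
    rw [← Matrix.map_mul, h2, Matrix.map_one _ C_0 C_1]
  rw [e]
  exact hP.equiv (U' := (S'.map (C : F →+* F[X]))ᴴ) (by rw [← conjTranspose_mul, k2, conjTranspose_one])
    (by rw [← conjTranspose_mul, k1, conjTranspose_one]) k1 k2 fun _ => rfl

lemma pencil_pairSum (P : MatPair F ι) (Q : MatPair F κ) :
    pencil (pairSum P Q) = fromBlocks (pencil P) 0 0 (pencil Q) := by
  ext (i | i) (j | j) : 2 <;> simp [pencil, pairSum]

lemma pencil_conjTranspose {P : MatPair F ι} (hP : IsHermPair P) : (pencil P)ᴴ = pencil P := by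
  rw [pencil, conjTranspose_sub, conjTranspose_smul, star_map_C, star_map_C, hP.1, hP.2,
    polyStar_X]

lemma hasForm_psum {h : Prop} {p : F[X]} {l : ℕ} {α : Type*} (f : α → PBlock F) (r : α → ℕ)
    (δ : α → F[X]) (L : List α) (hL : ∀ c ∈ L, HasForm h p l (pencil (f c).2) (r c) (δ c)) :
    HasForm h p l (pencil (psum (L.map f)).2) (L.map r).sum (L.map δ).prod := by
  induction L with
  | nil =>
    refine Degen.hasForm (fun y z _ _ => ?_) h
    have : y ⬝ᵥ pencil (psum (List.map f [])).2 *ᵥ z = 0 := Fin.sum_univ_zero _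
    rw [this]
    exact dvd_zero _
  | cons c L ih =>
    have h1 := ih fun c' hc' => hL c' (List.mem_cons_of_mem _ hc')
    have h2 := (hL c List.mem_cons_self).sum h1
    rw [← pencil_pairSum] at h2
    exact (psum_cons_cong _ _).symm.hasForm h2

lemma pencil_eq_mul_charmatrix (N T : Matrix ι ι F) :
    pencil (N, N * T) = N.map (C : F →+* F[X]) * charmatrix T := by
  have h : N.map (C : F →+* F[X]) * scalar ι (X : F[X]) = (X : F[X]) • N.map (C : F →+* F[X]) := by
    rw [scalar_apply, ← smul_one_eq_diagonal, Matrix.mul_smul, Matrix.mul_one]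
  rw [charmatrix, Matrix.mul_sub, h, RingHom.mapMatrix_apply, ← Matrix.map_mul, pencil]

lemma pencil_polyPair (N T : Matrix ι ι F) (g : F[X]) :
    pencil (polyPair N T g) = (N * aeval T g).map (C : F →+* F[X]) * charmatrix T := by
  rw [← pencil_eq_mul_charmatrix, polyPair, Matrix.mul_assoc, Matrix.mul_assoc,
    mul_aeval_of_mul_eq rfl]

lemma Degen.pencil_swap {P : MatPair F ι} (hP : IsUnit P.1.det) (l : ℕ) :
    Degen (X : F[X]) (l + 1) (pencil P.swap) := by
  refine Degen.of_not_dvd_det irreducible_X fun h => ?_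
  have h1 := X_dvd_iff.1 ((dvd_pow_self X l.succ_ne_zero).trans h)
  rw [coeff_zero_eq_eval_zero, ← coe_evalRingHom, RingHom.map_det, RingHom.mapMatrix_apply] at h1
  have h3 : (pencil P.swap).map (evalRingHom (0 : F)) = -P.1 := by
    ext i j; simp [pencil]
  rw [h3, det_neg] at h1
  exact (mul_ne_zero (pow_ne_zero _ (neg_ne_zero.2 one_ne_zero)) hP.ne_zero) h1

lemma isUnit_det_of_triangular {n : ℕ} {M : Matrix (Fin n) (Fin n) F[X]}
    (hd : ∀ i, M i i = -1) (h : (∀ i j, i < j → M i j = 0) ∨ ∀ i j, j < i → M i j = 0) :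
    IsUnit M.det := by
  have hu : IsUnit (∏ i, M i i) := by
    simp only [hd, Finset.prod_const]
    exact isUnit_one.neg.pow _
  rcases h with h | h
  · rwa [det_of_isLowerTriangular M fun i j hij => h i j hij]
  · rwa [det_of_isUpperTriangular (M := M) fun i j hij => h i j hij]

lemma degen_singular {n l : ℕ} {p : F[X]} (hl : 0 < l) {E : Matrix (Fin n) (Fin (n + 1)) F[X]}
    {K : Matrix (Fin (n + 1)) (Fin n) F[X]} (h : IsUnit (E * K).det) :
    Degen p l (fromBlocks 0 Eᴴ E 0) :=
  Degen.of_rightInverse hl (E' := K * (E * K)⁻¹)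
    (by rw [← Matrix.mul_assoc, mul_nonsing_inv _ h])

lemma pencil_antidiagonal (A B : Matrix κ ι F) :
    pencil (fromBlocks 0 Aᴴ A 0, fromBlocks 0 Bᴴ B 0) =
      fromBlocks 0 ((X : F[X]) • A.map (C : F →+* F[X]) - B.map (C : F →+* F[X]))ᴴ
        ((X : F[X]) • A.map (C : F →+* F[X]) - B.map (C : F →+* F[X])) 0 := by
  rw [conjTranspose_sub, conjTranspose_smul, star_map_C, star_map_C, polyStar_X]
  ext (i | i) (j | j) : 2 <;> simp [pencil]

lemma degen_pencil_singPair {p : F[X]} {l : ℕ} (hl : 0 < l) (n : ℕ) :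
    Degen p l (pencil (singPair F n)) := by
  rw [singPair, pencil_antidiagonal]
  refine degen_singular hl (K := ((tailMat F n).map (C : F →+* F[X]))ᵀ) ?_
  have key : ∀ i j : Fin n, (((X : F[X]) • (initMat F n).map (C : F →+* F[X]) -
      (tailMat F n).map (C : F →+* F[X])) * ((tailMat F n).map (C : F →+* F[X]))ᵀ) i j =
      (if (i : ℕ) = j + 1 then X else 0) - if i = j then 1 else 0 := by
    intro i j
    rw [Matrix.mul_apply, Finset.sum_eq_single ⟨j + 1, by omega⟩]
    · simp [initMat, tailMat, Fin.ext_iff]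
    · intro k _ hk
      have : (j : ℕ) + 1 ≠ k := fun h => hk (Fin.ext h.symm)
      simp [tailMat, this]
    · simp
  refine isUnit_det_of_triangular (fun i => ?_) (.inl fun i j hij => ?_)
  · rw [key]; simp
  · have : (i : ℕ) < j := hij
    rw [key, if_neg (by omega), if_neg (by omega), sub_zero]

lemma degen_pencil_singPair_swap {p : F[X]} {l : ℕ} (hl : 0 < l) (n : ℕ) :
    Degen p l (pencil (singPair F n).swap) := by
  rw [singPair, Prod.swap_prod_mk, pencil_antidiagonal]
  refine degen_singular hl (K := ((initMat F n).map (C : F →+* F[X]))ᵀ) ?_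
  have key : ∀ i j : Fin n, (((X : F[X]) • (tailMat F n).map (C : F →+* F[X]) -
      (initMat F n).map (C : F →+* F[X])) * ((initMat F n).map (C : F →+* F[X]))ᵀ) i j =
      (if (i : ℕ) + 1 = j then X else 0) - if i = j then 1 else 0 := by
    intro i j
    rw [Matrix.mul_apply, Finset.sum_eq_single ⟨j, by omega⟩]
    · simp [initMat, tailMat, Fin.ext_iff]
    · intro k _ hk
      have : (j : ℕ) ≠ k := fun h => hk (Fin.ext h.symm)
      simp [initMat, this]
    · simp
  refine isUnit_det_of_triangular (fun i => ?_) (.inr fun i j hij => ?_)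
  · rw [key]; simp
  · have : (j : ℕ) < i := hij
    rw [key, if_neg (by omega), if_neg (by omega), sub_zero]

end Pencils

section CodePencils

variable {F : Type*} [Field F] [StarRing F] {p : F[X]} {l : ℕ}

lemma isUnit_det_mul_aeval {q f : F[X]} (hN : 0 < q.natDegree) (hq : q.Monic) (hqf : IsCoprime q f)
    {N : Mat F q.natDegree} (hdet : IsUnit N.det) : IsUnit (N * aeval (companion F q) f).det := by
  obtain ⟨k, hk, -⟩ := exists_inverse_aeval (aeval_companion_self hN hq) hqf
  rw [det_mul]
  exact hdet.mul (IsUnit.of_mul_eq_one _ (by rw [← det_mul, hk, det_one]))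

lemma hasForm_pencil_polyPair (hm : p.Monic) (hi : Irreducible p) (hs : star p = p)
    {N : Mat F (p ^ (l + 1)).natDegree} (hdet : IsUnit N.det) (hN : Nᴴ = N)
    (hNΦ : (N * companion F (p ^ (l + 1)))ᴴ = N * companion F (p ^ (l + 1))) {f : F[X]}
    (hfs : star f = f) (hf : ¬ p ∣ f) :
    HasForm True p (l + 1) (pencil (polyPair N (companion F (p ^ (l + 1))) f)) 1
      (companionDisc _ (natDegree_pow_succ_pos hi l) N * f) := by
  have hpos := natDegree_pow_succ_pos hi l
  have hq := hm.pow (l + 1)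
  have h := mul_eq_conjTranspose_mul_of_herm hN hNΦ
  have hG : (N * aeval (companion F (p ^ (l + 1))) f)ᴴ =
      N * aeval (companion F (p ^ (l + 1))) f := by
    rw [conjTranspose_mul, hN, mul_aeval_eq_conjTranspose_mul h, hfs]
  have hGT : N * aeval (companion F (p ^ (l + 1))) f * companion F (p ^ (l + 1)) =
      (companion F (p ^ (l + 1)))ᴴ * (N * aeval (companion F (p ^ (l + 1))) f) := by
    rw [Matrix.mul_assoc, ← mul_aeval_of_mul_eq rfl, ← Matrix.mul_assoc, h, Matrix.mul_assoc]
  rw [pencil_polyPair]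
  exact hasForm_map_mul_charmatrix hm hi hs l.succ_pos hpos hG hGT
    (isUnit_det_mul_aeval hpos hq (isCoprime_of_not_dvd hi hf).pow_left hdet)
    ((dvd_pow_self p l.succ_ne_zero).trans
      (companionDisc_mul_aeval hpos hq (by rw [star_pow, hs]) hN h f))

lemma degen_pencil_polyPair (hm : p.Monic) (hi : Irreducible p) {p' : F[X]} (hm' : p'.Monic)
    (hi' : Irreducible p') {l' : ℕ} (hne : ¬ (p = p' ∧ l = l'))
    {N : Mat F (p' ^ (l' + 1)).natDegree} (hdet : IsUnit N.det) {f : F[X]} (hf : ¬ p' ∣ f) :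
    Degen p (l + 1) (pencil (polyPair N (companion F (p' ^ (l' + 1))) f)) := by
  rw [pencil_polyPair]
  exact (Degen.charmatrix_companion_pow hm hi hm' hi' l.succ_pos l'.succ_pos
    (by simpa using hne)).map_mul (isUnit_det_mul_aeval (natDegree_pow_succ_pos hi' l')
      (hm'.pow _) (isCoprime_of_not_dvd hi' hf).pow_left hdet)

lemma degen_pencil_infty (hi : Irreducible p) {n : ℕ} {N : Mat F ((X : F[X]) ^ (n + 1)).natDegree}
    (hdet : IsUnit N.det) {t : F} (ht : t ≠ 0) :
    Degen p (l + 1) (pencil (polyPair N (companion F (X ^ (n + 1))) (C t)).swap) := by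
  have hT : companion F ((X : F[X]) ^ (n + 1)) ^ (n + 1) = 0 := by
    have := aeval_companion_self (natDegree_pow_succ_pos irreducible_X n)
      ((monic_X (R := F)).pow (n + 1))
    rwa [map_pow, aeval_X] at this
  set T := companion F ((X : F[X]) ^ (n + 1)) with hTdef
  have e : pencil (polyPair N T (C t)).swap = (N.map (C : F →+* F[X]) *
      (-C t • (1 - (X : F[X]) • T.map (C : F →+* F[X])))) := by
    rw [polyPair, aeval_C, Algebra.algebraMap_eq_smul_one, Matrix.mul_smul, Matrix.mul_one, Matrix.mul_smul,
      Matrix.mul_one, Prod.swap_prod_mk, pencil]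
    have h1 : (t • (N * T)).map (C : F →+* F[X]) = C t • (N.map (C : F →+* F[X]) *
      T.map (C : F →+* F[X])) := by
      rw [← Matrix.map_mul]; ext1 i j; exact C_mul
    have h2 : (t • N).map (C : F →+* F[X]) = C t • N.map (C : F →+* F[X]) := by
      ext1 i j; exact C_mul
    rw [h1, h2, Matrix.mul_smul, Matrix.mul_sub, Matrix.mul_one, Matrix.mul_smul, smul_comm,
      neg_smul, smul_sub, neg_sub]
  have hnil : IsNilpotent ((X : F[X]) • T.map (C : F →+* F[X])) := by
    refine ⟨n + 1, ?_⟩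
    have : T.map (C : F →+* F[X]) ^ (n + 1) = 0 := by
      rw [← RingHom.mapMatrix_apply, ← map_pow, hT, map_zero]
    rw [_root_.smul_pow, this, smul_zero]
  have hu : IsUnit (1 - (X : F[X]) • T.map (C : F →+* F[X])).det :=
    (isUnit_iff_isUnit_det _).1 hnil.isUnit_one_sub
  rw [e]
  refine Degen.map_mul (Degen.of_not_dvd_det hi fun h => ?_) hdet
  rw [det_smul] at h
  refine hi.not_isUnit (isUnit_of_dvd_unit ((dvd_pow_self p l.succ_ne_zero).trans h) ?_)
  exact ((isUnit_C.2 ht.isUnit).neg.pow _).mul hu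

lemma pencil_skew {ι : Type} [Fintype ι] [DecidableEq ι] (T : Matrix ι ι F) :
    pencil (fromBlocks 0 1 1 0, fromBlocks 0 Tᴴ T 0) =
      fromBlocks 0 1 1 0 * fromBlocks (charmatrix T) 0 0 (charmatrix T)ᴴ * 1 := by
  have h := pencil_antidiagonal (1 : Matrix ι ι F) T
  rw [conjTranspose_one] at h
  have e : (X : F[X]) • (1 : Matrix ι ι F).map (C : F →+* F[X]) - T.map (C : F →+* F[X]) =
      charmatrix T := by
    rw [Matrix.map_one _ C_0 C_1, charmatrix, smul_one_eq_diagonal, scalar_apply,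
      RingHom.mapMatrix_apply]
  rw [h, e, Matrix.mul_one, fromBlocks_multiply]
  simp

lemma fromBlocks_swap_mul_self {R ι : Type*} [CommRing R] [Fintype ι] [DecidableEq ι] :
    (fromBlocks 0 1 1 0 : Matrix (ι ⊕ ι) (ι ⊕ ι) R) * fromBlocks 0 1 1 0 = 1 := by
  rw [fromBlocks_multiply, ← fromBlocks_one]
  simp

open Classical in
lemma hasForm_pencil_skew (hm : p.Monic) (hi : Irreducible p) {p' : F[X]} (hm' : p'.Monic)
    (hi' : Irreducible p') (l' : ℕ) :
    HasForm False p (l + 1) (pencil (fromBlocks 0 1 1 0,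
      fromBlocks 0 (companion F (p' ^ (l' + 1)))ᴴ (companion F (p' ^ (l' + 1))) 0))
      ((if p = p' ∧ l = l' then 1 else 0) + if star p = p' ∧ l = l' then 1 else 0) 1 := by
  have h1 := HasForm.charmatrix_companion_pow hm hi hm' hi' l.succ_pos l'.succ_pos
  have h2 := (HasForm.charmatrix_companion_pow (polyStar_monic hm) (polyStar_irreducible hi) hm' hi'
    l.succ_pos l'.succ_pos).conj (polyStar_irreducible hi)
  rw [star_star] at h2
  have h3 := h1.sum h2
  rw [star_one, mul_one] at h3
  simp only [Nat.add_right_cancel_iff, Nat.succ_eq_add_one] at h3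
  rw [pencil_skew]
  exact h3.equiv fromBlocks_swap_mul_self fromBlocks_swap_mul_self (Matrix.mul_one 1)
    (Matrix.mul_one 1) False.elim

lemma degen_pencil_skew (hi : Irreducible p) (hs : star p = p) (hm : p.Monic) {p' : F[X]}
    (hm' : p'.Monic) (hi' : Irreducible p') (hs' : star p' ≠ p') (l' : ℕ) :
    Degen p (l + 1) (pencil (fromBlocks 0 1 1 0,
      fromBlocks 0 (companion F (p' ^ (l' + 1)))ᴴ (companion F (p' ^ (l' + 1))) 0)) := by
  have hpos := natDegree_pow_succ_pos hi' l'
  rw [pencil_skew]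
  refine Degen.equiv (Degen.of_not_dvd_det hi fun h => ?_) fromBlocks_swap_mul_self
    (Matrix.mul_one 1)
  rw [det_fromBlocks_zero₁₂, det_conjTranspose, charpoly_companion hpos (hm'.pow _)] at h
  have hne : ¬ p ∣ p' ^ (l' + 1) := fun h' => hs' (by
    obtain rfl := (dvd_of_irreducible_of_dvd hm hi hm' hi' (hi.prime.dvd_of_dvd_pow h'))
    exact hs)
  rcases hi.prime.dvd_or_dvd ((dvd_pow_self p l.succ_ne_zero).trans h) with h | h
  · exact hne h
  · refine hne (polyStar_dvd_polyStar.1 ?_)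
    rwa [hs]

variable (D : CanonData F)

namespace CanonData

lemma not_dvd_ite (hm : p.Monic) (hi : Irreducible p) (hs : star p = p) (b : Bool) :
    ¬ p ∣ if b then D.rep p else 1 := by
  cases b
  · exact fun h => hi.not_isUnit (isUnit_of_dvd_one h)
  · exact (D.isNormRep_rep p hm hi hs).not_dvd

lemma star_ite (hm : p.Monic) (hi : Irreducible p) (hs : star p = p) (b : Bool) :
    star (if b then D.rep p else 1) = if b then D.rep p else 1 := by
  cases b
  · exact star_one _
  · exact (D.isNormRep_rep p hm hi hs).star_eq

lemma unit_ne_zero : D.unit ≠ 0 := fun h => D.isNormRep_unit.not_dvd (by rw [h, C_0]; exact dvd_zero _)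

lemma ite_unit_ne_zero (b : Bool) : (if b then D.unit else 1) ≠ 0 := by
  cases b
  · exact one_ne_zero
  · exact D.unit_ne_zero

open Classical in
/-- Ranks and discriminants at a selfadjoint irreducible polynomial. -/
lemma exists_hasForm_self (hm : p.Monic) (hi : Irreducible p) (hs : star p = p) (l : ℕ) :
    ∃ d : F[X], ¬ p ∣ d ∧ ∀ c : Code F, c.Valid → HasForm True p (l + 1) (pencil (D.blk c).2)
      ((if c = .self p l false then 1 else 0) + if c = .self p l true then 1 else 0)
      ((if c = .self p l false then d else 1) * if c = .self p l true then d * D.rep p else 1) := by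
  have hφ := D.isUnit_det_phi p l hm hi hs
  refine ⟨companionDisc _ (natDegree_pow_succ_pos hi l) (D.phi (p ^ (l + 1))),
    not_dvd_companionDisc _ (hm.pow _) (by rw [star_pow, hs]) (D.phi_herm p l hm hi hs)
      (mul_eq_conjTranspose_mul_of_herm (D.phi_herm p l hm hi hs) (D.phi_mul_herm p l hm hi hs))
      hi (dvd_pow_self p l.succ_ne_zero) hφ, ?_⟩
  rintro (n | ⟨p', l'⟩ | ⟨p', l', b⟩ | ⟨n, b⟩) hc
  · simpa using (D.pairCong_blk_sing n).hasForm
      ((degen_pencil_singPair (p := p) l.succ_pos n).hasForm True)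
  · simpa using (D.pairCong_blk_skew p' l').hasForm
      ((degen_pencil_skew hi hs hm hc.1 hc.2.1 hc.2.2 l').hasForm True)
  · refine (D.pairCong_blk_self p' l' b).hasForm ?_
    by_cases h : p = p' ∧ l = l'
    · obtain ⟨rfl, rfl⟩ := h
      have := hasForm_pencil_polyPair hm hi hs hφ (D.phi_herm p l hm hi hs)
        (D.phi_mul_herm p l hm hi hs) (D.star_ite hm hi hs b) (D.not_dvd_ite hm hi hs b)
      cases b <;> simpa using this
    · have h1 : ∀ b', ¬ (Code.self p' l' b = .self p l b') := fun b' hb => h (by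
        simp only [Code.self.injEq] at hb
        exact ⟨hb.1.symm, hb.2.1.symm⟩)
      rw [if_neg (h1 _), if_neg (h1 _), if_neg (h1 _), if_neg (h1 _), mul_one]
      exact (degen_pencil_polyPair hm hi hc.1 hc.2.1 h (D.isUnit_det_phi p' l' hc.1 hc.2.1 hc.2.2)
        (D.not_dvd_ite hc.1 hc.2.1 hc.2.2 b)).hasForm True
  · simpa using (D.pairCong_blk_infty n b).hasForm
      ((degen_pencil_infty (l := l) hi (isUnit_det_antidiag _) (D.ite_unit_ne_zero b)).hasForm True)

open Classical in
/-- Ranks at an irreducible polynomial that is not selfadjoint. -/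
lemma hasForm_skew (hm : p.Monic) (hi : Irreducible p) (hs : star p ≠ p) (l : ℕ) (c : Code F)
    (hc : c.Valid) : HasForm False p (l + 1) (pencil (D.blk c).2)
      ((if c = .skew p l then 1 else 0) + if c = .skew (star p) l then 1 else 0) 1 := by
  rcases c with n | ⟨p', l'⟩ | ⟨p', l', b⟩ | ⟨n, b⟩
  · simpa using (D.pairCong_blk_sing n).hasForm
      ((degen_pencil_singPair (p := p) l.succ_pos n).hasForm False)
  · refine (D.pairCong_blk_skew p' l').hasForm ?_
    have := hasForm_pencil_skew (l := l) hm hi hc.1 hc.2.1 l'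
    simpa only [Code.skew.injEq, eq_comm] using this
  · have h : ¬ (p = p' ∧ l = l') := by
      rintro ⟨rfl, -⟩
      exact hs hc.2.2
    simpa using (D.pairCong_blk_self p' l' b).hasForm
      ((degen_pencil_polyPair hm hi hc.1 hc.2.1 h (D.isUnit_det_phi p' l' hc.1 hc.2.1 hc.2.2)
        (D.not_dvd_ite hc.1 hc.2.1 hc.2.2 b)).hasForm False)
  · simpa using (D.pairCong_blk_infty n b).hasForm
      ((degen_pencil_infty (l := l) hi (isUnit_det_antidiag _) (D.ite_unit_ne_zero b)).hasForm False)

open Classical in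
/-- Ranks and discriminants at infinity. -/
lemma exists_hasForm_infty (l : ℕ) :
    ∃ d : F[X], ¬ X ∣ d ∧ ∀ c : Code F, c.Valid → HasForm True X (l + 1) (pencil (D.blk c).2.swap)
      ((if c = .infty l false then 1 else 0) + if c = .infty l true then 1 else 0)
      ((if c = .infty l false then d else 1) * if c = .infty l true then d * C D.unit else 1) := by
  have hs : star (X : F[X]) = X := polyStar_X
  have ha := fun l : ℕ => antidiag_mul_companion_conjTranspose (F := F) l
  refine ⟨companionDisc _ (natDegree_pow_succ_pos irreducible_X l) (antidiag F _),
    not_dvd_companionDisc _ (monic_X.pow _) (by rw [star_pow, hs]) (antidiag_conjTranspose _)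
      (mul_eq_conjTranspose_mul_of_herm (antidiag_conjTranspose _) (ha l))
      irreducible_X (dvd_pow_self X l.succ_ne_zero) (isUnit_det_antidiag _), ?_⟩
  rintro (n | ⟨p', l'⟩ | ⟨p', l', b⟩ | ⟨n, b⟩) hc
  · simpa using (D.pairCong_blk_sing n).swap.hasForm
      ((degen_pencil_singPair_swap (p := X) l.succ_pos n).hasForm True)
  · refine (D.pairCong_blk_skew p' l').swap.hasForm ?_
    simpa using (Degen.pencil_swap (P := (fromBlocks 0 1 1 0,
      fromBlocks 0 (companion F (p' ^ (l' + 1)))ᴴ (companion F (p' ^ (l' + 1))) 0))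
        (IsUnit.of_mul_eq_one _ (by rw [← det_mul, fromBlocks_swap_mul_self, det_one]))
        l).hasForm True
  · refine (D.pairCong_blk_self p' l' b).swap.hasForm ?_
    simpa using (Degen.pencil_swap (P := polyPair _ _ _)
      (isUnit_det_mul_aeval (natDegree_pow_succ_pos hc.2.1 l') (hc.1.pow _)
        (isCoprime_of_not_dvd hc.2.1 (D.not_dvd_ite hc.1 hc.2.1 hc.2.2 b)).pow_left
        (D.isUnit_det_phi p' l' hc.1 hc.2.1 hc.2.2)) l).hasForm True
  · refine (D.pairCong_blk_infty n b).swap.hasForm ?_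
    rw [Prod.swap_swap]
    have hX : ∀ b : Bool, ¬ X ∣ C (if b then D.unit else 1) := fun b h =>
      D.ite_unit_ne_zero b (by simpa using X_dvd_iff.1 h)
    by_cases h : l = n
    · subst h
      have hb : star (C (if b then D.unit else 1)) = C (if b then D.unit else 1) := by
        cases b
        · exact star_one F[X]
        · exact D.isNormRep_unit.star_eq
      have := hasForm_pencil_polyPair monic_X irreducible_X hs (isUnit_det_antidiag _)
        (antidiag_conjTranspose _) (ha l) hb (hX b)
      cases b <;> simpa using this
    · have h1 : ∀ b', ¬ (Code.infty n b = (.infty l b' : Code F)) := fun b' hb => h (by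
        simp only [Code.infty.injEq] at hb
        exact hb.1.symm)
      rw [if_neg (h1 _), if_neg (h1 _), if_neg (h1 _), if_neg (h1 _), mul_one]
      exact (degen_pencil_polyPair monic_X irreducible_X monic_X irreducible_X (by simpa using h)
        (isUnit_det_antidiag _) (hX b)).hasForm True

end CanonData
end CodePencils

section NullSequences

variable {F : Type*} [Field F] [StarRing F]
variable {ι κ : Type} [Fintype ι] [DecidableEq ι] [Fintype κ] [DecidableEq κ]

/-- The coefficient sequences of the polynomial solutions of degree less than `k` of the
homogeneous system with the pencil of `P`. -/
def IsNullSeq (k : ℕ) (P : MatPair F ι) (z : ℕ → ι → F) : Prop :=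
  (∀ i, k ≤ i → z i = 0) ∧ P.2 *ᵥ z 0 = 0 ∧ ∀ i, P.1 *ᵥ z i = P.2 *ᵥ z (i + 1)

/-- The space of null sequences of length `k` has dimension `m`. -/
def HasNullity (k : ℕ) (P : MatPair F ι) (m : ℕ) : Prop :=
  ∃ (α : Type) (_ : Fintype α) (f : (α → F) →ₗ[F] (ℕ → ι → F)), Fintype.card α = m ∧
    Function.Injective f ∧ ∀ z, IsNullSeq k P z ↔ ∃ a, f a = z

lemma HasNullity.unique {k m m' : ℕ} {P : MatPair F ι} (h : HasNullity k P m)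
    (h' : HasNullity k P m') : m = m' := by
  obtain ⟨α, _, f, rfl, hf, hf'⟩ := h
  obtain ⟨β, _, g, rfl, hg, hg'⟩ := h'
  have e : LinearMap.range f = LinearMap.range g := by
    ext z
    rw [LinearMap.mem_range, LinearMap.mem_range, ← hf', ← hg']
  have h1 := LinearMap.finrank_range_of_inj hf
  have h2 := LinearMap.finrank_range_of_inj hg
  rw [Module.finrank_fintype_fun_eq_card] at h1 h2
  rw [← h1, ← h2, e]

lemma IsNullSeq.cong {k : ℕ} {P : MatPair F ι} {Q : MatPair F κ} {S : Matrix ι κ F}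
    {S' : Matrix κ ι F} (h1 : S * S' = 1) (h3 : Sᴴ * P.1 * S = Q.1) (h4 : Sᴴ * P.2 * S = Q.2)
    {z : ℕ → ι → F} (hz : IsNullSeq k P z) : IsNullSeq k Q fun i => S' *ᵥ z i := by
  have key : ∀ (A : Matrix ι ι F) (v : ι → F), (Sᴴ * A * S) *ᵥ (S' *ᵥ v) = Sᴴ *ᵥ (A *ᵥ v) := by
    intro A v
    rw [mulVec_mulVec, Matrix.mul_assoc _ S, h1, Matrix.mul_one, mulVec_mulVec]
  refine ⟨fun i hi => ?_, ?_, fun i => ?_⟩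
  · simp only [hz.1 i hi, mulVec_zero]
  · rw [← h4, key, hz.2.1, mulVec_zero]
  · rw [← h4, ← h3, key, key, hz.2.2]

lemma HasNullity.cong {k m : ℕ} {P : MatPair F ι} {Q : MatPair F κ} (hPQ : PairCong P Q)
    (h : HasNullity k P m) : HasNullity k Q m := by
  obtain ⟨S, S', h1, h2, h3, h4⟩ := hPQ
  have hQP : S'ᴴ * Q.1 * S' = P.1 ∧ S'ᴴ * Q.2 * S' = P.2 := by
    have h1' : S'ᴴ * Sᴴ = 1 := by rw [← conjTranspose_mul, h1, conjTranspose_one]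
    have key : ∀ A : Matrix ι ι F, S'ᴴ * (Sᴴ * A * S) * S' = A := fun A => by
      calc S'ᴴ * (Sᴴ * A * S) * S' = (S'ᴴ * Sᴴ) * A * (S * S') := by simp only [Matrix.mul_assoc]
        _ = A := by rw [h1, h1', Matrix.mul_one, Matrix.one_mul]
    exact ⟨by rw [← h3, key], by rw [← h4, key]⟩
  obtain ⟨α, _, f, rfl, hf, hf'⟩ := h
  have hSS : ∀ v, S *ᵥ (S' *ᵥ v) = v := fun v => by rw [mulVec_mulVec, h1, one_mulVec]
  have hSS' : ∀ v, S' *ᵥ (S *ᵥ v) = v := fun v => by rw [mulVec_mulVec, h2, one_mulVec]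
  refine ⟨α, inferInstance, LinearMap.pi fun i => (Matrix.mulVecLin S').comp
    ((LinearMap.proj i).comp f), rfl, fun a b hab => hf ?_, fun z => ⟨fun hz => ?_, ?_⟩⟩
  · funext i
    have : S' *ᵥ f a i = S' *ᵥ f b i := congrFun hab i
    rw [← hSS (f a i), this, hSS]
  · obtain ⟨a, ha⟩ := (hf' _).1 (hz.cong h2 hQP.1 hQP.2)
    refine ⟨a, funext fun i => ?_⟩
    change S' *ᵥ f a i = z i
    rw [ha, hSS']
  · rintro ⟨a, rfl⟩
    exact ((hf' _).2 ⟨a, rfl⟩).cong h1 h3 h4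

lemma isNullSeq_pairSum {k : ℕ} {P : MatPair F ι} {Q : MatPair F κ} {z : ℕ → ι ⊕ κ → F} :
    IsNullSeq k (pairSum P Q) z ↔
      IsNullSeq k P (fun i => z i ∘ Sum.inl) ∧ IsNullSeq k Q fun i => z i ∘ Sum.inr := by
  simp only [IsNullSeq, pairSum, fromBlocks_mulVec, zero_mulVec, add_zero, zero_add]
  have h0 : ∀ (u : ι → F) (v : κ → F), Sum.elim u v = 0 ↔ u = 0 ∧ v = 0 := fun u v => by
    rw [← Sum.elim_zero_zero, Sum.elim_eq_iff]
  have h1 : ∀ w : ι ⊕ κ → F, w = 0 ↔ w ∘ Sum.inl = 0 ∧ w ∘ Sum.inr = 0 := fun w => by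
    rw [← h0, Sum.elim_comp_inl_inr]
  simp only [h0, Sum.elim_eq_iff]
  constructor
  · rintro ⟨h2, h3, h4⟩
    exact ⟨⟨fun i hi => ((h1 _).1 (h2 i hi)).1, h3.1, fun i => (h4 i).1⟩,
      fun i hi => ((h1 _).1 (h2 i hi)).2, h3.2, fun i => (h4 i).2⟩
  · rintro ⟨⟨h2, h3, h4⟩, h2', h3', h4'⟩
    exact ⟨fun i hi => (h1 _).2 ⟨h2 i hi, h2' i hi⟩, ⟨h3, h3'⟩, fun i => ⟨h4 i, h4' i⟩⟩

lemma HasNullity.sum {k m m' : ℕ} {P : MatPair F ι} {Q : MatPair F κ} (h : HasNullity k P m)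
    (h' : HasNullity k Q m') : HasNullity k (pairSum P Q) (m + m') := by
  obtain ⟨α, _, f, rfl, hf, hf'⟩ := h
  obtain ⟨β, _, g, rfl, hg, hg'⟩ := h'
  let F' : (α ⊕ β → F) →ₗ[F] (ℕ → ι ⊕ κ → F) :=
    { toFun := fun a i => Sum.elim (f (a ∘ Sum.inl) i) (g (a ∘ Sum.inr) i)
      map_add' := fun a b => by
        funext i j
        have h1 : (a + b) ∘ Sum.inl = a ∘ Sum.inl + b ∘ Sum.inl := rfl
        have h2 : (a + b) ∘ Sum.inr = a ∘ Sum.inr + b ∘ Sum.inr := rfl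
        rw [h1, h2, map_add, map_add]
        cases j <;> rfl
      map_smul' := fun c a => by
        funext i j
        have h1 : (c • a) ∘ Sum.inl = c • (a ∘ Sum.inl) := rfl
        have h2 : (c • a) ∘ Sum.inr = c • (a ∘ Sum.inr) := rfl
        rw [h1, h2, map_smul, map_smul]
        cases j <;> rfl }
  refine ⟨α ⊕ β, inferInstance, F', Fintype.card_sum, fun a b hab => ?_, fun z => ?_⟩
  · have h1 : a ∘ Sum.inl = b ∘ Sum.inl := hf (funext fun i => funext fun j =>
      congrFun (congrFun hab i) (.inl j))
    have h2 : a ∘ Sum.inr = b ∘ Sum.inr := hg (funext fun i => funext fun j =>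
      congrFun (congrFun hab i) (.inr j))
    rw [← Sum.elim_comp_inl_inr a, h1, h2, Sum.elim_comp_inl_inr]
  · rw [isNullSeq_pairSum, hf', hg']
    constructor
    · rintro ⟨⟨a, ha⟩, b, hb⟩
      refine ⟨Sum.elim a b, funext fun i => ?_⟩
      change Sum.elim (f a i) (g b i) = z i
      rw [ha, hb, Sum.elim_comp_inl_inr]
    · rintro ⟨a, rfl⟩
      exact ⟨⟨a ∘ Sum.inl, rfl⟩, a ∘ Sum.inr, rfl⟩

lemma hasNullity_zero {k : ℕ} {P : MatPair F ι} (h : ∀ z, IsNullSeq k P z → z = 0) :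
    HasNullity k P 0 := by
  refine ⟨Empty, inferInstance, 0, rfl, Function.injective_of_subsingleton _, fun z => ⟨fun hz =>
    ⟨0, by rw [h z hz, LinearMap.zero_apply]⟩, ?_⟩⟩
  rintro ⟨a, rfl⟩
  exact ⟨fun _ _ => rfl, mulVec_zero _, fun _ => (mulVec_zero _).trans (mulVec_zero _).symm⟩

lemma hasNullity_zero_of_fst {k : ℕ} {P : MatPair F ι} (h : IsUnit P.1.det) :
    HasNullity k P 0 := by
  refine hasNullity_zero fun z hz => ?_
  have key : ∀ n i, k ≤ i + n → z i = 0 := by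
    intro n
    induction n with
    | zero => exact fun i hi => hz.1 i hi
    | succ n ih =>
      intro i hi
      have h1 := hz.2.2 i
      rw [ih (i + 1) (by omega), mulVec_zero] at h1
      exact Matrix.eq_zero_of_mulVec_eq_zero h.ne_zero h1
  exact funext fun i => key k i (by omega)

lemma hasNullity_zero_of_snd {k : ℕ} {P : MatPair F ι} (h : IsUnit P.2.det) :
    HasNullity k P 0 := by
  refine hasNullity_zero fun z hz => funext fun i => ?_
  induction i with
  | zero => exact Matrix.eq_zero_of_mulVec_eq_zero h.ne_zero hz.2.1
  | succ i ih =>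
    have h1 := hz.2.2 i
    rw [ih, Pi.zero_apply, mulVec_zero] at h1
    exact Matrix.eq_zero_of_mulVec_eq_zero h.ne_zero h1.symm

lemma initMat_mulVec (n : ℕ) (v : Fin (n + 1) → F) (i : Fin n) :
    (initMat F n *ᵥ v) i = v i.castSucc := by
  have h := congrFun (congrFun (initMat_mul n (Matrix.replicateCol Unit v)) i) ()
  exact h

lemma tailMat_mulVec (n : ℕ) (v : Fin (n + 1) → F) (i : Fin n) :
    (tailMat F n *ᵥ v) i = v i.succ := by
  have h := congrFun (congrFun (tailMat_mul n (Matrix.replicateCol Unit v)) i) ()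
  exact h

lemma tailMat_conjTranspose_mulVec_injective {n : ℕ} {v : Fin n → F}
    (h : (tailMat F n)ᴴ *ᵥ v = 0) : v = 0 := by
  have h1 : tailMat F n * (tailMat F n)ᴴ = 1 := by
    rw [tailMat_mul]
    ext i j
    simp [tailMat, one_apply, Fin.ext_iff, eq_comm, apply_ite]
  rw [← one_mulVec v, ← h1, ← mulVec_mulVec, h, mulVec_zero]

lemma isNullSeq_singPair {k n : ℕ} {z : ℕ → Fin (n + 1) ⊕ Fin n → F} :
    IsNullSeq k (singPair F n) z ↔ (∀ i j, z i (.inr j) = 0) ∧ (∀ i, k ≤ i → ∀ j, z i (.inl j) = 0) ∧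
      (∀ j : Fin n, z 0 (.inl j.succ) = 0) ∧
      ∀ i (j : Fin n), z i (.inl j.castSucc) = z (i + 1) (.inl j.succ) := by
  simp only [IsNullSeq, singPair, fromBlocks_mulVec, zero_mulVec, add_zero, zero_add]
  have h0 : ∀ (u : Fin (n + 1) → F) (v : Fin n → F), Sum.elim u v = 0 ↔ u = 0 ∧ v = 0 :=
    fun u v => by rw [← Sum.elim_zero_zero, Sum.elim_eq_iff]
  simp only [h0, Sum.elim_eq_iff]
  constructor
  · rintro ⟨h1, ⟨h2, h3⟩, h4⟩
    have hb : ∀ i, z i ∘ Sum.inr = 0 := by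
      intro i
      induction i with
      | zero => exact tailMat_conjTranspose_mulVec_injective h2
      | succ i ih =>
        refine tailMat_conjTranspose_mulVec_injective ?_
        rw [← (h4 i).1, ih, mulVec_zero]
    refine ⟨fun i j => congrFun (hb i) j, fun i hi j => congrFun (h1 i hi) _, fun j => ?_,
      fun i j => ?_⟩
    · have := congrFun h3 j
      rwa [tailMat_mulVec] at this
    · have := congrFun (h4 i).2 j
      rwa [initMat_mulVec, tailMat_mulVec] at this
  · rintro ⟨h1, h2, h3, h4⟩
    have hb : ∀ i, z i ∘ Sum.inr = 0 := fun i => funext fun j => h1 i j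
    refine ⟨fun i hi => ?_, ⟨by rw [hb, mulVec_zero], ?_⟩, fun i => ⟨?_, ?_⟩⟩
    · funext j
      cases j with
      | inl j => exact h2 i hi j
      | inr j => exact h1 i j
    · funext j
      rw [tailMat_mulVec]
      exact h3 j
    · rw [hb, hb, mulVec_zero, mulVec_zero]
    · funext j
      rw [tailMat_mulVec, initMat_mulVec]
      exact h4 i j

lemma hasNullity_singPair (k n : ℕ) : HasNullity k (singPair F n) (k - n) := by
  let f : (Fin (k - n) → F) →ₗ[F] (ℕ → Fin (n + 1) ⊕ Fin n → F) :=
    { toFun := fun a i => Sum.elim (fun j => if h : (j : ℕ) ≤ i ∧ i - j < k - n then a ⟨i - j, h.2⟩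
        else 0) 0
      map_add' := fun a b => by
        funext i j
        rcases j with j | j
        · simp only [Pi.add_apply, Sum.elim_inl]
          split_ifs <;> simp
        · simp
      map_smul' := fun c a => by
        funext i j
        rcases j with j | j
        · simp only [Pi.smul_apply, Sum.elim_inl, RingHom.id_apply]
          split_ifs <;> simp
        · simp }
  have hfa : ∀ a i (j : Fin (n + 1)), f a i (.inl j) =
    if h : (j : ℕ) ≤ i ∧ i - j < k - n then a ⟨i - j, h.2⟩ else 0 := fun _ _ _ => rfl
  refine ⟨Fin (k - n), inferInstance, f, Fintype.card_fin _, fun a b hab => funext fun i => ?_,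
    fun z => ⟨fun hz => ?_, ?_⟩⟩
  · have := congrFun (congrFun hab i) (.inl 0)
    rw [hfa, hfa] at this
    simpa using this
  · obtain ⟨h1, h2, h3, h4⟩ := isNullSeq_singPair.1 hz
    have key : ∀ (j i : ℕ) (hj : j < n + 1), z i (.inl ⟨j, hj⟩) =
        if j ≤ i then z (i - j) (.inl 0) else 0 := by
      intro j
      induction j with
      | zero => exact fun i hj => by simp
      | succ j ih =>
        intro i hj
        rcases i with _ | i
        · rw [if_neg (by omega)]
          exact h3 ⟨j, by omega⟩
        · have h5 := h4 i ⟨j, by omega⟩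
          have h6 := ih i (by omega)
          simp only [Nat.add_le_add_iff_right, Nat.add_sub_add_right]
          rw [← h6]
          exact h5.symm
    have hc : ∀ m, k - n ≤ m → z m (.inl 0) = 0 := by
      intro m hm
      have h5 := key n (m + n) (by omega)
      rw [if_pos (by omega), Nat.add_sub_cancel] at h5
      rw [← h5]
      exact h2 _ (by omega) _
    refine ⟨fun i => z i (.inl 0), funext fun i => funext fun j => ?_⟩
    rcases j with j | j
    · rw [hfa]
      have h5 := key j i j.2
      rw [Fin.eta] at h5
      rw [h5]
      by_cases h6 : (j : ℕ) ≤ i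
      · rw [if_pos h6]
        by_cases h7 : i - j < k - n
        · rw [dif_pos ⟨h6, h7⟩]
        · rw [dif_neg fun h => h7 h.2, hc _ (by omega)]
      · rw [if_neg h6, dif_neg fun h => h6 h.1]
    · exact (h1 i j).symm
  · rintro ⟨a, rfl⟩
    refine isNullSeq_singPair.2 ⟨fun _ _ => rfl, fun i hi j => ?_, fun j => ?_, fun i j => ?_⟩
    · have := j.2
      rw [hfa, dif_neg (by omega)]
    · rw [hfa, dif_neg (by simp)]
    · rw [hfa, hfa]
      simp only [Fin.val_castSucc, Fin.val_succ, Nat.add_le_add_iff_right, Nat.add_sub_add_right]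

/-- The nullity of level `k` of the block with the given code. -/
def Code.nullity (k : ℕ) : Code F → ℕ
  | .sing n => k - n
  | _ => 0

namespace CanonData

variable (D : CanonData F)

lemma hasNullity_blk (k : ℕ) {c : Code F} (hc : c.Valid) : HasNullity k (D.blk c).2 (c.nullity k) := by
  rcases c with n | ⟨p', l'⟩ | ⟨p', l', b⟩ | ⟨n, b⟩
  · exact (hasNullity_singPair k n).cong (D.pairCong_blk_sing n)
  · refine HasNullity.cong (D.pairCong_blk_skew p' l') (hasNullity_zero_of_fst ?_)
    exact IsUnit.of_mul_eq_one _ (by rw [← det_mul, fromBlocks_swap_mul_self, det_one])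
  · refine HasNullity.cong (D.pairCong_blk_self p' l' b) (hasNullity_zero_of_fst ?_)
    exact isUnit_det_mul_aeval (natDegree_pow_succ_pos hc.2.1 l') (hc.1.pow _)
      (isCoprime_of_not_dvd hc.2.1 (D.not_dvd_ite hc.1 hc.2.1 hc.2.2 b)).pow_left
      (D.isUnit_det_phi p' l' hc.1 hc.2.1 hc.2.2)
  · refine HasNullity.cong (D.pairCong_blk_infty n b) (hasNullity_zero_of_snd ?_)
    refine isUnit_det_mul_aeval (natDegree_pow_succ_pos irreducible_X n) (monic_X.pow _)
      (isCoprime_of_not_dvd irreducible_X fun h => ?_).pow_left (isUnit_det_antidiag _)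
    exact D.ite_unit_ne_zero b (by simpa using X_dvd_iff.1 h)

lemma hasNullity_psum (k : ℕ) {L : List (Code F)} (hL : ∀ c ∈ L, c.Valid) :
    HasNullity k (psum (L.map D.blk)).2 (L.map (Code.nullity k)).sum := by
  induction L with
  | nil =>
    exact hasNullity_zero fun z _ => funext fun i => funext fun j => j.elim0
  | cons c L ih =>
    have h1 := ih fun c' hc' => hL c' (List.mem_cons_of_mem _ hc')
    have h2 := (D.hasNullity_blk k (hL c List.mem_cons_self)).sum h1
    exact h2.cong (psum_cons_cong _ _).symm

end CanonData

open Classical in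
lemma Code.count_sing (k : ℕ) (L : List (Code F)) :
    (L.map (Code.nullity (k + 1))).sum + (L.map (Code.nullity (k - 1))).sum =
      2 * (L.map (Code.nullity k)).sum + L.count (.sing k) := by
  induction L with
  | nil => rfl
  | cons c L ih =>
    rw [List.count_cons]
    simp only [List.map_cons, List.sum_cons]
    rcases c with n | ⟨p', l'⟩ | ⟨p', l', b⟩ | ⟨n, b⟩
    · by_cases h : n = k
      · subst h
        simp only [BEq.rfl, if_true, Code.nullity]
        omega
      · rw [if_neg (by simpa using h)]
        simp only [Code.nullity]
        omega
    all_goals simp [Code.nullity]; omega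

namespace CanonData

variable (D : CanonData F)

open Classical in
/-- The number of singular summands of each size is an invariant. -/
lemma count_sing_eq {L L' : List (Code F)} (hL : ∀ c ∈ L, c.Valid) (hL' : ∀ c ∈ L', c.Valid)
    (h : PairCong (psum (L.map D.blk)).2 (psum (L'.map D.blk)).2) (n : ℕ) :
    L.count (.sing n) = L'.count (.sing n) := by
  have key := fun k => ((D.hasNullity_psum k hL).cong h).unique (D.hasNullity_psum k hL')
  have h1 := Code.count_sing n L
  have h2 := Code.count_sing n L'
  rw [key, key, key] at h1
  omega

end CanonData
end NullSequences

section CodesUnique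

variable {F : Type*} [Field F] [StarRing F]

lemma hasForm_psum_swap {h : Prop} {p : F[X]} {l : ℕ} {α : Type*} (f : α → PBlock F) (r : α → ℕ)
    (δ : α → F[X]) (L : List α)
    (hL : ∀ c ∈ L, HasForm h p l (pencil (f c).2.swap) (r c) (δ c)) :
    HasForm h p l (pencil (psum (L.map f)).2.swap) (L.map r).sum (L.map δ).prod := by
  induction L with
  | nil =>
    refine Degen.hasForm (fun y z _ _ => ?_) h
    have : y ⬝ᵥ pencil (psum (List.map f [])).2.swap *ᵥ z = 0 := Fin.sum_univ_zero _
    rw [this]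
    exact dvd_zero _
  | cons c L ih =>
    have h1 := ih fun c' hc' => hL c' (List.mem_cons_of_mem _ hc')
    have h2 := (hL c List.mem_cons_self).sum h1
    rw [← pencil_pairSum] at h2
    exact (psum_cons_cong (f c) (L.map f)).symm.swap.hasForm h2

section Lists

variable {α : Type*} [DecidableEq α]

lemma sum_map_ite_add_ite (L : List α) (a b : α) :
    (L.map fun c => (if c = a then 1 else 0) + if c = b then 1 else 0).sum =
      L.count a + L.count b := by
  induction L with
  | nil => rfl
  | cons c L ih =>
    rw [List.map_cons, List.sum_cons, ih, List.count_cons, List.count_cons]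
    simp only [beq_iff_eq]
    omega

lemma prod_map_ite_mul_ite {M : Type*} [CommMonoid M] (L : List α) (a b : α) (x y : M) :
    (L.map fun c => (if c = a then x else 1) * if c = b then y else 1).prod =
      x ^ L.count a * y ^ L.count b := by
  induction L with
  | nil => simp
  | cons c L ih =>
    rw [List.map_cons, List.prod_cons, ih, List.count_cons, List.count_cons]
    simp only [beq_iff_eq]
    split_ifs <;> simp only [pow_succ, add_zero, one_mul, mul_one] <;> ac_rfl

lemma exists_perm_forall₂_of_map_perm {β : Type*} (f : α → β) {L' L : List α}
    (h : (L.map f).Perm (L'.map f)) :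
    ∃ L₂, L.Perm L₂ ∧ List.Forall₂ (fun a b => f a = f b) L₂ L' := by
  induction L' generalizing L with
  | nil =>
    rw [List.map_nil, List.perm_nil, List.map_eq_nil_iff] at h
    exact ⟨[], by rw [h], .nil⟩
  | cons c L' ih =>
    obtain ⟨a, ha, hac⟩ := List.mem_map.1 (h.symm.subset (List.mem_cons_self (a := f c)))
    have h1 := List.perm_cons_erase ha
    have h2 := ((h1.map f).symm.trans h)
    rw [List.map_cons, List.map_cons, hac, List.perm_cons] at h2
    obtain ⟨L₂, h3, h4⟩ := ih h2
    exact ⟨a :: L₂, h1.trans (h3.cons a), .cons hac h4⟩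

end Lists

lemma PolyNormRep.eq_of_disc {p f d : F[X]} (hp : Irreducible p) (hf : PolyNormRep p f)
    (hd : ¬ p ∣ d) {a b a' b' : ℕ} (hb : b ≤ 1) (hb' : b' ≤ 1) (hr : a + b = a' + b')
    (h : ∃ g, p ∣ d ^ a' * (d * f) ^ b' - d ^ a * (d * f) ^ b * (g * star g))
    (h' : ∃ g, p ∣ d ^ a * (d * f) ^ b - d ^ a' * (d * f) ^ b' * (g * star g)) : b = b' := by
  have key : ∀ {a a' : ℕ}, a = a' + 1 →
      ¬ ∃ g, p ∣ d ^ a' * (d * f) ^ 1 - d ^ a * (d * f) ^ 0 * (g * star g) := by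
    rintro _ a rfl ⟨g, hg⟩
    have e : d ^ a * (d * f) ^ 1 - d ^ (a + 1) * (d * f) ^ 0 * (g * star g) =
        -(d ^ (a + 1) * (g * star g - f)) := by ring
    rw [e, dvd_neg] at hg
    rcases hp.prime.dvd_or_dvd hg with h1 | h1
    · exact hd (hp.prime.dvd_of_dvd_pow h1)
    · exact hf.not_norm ⟨g, h1⟩
  rcases (by omega : b = b' ∨ (b = 0 ∧ b' = 1) ∨ (b = 1 ∧ b' = 0)) with h1 | ⟨rfl, rfl⟩ | ⟨rfl, rfl⟩
  · exact h1
  · exact absurd h (key (by omega))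
  · exact absurd h' (key (by omega))

open Classical in
lemma HasForm.count_eq {ι : Type} [Fintype ι] {p f d : F[X]} {l : ℕ} {M : Matrix ι ι F[X]}
    (hp : Irreducible p) (hs : star p = p) (hf : PolyNormRep p f) (hd : ¬ p ∣ d) (hM : Mᴴ = M)
    {L L' : List (Code F)} {c c' : Code F} (hL : L.count c' ≤ 1) (hL' : L'.count c' ≤ 1)
    (h : HasForm True p l M (L.map fun x => (if x = c then 1 else 0) + if x = c' then 1 else 0).sum
      (L.map fun x => (if x = c then d else 1) * if x = c' then d * f else 1).prod)
    (h' : HasForm True p l M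
      (L'.map fun x => (if x = c then 1 else 0) + if x = c' then 1 else 0).sum
      (L'.map fun x => (if x = c then d else 1) * if x = c' then d * f else 1).prod) :
    L.count c = L'.count c ∧ L.count c' = L'.count c' := by
  rw [sum_map_ite_add_ite, prod_map_ite_mul_ite] at h h'
  obtain ⟨hr, h1⟩ := h.disc_unique hp hs hM h'
  have h2 := hf.eq_of_disc hp hd hL hL' hr h1 (h'.disc_unique hp hs hM h).2
  omega

/-- A representative of the unordered pair `{p, star p}`. -/
def pairRep (p : F[X]) : F[X] := (Quot.out s(p, star p)).1

lemma pairRep_eq (p : F[X]) : pairRep p = p ∨ pairRep p = star p := by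
  have h : s((Quot.out s(p, star p)).1, (Quot.out s(p, star p)).2) = s(p, star p) :=
    Quot.out_eq _
  rcases Sym2.eq_iff.1 h with h | h
  · exact .inl h.1
  · exact .inr h.1

lemma pairRep_star (p : F[X]) : pairRep (star p) = pairRep p := by
  rw [pairRep, pairRep, star_star, Sym2.eq_swap]

lemma pairRep_eq_iff {p q : F[X]} : pairRep q = pairRep p ↔ q = p ∨ q = star p := by
  refine ⟨fun h => ?_, ?_⟩
  · rcases pairRep_eq p with hp | hp <;> rcases pairRep_eq q with hq | hq <;> rw [hp, hq] at h
    · exact .inl h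
    · exact .inr (by rw [← h, star_star])
    · exact .inr h
    · exact .inl (star_injective h)
  · rintro (rfl | rfl)
    · rfl
    · exact pairRep_star p

/-- The label with the polynomial of a skew label replaced by the chosen representative. -/
def Code.normalize : Code F → Code F
  | .skew p l => .skew (pairRep p) l
  | c => c

/-- Labels which agree up to conjugation of the polynomial of a skew label. -/
def Code.Equiv (c c' : Code F) : Prop :=
  c = c' ∨ ∃ p l, c = .skew p l ∧ c' = .skew (star p) l

lemma Code.normalize_eq_iff {c c' : Code F} : c.normalize = c'.normalize ↔ c.Equiv c' := by
  refine ⟨fun h => ?_, ?_⟩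
  · cases c <;> cases c' <;> simp only [Code.normalize, reduceCtorEq, Code.skew.injEq] at h <;>
      try exact .inl h
    obtain ⟨h1, rfl⟩ := h
    rcases pairRep_eq_iff.1 h1 with rfl | rfl
    · exact .inl rfl
    · exact .inr ⟨_, _, rfl, by rw [star_star]⟩
  · rintro (rfl | ⟨p, l, rfl, rfl⟩)
    · rfl
    · simp only [Code.normalize, pairRep_star]

open Classical in
lemma Code.count_normalize_skew (L : List (Code F)) {p : F[X]} (hs : star p ≠ p) (l : ℕ) :
    (L.map Code.normalize).count (Code.normalize (.skew p l)) =
      L.count (.skew p l) + L.count (.skew (star p) l) := by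
  induction L with
  | nil => rfl
  | cons c L ih =>
    have h1 : Code.normalize c = Code.normalize (.skew p l) ↔
        c = .skew p l ∨ c = .skew (star p) l := by
      rw [Code.normalize_eq_iff]
      refine or_congr_right ⟨?_, ?_⟩
      · rintro ⟨q, m, rfl, h⟩
        rw [Code.skew.injEq] at h
        rw [h.1, h.2, star_star]
      · rintro rfl
        exact ⟨_, _, rfl, by rw [star_star]⟩
    have h2 : ¬ (c = .skew p l ∧ c = .skew (star p) l) := by
      rintro ⟨rfl, h⟩
      rw [Code.skew.injEq] at h
      exact hs h.1.symm
    rw [List.map_cons, List.count_cons, List.count_cons, List.count_cons, ih]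
    simp only [beq_iff_eq, h1]
    split_ifs <;> first | omega | tauto

open Classical in
lemma Code.count_normalize_of_ne (L : List (Code F)) {c : Code F} (hc : ∀ p l, c ≠ .skew p l) :
    (L.map Code.normalize).count c = L.count c := by
  induction L with
  | nil => rfl
  | cons c' L ih =>
    have h1 : Code.normalize c' = c ↔ c' = c := by
      cases c'
      case skew => exact ⟨fun h => (hc _ _ h.symm).elim, fun h => (hc _ _ h.symm).elim⟩
      all_goals rfl
    rw [List.map_cons, List.count_cons, List.count_cons, ih]
    simp only [beq_iff_eq, h1]

namespace CanonData

variable (D : CanonData F)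

open Classical in
/-- The canonical form of a pair of Hermitian matrices is unique. -/
theorem codes_unique {L L' : List (Code F)} (hL : ∀ c ∈ L, c.Valid) (hL' : ∀ c ∈ L', c.Valid)
    (hr : ∀ c : Code F, c.IsScaled → L.count c ≤ 1)
    (hr' : ∀ c : Code F, c.IsScaled → L'.count c ≤ 1)
    (h : PairCong (psum (L.map D.blk)).2 (psum (L'.map D.blk)).2)
    (hH : IsHermPair (psum (L'.map D.blk)).2) :
    ∃ L₂, L.Perm L₂ ∧ List.Forall₂ Code.Equiv L₂ L' := by
  have hM := pencil_conjTranspose hH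
  have hM' := pencil_conjTranspose (P := (psum (L'.map D.blk)).2.swap) ⟨hH.2, hH.1⟩
  have hself : ∀ p l, p.Monic → Irreducible p → star p = p →
      L.count (.self p l false) = L'.count (.self p l false) ∧
      L.count (.self p l true) = L'.count (.self p l true) := by
    intro p l hm hi hs
    obtain ⟨d, hd, hform⟩ := D.exists_hasForm_self hm hi hs l
    exact HasForm.count_eq hi hs (D.isNormRep_rep p hm hi hs) hd hM (hr _ rfl) (hr' _ rfl)
      (h.hasForm (hasForm_psum D.blk _ _ L fun c hc => hform c (hL c hc)))
      (hasForm_psum D.blk _ _ L' fun c hc => hform c (hL' c hc))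
  have hinfty : ∀ l, L.count (.infty l false) = L'.count (.infty l false) ∧
      L.count (.infty l true) = L'.count (.infty l true) := by
    intro l
    obtain ⟨d, hd, hform⟩ := D.exists_hasForm_infty l
    exact HasForm.count_eq irreducible_X polyStar_X D.isNormRep_unit hd hM' (hr _ rfl) (hr' _ rfl)
      (h.swap.hasForm (hasForm_psum_swap D.blk _ _ L fun c hc => hform c (hL c hc)))
      (hasForm_psum_swap D.blk _ _ L' fun c hc => hform c (hL' c hc))
  have hskew : ∀ p l, p.Monic → Irreducible p → star p ≠ p →
      L.count (.skew p l) + L.count (.skew (star p) l) =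
        L'.count (.skew p l) + L'.count (.skew (star p) l) := by
    intro p l hm hi hs
    have h1 := h.hasForm (hasForm_psum D.blk _ _ L fun c hc => D.hasForm_skew hm hi hs l c (hL c hc))
    have h2 := hasForm_psum D.blk _ _ L' fun c hc => D.hasForm_skew hm hi hs l c (hL' c hc)
    have h3 := h1.rank_unique hi h2
    rwa [sum_map_ite_add_ite, sum_map_ite_add_ite] at h3
  have key : ∀ c : Code F, c.Valid →
      (L.map Code.normalize).count c.normalize = (L'.map Code.normalize).count c.normalize := by
    rintro (n | ⟨p, l⟩ | ⟨p, l, b⟩ | ⟨n, b⟩) hc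
    · change (L.map Code.normalize).count (.sing n) = (L'.map Code.normalize).count (.sing n)
      rw [Code.count_normalize_of_ne _ (by simp), Code.count_normalize_of_ne _ (by simp)]
      exact D.count_sing_eq hL hL' h n
    · rw [Code.count_normalize_skew _ hc.2.2, Code.count_normalize_skew _ hc.2.2]
      exact hskew p l hc.1 hc.2.1 hc.2.2
    · change (L.map Code.normalize).count (.self p l b) = (L'.map Code.normalize).count (.self p l b)
      rw [Code.count_normalize_of_ne _ (by simp), Code.count_normalize_of_ne _ (by simp)]
      cases b
      · exact (hself p l hc.1 hc.2.1 hc.2.2).1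
      · exact (hself p l hc.1 hc.2.1 hc.2.2).2
    · change (L.map Code.normalize).count (.infty n b) = (L'.map Code.normalize).count (.infty n b)
      rw [Code.count_normalize_of_ne _ (by simp), Code.count_normalize_of_ne _ (by simp)]
      cases b
      · exact (hinfty n).1
      · exact (hinfty n).2
  have hperm : (L.map Code.normalize).Perm (L'.map Code.normalize) := by
    refine List.perm_iff_count.2 fun x => ?_
    by_cases hx : x ∈ L.map Code.normalize ∨ x ∈ L'.map Code.normalize
    · simp only [List.mem_map] at hx
      rcases hx with ⟨c, hc, rfl⟩ | ⟨c, hc, rfl⟩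
      · exact key c (hL c hc)
      · exact key c (hL' c hc)
    · rw [not_or] at hx
      rw [List.count_eq_zero_of_not_mem hx.1, List.count_eq_zero_of_not_mem hx.2]
  obtain ⟨L₂, h1, h2⟩ := exists_perm_forall₂_of_map_perm _ hperm
  exact ⟨L₂, h1, h2.imp fun _ _ => Code.normalize_eq_iff.1⟩

end CanonData

end CodesUnique

section Matching

variable {F : Type*} [Field F] [StarRing F]

lemma isHermPair_polyPair {ι : Type} [Fintype ι] [DecidableEq ι] {N T : Matrix ι ι F} (hN : Nᴴ = N)
    (hNT : (N * T)ᴴ = N * T) {g : F[X]} (hg : star g = g) : IsHermPair (polyPair N T g) := by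
  have h := mul_eq_conjTranspose_mul_of_herm hN hNT
  have key : ∀ s : F[X], star s = s → (N * aeval T s)ᴴ = N * aeval T s := fun s hs => by
    rw [conjTranspose_mul, hN, mul_aeval_eq_conjTranspose_mul h, hs]
  refine ⟨key g hg, ?_⟩
  rw [polyPair_snd]
  exact key _ (by rw [star_mul', polyStar_X, hg])

lemma IsHermPair.sum {ι κ : Type} [Fintype ι] [DecidableEq ι] [Fintype κ] [DecidableEq κ]
    {P : MatPair F ι} {Q : MatPair F κ} (hP : IsHermPair P) (hQ : IsHermPair Q) :
    IsHermPair (pairSum P Q) := by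
  constructor
  · simp only [pairSum, fromBlocks_conjTranspose, hP.1, hQ.1, conjTranspose_zero]
  · simp only [pairSum, fromBlocks_conjTranspose, hP.2, hQ.2, conjTranspose_zero]

lemma atMostOne_iff {α : Type*} {P : α → Prop} {L : List α} :
    AtMostOne P L ↔ ∀ b₁ b₂, [b₁, b₂].Sublist L → P b₁ → ¬ P b₂ :=
  ⟨fun h b₁ b₂ h1 h2 h3 => h ⟨b₁, b₂, h1, h2, h3⟩, fun h ⟨b₁, b₂, h1, h2, h3⟩ => h b₁ b₂ h1 h2 h3⟩

namespace CanonData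

variable (D : CanonData F)

lemma isHermPair_blk {c : Code F} (hc : c.Valid) (hs : c.IsScaled) : IsHermPair (D.blk c).2 := by
  rcases c with n | ⟨p, l⟩ | ⟨p, l, b⟩ | ⟨n, b⟩
  · exact hs.elim
  · exact hs.elim
  · exact (isHermPair_polyPair (D.phi_herm p l hc.1 hc.2.1 hc.2.2)
      (D.phi_mul_herm p l hc.1 hc.2.1 hc.2.2) (D.star_ite hc.1 hc.2.1 hc.2.2 b)).cong
      (D.pairCong_blk_self p l b)
  · obtain rfl : b = true := hs
    have h := isHermPair_polyPair (antidiag_conjTranspose _)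
      (antidiag_mul_companion_conjTranspose n) D.isNormRep_unit.star_eq
    exact IsHermPair.cong ⟨h.2, h.1⟩ (D.pairCong_blk_infty n true)

lemma blk_injective_of_isScaled {c c' : Code F} (hc : c.Valid) (hc' : c'.Valid)
    (hs : c'.IsScaled) (h : D.blk c = D.blk c') : c = c' := by
  classical
  have h1 : List.map D.blk [c] = List.map D.blk [c'] := by
    rw [List.map_singleton, List.map_singleton, h]
  have h2 : IsHermPair (psum (List.map D.blk [c'])).2 :=
    IsHermPair.cong ((D.isHermPair_blk hc' hs).sum
      ⟨funext fun i => i.elim0, funext fun i => i.elim0⟩) (psum_cons_cong (D.blk c') []).symm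
  have h3 : ∀ c : Code F, c.Valid → ∀ x ∈ [c], x.Valid := fun c hc x hx => by
    rwa [List.mem_singleton.1 hx]
  have h4 : ∀ c x : Code F, List.count x [c] ≤ 1 := fun c x => List.count_le_length
  obtain ⟨L₂, h5, h6⟩ := D.codes_unique (h3 c hc) (h3 c' hc') (fun x _ => h4 c x)
    (fun x _ => h4 c' x) (h1 ▸ PairCong.refl _) h2
  rw [List.perm_singleton.1 h5.symm, List.forall₂_cons] at h6
  rcases h6.1 with h6 | ⟨p, l, -, rfl⟩
  · exact h6
  · exact hs.elim

/-- The summands attached to the data `D` are the canonical ones. -/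
structure IsCanonical (uF πF : F) (Phi1 : (q : F[X]) → Mat F q.natDegree)
    (πK uK : (pp : F[X]) → AdjoinRoot pp) : Prop where
  phi_eq : D.phi = Phi1
  unit : RepCond uF πF D.unit
  eq_unit : ∀ t, RepCond uF πF t → t = D.unit
  degree_rep : ∀ p, p.Monic → Irreducible p → star p = p → (D.rep p).degree < p.degree
  rep : ∀ p, p.Monic → Irreducible p → star p = p →
    RepCond (uK p) (πK p) (AdjoinRoot.mk p (D.rep p))
  eq_rep : ∀ p, p.Monic → Irreducible p → star p = p →
    ∀ t, RepCond (uK p) (πK p) t → t = AdjoinRoot.mk p (D.rep p)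

variable {D} {uF πF : F} {Phi1 : (q : F[X]) → Mat F q.natDegree}
  {πK uK : (pp : F[X]) → AdjoinRoot pp}

lemma IsCanonical.t9iiib_iff (hD : D.IsCanonical uF πF Phi1 πK uK) {pp : F[X]} {l : ℕ}
    {b : PBlock F} : T9iiib (starRingEnd F) Phi1 πK uK pp l b ↔
      ∃ l', l = l' + 1 ∧ (Code.self pp l' true).Valid ∧ b = D.blk (.self pp l' true) := by
  rw [← hD.phi_eq]
  constructor
  · rintro ⟨hm, hi, hl, hs, t, ht, f, hf, hfs, rfl, rfl⟩
    rw [← polyStar_eq_self_iff] at hs hfs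
    obtain ⟨l', rfl⟩ := Nat.exists_eq_add_of_lt hl
    rw [zero_add]
    have h1 := hD.eq_rep pp hm hi hs _ ht
    rw [AdjoinRoot.mk_eq_mk] at h1
    have h2 : f = D.rep pp := by
      rw [← sub_eq_zero]
      exact eq_zero_of_dvd_of_degree_lt h1 ((degree_sub_le _ _).trans_lt
        (max_lt hf (hD.degree_rep pp hm hi hs)))
    exact ⟨l', rfl, ⟨hm, hi, hs⟩, by rw [h2]; rfl⟩
  · rintro ⟨l', rfl, ⟨hm, hi, hs⟩, rfl⟩
    exact ⟨hm, hi, l'.succ_pos, (polyStar_eq_self_iff _).1 hs, _, hD.rep pp hm hi hs, _,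
      hD.degree_rep pp hm hi hs, (polyStar_eq_self_iff _).1 (D.isNormRep_rep pp hm hi hs).star_eq,
      rfl, rfl⟩

lemma IsCanonical.t9ivb_iff (hD : D.IsCanonical uF πF Phi1 πK uK) {n : ℕ} {b : PBlock F} :
    T9ivb uF πF n b ↔ ∃ n', n = n' + 1 ∧ b = D.blk (.infty n' true) := by
  constructor
  · rintro ⟨hn, t, ht, rfl⟩
    obtain ⟨n', rfl⟩ := Nat.exists_eq_add_of_lt hn
    rw [zero_add, hD.eq_unit t ht]
    exact ⟨n', rfl, rfl⟩
  · rintro ⟨n', rfl, rfl⟩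
    exact ⟨n'.succ_pos, _, hD.unit, rfl⟩

lemma IsCanonical.exists_code_iff (hD : D.IsCanonical uF πF Phi1 πK uK) {b : PBlock F} :
    (T9i (starRingEnd F) b ∨ T9ii (starRingEnd F) b ∨ T9iiia (starRingEnd F) Phi1 b ∨
      (∃ pp l, T9iiib (starRingEnd F) Phi1 πK uK pp l b) ∨ T9iva b ∨ ∃ n, T9ivb uF πF n b) ↔
      ∃ c : Code F, c.Valid ∧ D.blk c = b := by
  simp only [hD.t9iiib_iff, hD.t9ivb_iff]
  constructor
  · rintro (⟨n, hn, rfl⟩ | ⟨p, l, hm, hi, hl, hs, rfl⟩ | ⟨p, l, hm, hi, hl, hs, rfl⟩ |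
      ⟨p, _, l, -, hc, rfl⟩ | ⟨n, hn, rfl⟩ | ⟨_, n, -, rfl⟩)
    · obtain ⟨n, rfl⟩ := Nat.exists_eq_add_of_lt hn
      rw [zero_add]
      exact ⟨.sing n, trivial, rfl⟩
    · obtain ⟨l, rfl⟩ := Nat.exists_eq_add_of_lt hl
      rw [zero_add]
      rw [← polyStar_eq_self_iff] at hs
      exact ⟨.skew p l, ⟨hm, hi, hs⟩, rfl⟩
    · obtain ⟨l, rfl⟩ := Nat.exists_eq_add_of_lt hl
      rw [zero_add, ← hD.phi_eq]
      rw [← polyStar_eq_self_iff] at hs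
      exact ⟨.self p l false, ⟨hm, hi, hs⟩, rfl⟩
    · exact ⟨.self p l true, hc, rfl⟩
    · obtain ⟨n, rfl⟩ := Nat.exists_eq_add_of_lt hn
      rw [zero_add]
      exact ⟨.infty n false, trivial, rfl⟩
    · exact ⟨.infty n true, trivial, rfl⟩
  · rintro ⟨n | ⟨p, l⟩ | ⟨p, l, _ | _⟩ | ⟨n, _ | _⟩, hc, rfl⟩
    · exact .inl ⟨n + 1, n.succ_pos, rfl⟩
    · exact .inr (.inl ⟨p, l + 1, hc.1, hc.2.1, l.succ_pos,
        mt (polyStar_eq_self_iff p).2 hc.2.2, rfl⟩)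
    · rw [← hD.phi_eq]
      exact .inr (.inr (.inl ⟨p, l + 1, hc.1, hc.2.1, l.succ_pos,
        (polyStar_eq_self_iff p).1 hc.2.2, rfl⟩))
    · exact .inr (.inr (.inr (.inl ⟨p, l + 1, l, rfl, hc, rfl⟩)))
    · exact .inr (.inr (.inr (.inr (.inl ⟨n + 1, n.succ_pos, rfl⟩))))
    · exact .inr (.inr (.inr (.inr (.inr ⟨n + 1, n, rfl, rfl⟩))))

lemma atMostOne_blk {C : List (Code F)} (hC : ∀ c ∈ C, c.Valid) {c : Code F} (hc : c.Valid)
    (hs : c.IsScaled) [DecidableEq (Code F)] :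
    AtMostOne (fun b => b = D.blk c) (C.map D.blk) ↔ C.count c ≤ 1 := by
  rw [atMostOne_iff]
  constructor
  · intro h
    by_contra! h1
    have h2 : [c, c].Sublist C := List.replicate_sublist_iff.2 h1
    exact h _ _ (h2.map D.blk) rfl rfl
  · rintro h _ _ h1 rfl rfl
    obtain ⟨C', h2, h3⟩ := List.sublist_map_iff.1 h1
    have h4 : ∀ x ∈ C', x = c := fun x hx => by
      refine D.blk_injective_of_isScaled (hC x (h2.subset hx)) hc hs ?_
      have h5 := List.mem_map_of_mem (f := D.blk) hx
      rw [← h3] at h5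
      simpa using h5
    have h5 : C' = List.replicate 2 c := List.eq_replicate_iff.2
      ⟨by simpa using (congrArg List.length h3).symm, h4⟩
    rw [h5, List.replicate_sublist_iff] at h2
    omega

open Classical in
lemma IsCanonical.canon9_iff (hD : D.IsCanonical uF πF Phi1 πK uK) {L : List (PBlock F)} :
    Canon9 (starRingEnd F) uF πF Phi1 πK uK L ↔ ∃ C : List (Code F), (∀ c ∈ C, c.Valid) ∧
      (∀ c : Code F, c.IsScaled → C.count c ≤ 1) ∧ C.map D.blk = L := by
  have h0 : ∀ (P Q : PBlock F → Prop) (L : List (PBlock F)), (∀ b, P b → Q b) → AtMostOne Q L →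
      AtMostOne P L := fun P Q L h h1 ⟨b₁, b₂, h2, h3, h4⟩ => h1 ⟨b₁, b₂, h2, h _ h3, h _ h4⟩
  constructor
  · rintro ⟨h1, h2, h3⟩
    have h4 : ∃ C : List (Code F), (∀ c ∈ C, c.Valid) ∧ C.map D.blk = L := by
      clear h2 h3
      induction L with
      | nil => exact ⟨[], by simp, rfl⟩
      | cons b L ih =>
        obtain ⟨C, hC, rfl⟩ := ih fun b hb => h1 b (List.mem_cons_of_mem _ hb)
        obtain ⟨c, hc, rfl⟩ := hD.exists_code_iff.1 (h1 _ List.mem_cons_self)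
        exact ⟨c :: C, List.forall_mem_cons.2 ⟨hc, hC⟩, rfl⟩
    obtain ⟨C, hC, rfl⟩ := h4
    refine ⟨C, hC, fun c hs => ?_, rfl⟩
    by_cases hcC : c ∈ C
    · have hc := hC c hcC
      rw [← atMostOne_blk (D := D) hC hc hs]
      rcases c with n | ⟨p, l⟩ | ⟨p, l, b⟩ | ⟨n, b⟩
      · exact hs.elim
      · exact hs.elim
      · obtain rfl : b = true := hs
        exact h0 _ _ _ (fun b hb => hD.t9iiib_iff.2 ⟨l, rfl, hc, hb⟩) (h2 p (l + 1))
      · obtain rfl : b = true := hs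
        exact h0 _ _ _ (fun b hb => hD.t9ivb_iff.2 ⟨n, rfl, hb⟩) (h3 (n + 1))
    · rw [List.count_eq_zero_of_not_mem hcC]
      exact Nat.zero_le _
  · rintro ⟨C, hC, hr, rfl⟩
    refine ⟨fun b hb => ?_, fun p l => ?_, fun n => ?_⟩
    · obtain ⟨c, hc, rfl⟩ := List.mem_map.1 hb
      exact hD.exists_code_iff.2 ⟨c, hC c hc, rfl⟩
    · rintro ⟨b₁, b₂, h1, h2, h3⟩
      obtain ⟨l', rfl, hc, h2⟩ := hD.t9iiib_iff.1 h2
      obtain ⟨l'', h4, -, h3⟩ := hD.t9iiib_iff.1 h3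
      obtain rfl : l' = l'' := by omega
      exact (atMostOne_blk hC hc rfl).2 (hr _ rfl) ⟨b₁, b₂, h1, h2, h3⟩
    · rintro ⟨b₁, b₂, h1, h2, h3⟩
      obtain ⟨l', rfl, h2'⟩ := hD.t9ivb_iff.1 h2
      obtain ⟨l'', h4, h3⟩ := hD.t9ivb_iff.1 h3
      obtain rfl : l' = l'' := by omega
      exact (atMostOne_blk hC (c := .infty l' true) trivial rfl).2 (hr _ rfl)
        ⟨b₁, b₂, h1, h2', h3⟩

lemma equiv9_blk {c c' : Code F} (hc : c.Valid) (h : c.Equiv c') :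
    Equiv9 (starRingEnd F) (D.blk c) (D.blk c') := by
  rcases h with rfl | ⟨p, l, rfl, rfl⟩
  · exact .inl rfl
  · refine .inr ⟨p, l + 1, hc.1, hc.2.1, l.succ_pos, mt (polyStar_eq_self_iff p).2 hc.2.2, rfl, ?_⟩
    change pairStar9 (starRingEnd F) (star p ^ (l + 1)) = _
    rw [← star_pow]
    rfl

lemma forall₂_equiv9 {L L' : List (Code F)} (hL : ∀ c ∈ L, c.Valid)
    (h : List.Forall₂ Code.Equiv L L') :
    List.Forall₂ (fun c c' => Equiv9 (starRingEnd F) (D.blk c) (D.blk c')) L L' := by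
  induction h with
  | nil => exact .nil
  | cons h _ ih =>
    rw [List.forall_mem_cons] at hL
    exact .cons (equiv9_blk hL.1 h) (ih hL.2)

/-- Existence and uniqueness of the canonical form. -/
theorem IsCanonical.main [CharZero F] (hD : D.IsCanonical uF πF Phi1 πK uK) {n : ℕ}
    (P : Mat F n × Mat F n) (hP : IsHermPair P) :
    (∃ L, Canon9 (starRingEnd F) uF πF Phi1 πK uK L ∧
      PStarCong (starRingEnd F) ⟨n, P⟩ (psum L)) ∧
    ∀ L₁ L₂, Canon9 (starRingEnd F) uF πF Phi1 πK uK L₁ →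
      Canon9 (starRingEnd F) uF πF Phi1 πK uK L₂ →
      PStarCong (starRingEnd F) ⟨n, P⟩ (psum L₁) → PStarCong (starRingEnd F) ⟨n, P⟩ (psum L₂) →
      ∃ L₂', L₁.Perm L₂' ∧ List.Forall₂ (Equiv9 (starRingEnd F)) L₂' L₂ := by
  classical
  constructor
  · obtain ⟨C, hC, h1⟩ := D.exists_codes n P hP
    obtain ⟨C', hC', hr, h2⟩ := D.exists_reduced C hC
    exact ⟨C'.map D.blk, hD.canon9_iff.2 ⟨C', hC', hr, rfl⟩, (pStarCong_iff _ _).2 (h1.trans h2)⟩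
  · intro L₁ L₂ h1 h2 h3 h4
    obtain ⟨C₁, hC₁, hr₁, rfl⟩ := hD.canon9_iff.1 h1
    obtain ⟨C₂, hC₂, hr₂, rfl⟩ := hD.canon9_iff.1 h2
    rw [pStarCong_iff] at h3 h4
    obtain ⟨C, h5, h6⟩ := D.codes_unique hC₁ hC₂ hr₁ hr₂ (h3.symm.trans h4) (hP.cong h4)
    refine ⟨C.map D.blk, h5.map _, ?_⟩
    rw [List.forall₂_map_left_iff, List.forall₂_map_right_iff]
    exact forall₂_equiv9 (fun c hc => hC₁ c (h5.symm.subset hc)) h6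

end CanonData

end Matching

section Realization

lemma exists_starRing {F : Type*} [Field F] (σ : F →+* F) (hσ : ∀ a, σ (σ a) = a) :
    ∃ inst : StarRing F, @starRingEnd F _ inst = σ :=
  ⟨{ star := σ, star_involutive := hσ, star_mul := fun a b => by
      rw [mul_comm a b]; exact map_mul σ b a, star_add := map_add σ }, rfl⟩

variable {F : Type*} [Field F] [StarRing F]

lemma polyNormRep_X {t : F} (h : IsNormRep (starRingEnd F) t) : PolyNormRep (X : F[X]) (C t) := by
  have h1 : ∀ a : F[X], (star a).coeff 0 = starRingEnd F (a.coeff 0) := fun a => polyStar_coeff a 0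
  refine ⟨?_, ?_, ?_, ?_, ?_⟩
  · rw [polyStar_C]
    exact congrArg C h.fixed
  · rw [X_dvd_iff, coeff_C_zero]
    exact h.ne_zero
  · rintro ⟨a, ha⟩
    rw [X_dvd_iff, coeff_sub, mul_coeff_zero, coeff_C_zero, h1, sub_eq_zero] at ha
    exact h.not_norm ⟨_, ha⟩
  · intro c hc hX
    obtain ⟨a, ha⟩ := h.class_eq (c.coeff 0) (by rw [← h1, hc]) (mt X_dvd_iff.2 hX)
    refine ⟨C a, ?_⟩
    simp only [X_dvd_iff, coeff_sub, mul_coeff_zero, coeff_C_zero, h1, coeff_one_zero, sub_eq_zero]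
    exact ha
  · obtain ⟨a, b, hab⟩ := h.sum_norm
    refine ⟨C a, C b, ?_⟩
    simp only [X_dvd_iff, coeff_sub, coeff_add, mul_coeff_zero, coeff_C_zero, h1, sub_eq_zero]
    exact hab

lemma polyNormRep_of_adjoinRoot {p : F[X]} [Fact (Irreducible p)]
    {τ : AdjoinRoot p →+* AdjoinRoot p} (hτ : ∀ g, τ (AdjoinRoot.mk p g) = AdjoinRoot.mk p (star g))
    {f : F[X]} (hf : star f = f) (h : IsNormRep τ (AdjoinRoot.mk p f)) : PolyNormRep p f := by
  have h0 : ∀ {g}, p ∣ g ↔ AdjoinRoot.mk p g = 0 := AdjoinRoot.mk_eq_zero.symm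
  refine ⟨hf, mt h0.1 h.ne_zero, ?_, ?_, ?_⟩
  · rintro ⟨a, ha⟩
    rw [h0, map_sub, map_mul, ← hτ, sub_eq_zero] at ha
    exact h.not_norm ⟨_, ha⟩
  · intro c hc hp
    obtain ⟨a, ha⟩ := h.class_eq (AdjoinRoot.mk p c) (by rw [hτ, hc]) (mt h0.2 hp)
    obtain ⟨a, rfl⟩ := AdjoinRoot.mk_surjective a
    refine ⟨a, ?_⟩
    simp only [h0, map_sub, map_mul, map_one, ← hτ, sub_eq_zero]
    exact ha
  · obtain ⟨a, b, hab⟩ := h.sum_norm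
    obtain ⟨a, rfl⟩ := AdjoinRoot.mk_surjective a
    obtain ⟨b, rfl⟩ := AdjoinRoot.mk_surjective b
    refine ⟨a, b, ?_⟩
    simp only [h0, map_sub, map_add, map_mul, ← hτ, sub_eq_zero]
    exact hab

lemma map_adjoinRoot_mk {p : F[X]} {τ : AdjoinRoot p →+* AdjoinRoot p}
    (h1 : ∀ a : F, τ (algebraMap F (AdjoinRoot p) a) = algebraMap F (AdjoinRoot p) (starRingEnd F a))
    (h2 : τ (AdjoinRoot.root p) = AdjoinRoot.root p) (g : F[X]) :
    τ (AdjoinRoot.mk p g) = AdjoinRoot.mk p (star g) := by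
  induction g using Polynomial.induction_on' with
  | add f g hf hg => rw [map_add, map_add, star_add, map_add, hf, hg]
  | monomial n a =>
    rw [← C_mul_X_pow_eq_monomial, star_mul', star_pow, polyStar_C, polyStar_X, map_mul, map_pow,
      map_mul, map_pow, map_mul, map_pow, AdjoinRoot.mk_X, h2, AdjoinRoot.mk_C, AdjoinRoot.mk_C]
    congr 1
    exact h1 a

/-- Elements of the fixed field of `F[X] / (p)` are represented by fixed polynomials. -/
lemma exists_fixed_rep {p : F[X]} (hm : p.Monic)
    {τ : AdjoinRoot p →+* AdjoinRoot p} (hτ : ∀ g, τ (AdjoinRoot.mk p g) = AdjoinRoot.mk p (star g))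
    {t : AdjoinRoot p} (ht : τ t = t) :
    ∃ f : F[X], f.degree < p.degree ∧ star f = f ∧ AdjoinRoot.mk p f = t := by
  obtain ⟨g, rfl⟩ := AdjoinRoot.mk_surjective t
  have h1 : AdjoinRoot.mk p (g %ₘ p) = AdjoinRoot.mk p g := by
    rw [AdjoinRoot.mk_eq_mk, modByMonic_eq_sub_mul_div, sub_sub_cancel_left, dvd_neg]
    exact dvd_mul_right _ _
  have h2 : (g %ₘ p).degree < p.degree := degree_modByMonic_lt _ hm
  refine ⟨g %ₘ p, h2, ?_, h1⟩
  rw [← h1, hτ, AdjoinRoot.mk_eq_mk] at ht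
  rw [← sub_eq_zero]
  refine eq_zero_of_dvd_of_degree_lt ht ((degree_sub_le _ _).trans_lt (max_lt ?_ h2))
  exact degree_map_le.trans_lt h2

lemma exists_rep (p : ℕ) [Fact p.Prime] (hp : p ≠ 2) [Algebra ℚ_[p] F] [FiniteDimensional ℚ_[p] F]
    (hne : ∃ a : F, star a ≠ a) {ν : F → ℚ} (hν : IsExpValuation p F ν) {pp : F[X]}
    (hm : pp.Monic) (hi : Irreducible pp)
    {τ : AdjoinRoot pp →+* AdjoinRoot pp}
    (hτ : (∀ a : F, τ (algebraMap F (AdjoinRoot pp) a) =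
        algebraMap F (AdjoinRoot pp) (starRingEnd F a)) ∧
      τ (AdjoinRoot.root pp) = AdjoinRoot.root pp ∧ ∀ z, τ (τ z) = z)
    {νK : AdjoinRoot pp → ℚ}
    (hνK : (∀ a b : AdjoinRoot pp, a ≠ 0 → b ≠ 0 → νK (a * b) = νK a + νK b) ∧
      (∀ a b : AdjoinRoot pp, a ≠ 0 → b ≠ 0 → a + b ≠ 0 → min (νK a) (νK b) ≤ νK (a + b)) ∧
      ∀ a : F, a ≠ 0 → νK (algebraMap F (AdjoinRoot pp) a) = ν a)
    {πK uK : AdjoinRoot pp}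
    (hπK : τ πK = πK ∧ πK ≠ 0 ∧ 0 < νK πK ∧ ∀ z, τ z = z → z ≠ 0 → 0 < νK z → νK πK ≤ νK z)
    (huK : τ uK = uK ∧ uK ≠ 0 ∧ νK uK = 0 ∧ ¬ ∃ w, τ w = w ∧ w ^ 2 = uK) :
    ∃ f : F[X], f.degree < pp.degree ∧ RepCond uK πK (AdjoinRoot.mk pp f) ∧
      (∀ t, RepCond uK πK t → t = AdjoinRoot.mk pp f) ∧ PolyNormRep pp f := by
  have : Fact (Irreducible pp) := ⟨hi⟩
  have h1 := map_adjoinRoot_mk hτ.1 hτ.2.1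
  have := hm.finite_adjoinRoot
  have : FiniteDimensional ℚ_[p] (AdjoinRoot pp) := Module.Finite.trans F _
  have hinj : Function.Injective (algebraMap F (AdjoinRoot pp)) := (algebraMap F _).injective
  have h2 : IsExpValuation p (AdjoinRoot pp) νK := by
    refine ⟨hνK.1, hνK.2.1, fun x hx => ?_⟩
    rw [IsScalarTower.algebraMap_apply ℚ_[p] F, hνK.2.2 _ ?_, hν.2.2 x hx]
    rwa [ne_eq, map_eq_zero]
  have h3 : ∃ a, τ a ≠ a := by
    obtain ⟨a, ha⟩ := hne
    exact ⟨algebraMap F _ a, fun h => ha (hinj ((hτ.1 a).symm.trans h))⟩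
  obtain ⟨t, ht, ht', hN⟩ := exists_repCond_of_isExpValuation hp h2 hτ.2.2 h3 huK hπK
  obtain ⟨f, hf, hfs, rfl⟩ := exists_fixed_rep hm h1 hN.fixed
  exact ⟨f, hf, ht, ht', polyNormRep_of_adjoinRoot h1 hfs hN⟩

end Realization

section Stmt9
variable {F : Type*} [Field F] (σ : F →+* F)

theorem stmt9 (p : ℕ) [Fact p.Prime] (hp : p ≠ 2)
    (F : Type*) [Field F] [Algebra ℚ_[p] F] [FiniteDimensional ℚ_[p] F]
    (σ : F →+* F) (hσinv : ∀ a, σ (σ a) = a) (hσ : σ ≠ RingHom.id F)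
    (ν : F → ℚ) (hν : IsExpValuation p F ν)
    -- u : a unit of the ring of integers of the fixed field F∘ that is not a square in F∘
    (uF : F) (huF : σ uF = uF ∧ uF ≠ 0 ∧ ν uF = 0 ∧ ¬ ∃ w : F, σ w = w ∧ w ^ 2 = uF)
    -- π : a prime element of F∘
    (πF : F) (hπF : σ πF = πF ∧ πF ≠ 0 ∧ 0 < ν πF ∧
      ∀ a : F, σ a = a → a ≠ 0 → 0 < ν a → ν πF ≤ ν a)
    -- a fixed choice of Φ₁
    (Phi1 : (q : Polynomial F) → Mat F q.natDegree)
    (hPhi1 : ∀ (pp : Polynomial F) (l : ℕ), pp.Monic → Irreducible pp → 0 < l →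
      (∀ k : ℕ, σ (pp.coeff k) = pp.coeff k) →
      IsUnit (Phi1 (pp ^ l)).det ∧ ctr σ (Phi1 (pp ^ l)) = Phi1 (pp ^ l) ∧
        ctr σ (Phi1 (pp ^ l) * companion F (pp ^ l)) = Phi1 (pp ^ l) * companion F (pp ^ l))
    -- the involution f(ω)° := f̄(ω) on K = F[x]/(p_Φ)
    (τ : (pp : Polynomial F) → AdjoinRoot pp ≃+* AdjoinRoot pp)
    (hτ : ∀ pp : Polynomial F, pp.Monic → Irreducible pp →
      (∀ k : ℕ, σ (pp.coeff k) = pp.coeff k) →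
      (∀ a : F, τ pp (algebraMap F (AdjoinRoot pp) a) = algebraMap F (AdjoinRoot pp) (σ a)) ∧
      (τ pp (AdjoinRoot.root pp) = AdjoinRoot.root pp) ∧
      (∀ z, τ pp (τ pp z) = z))
    -- the (unique) extension of the valuation to K = F[x]/(p_Φ)
    (νK : (pp : Polynomial F) → AdjoinRoot pp → ℚ)
    (hνK : ∀ pp : Polynomial F, pp.Monic → Irreducible pp →
      (∀ k : ℕ, σ (pp.coeff k) = pp.coeff k) →
      (∀ a b : AdjoinRoot pp, a ≠ 0 → b ≠ 0 → νK pp (a * b) = νK pp a + νK pp b) ∧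
      (∀ a b : AdjoinRoot pp, a ≠ 0 → b ≠ 0 → a + b ≠ 0 →
        min (νK pp a) (νK pp b) ≤ νK pp (a + b)) ∧
      (∀ a : F, a ≠ 0 → νK pp (algebraMap F (AdjoinRoot pp) a) = ν a))
    -- π̃ : a fixed prime element of the fixed field K∘, and
    -- ũ : a fixed unit of the ring of integers of K∘ that is not a square in K∘
    (πK uK : (pp : Polynomial F) → AdjoinRoot pp)
    (hπK : ∀ pp : Polynomial F, pp.Monic → Irreducible pp →
      (∀ k : ℕ, σ (pp.coeff k) = pp.coeff k) →
      τ pp (πK pp) = πK pp ∧ πK pp ≠ 0 ∧ 0 < νK pp (πK pp) ∧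
      ∀ z : AdjoinRoot pp, τ pp z = z → z ≠ 0 → 0 < νK pp z → νK pp (πK pp) ≤ νK pp z)
    (huK : ∀ pp : Polynomial F, pp.Monic → Irreducible pp →
      (∀ k : ℕ, σ (pp.coeff k) = pp.coeff k) →
      τ pp (uK pp) = uK pp ∧ uK pp ≠ 0 ∧ νK pp (uK pp) = 0 ∧
      ¬ ∃ w : AdjoinRoot pp, τ pp w = w ∧ w ^ 2 = uK pp)
    (n : ℕ) (A B : Mat F n) (hA : ctr σ A = A) (hB : ctr σ B = B) :
    (∃ L : List (PBlock F), Canon9 σ uF πF Phi1 πK uK L ∧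
      PStarCong σ ⟨n, (A, B)⟩ (psum L)) ∧
    (∀ L₁ L₂ : List (PBlock F), Canon9 σ uF πF Phi1 πK uK L₁ → Canon9 σ uF πF Phi1 πK uK L₂ →
      PStarCong σ ⟨n, (A, B)⟩ (psum L₁) → PStarCong σ ⟨n, (A, B)⟩ (psum L₂) →
      ∃ L₂' : List (PBlock F), L₁.Perm L₂' ∧ List.Forall₂ (Equiv9 σ) L₂' L₂) := by
  have : CharZero F := charZero_of_injective_algebraMap (algebraMap ℚ_[p] F).injective
  obtain ⟨inst, rfl⟩ := exists_starRing σ hσinv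
  have hne : ∃ a : F, star a ≠ a := by
    by_contra! h
    exact hσ (RingHom.ext h)
  obtain ⟨t, ht, ht', hN⟩ := exists_repCond_of_isExpValuation hp hν hσinv hne huF hπF
  have hrep : ∀ pp : F[X], pp.Monic → Irreducible pp → star pp = pp → ∃ f : F[X],
      f.degree < pp.degree ∧ RepCond (uK pp) (πK pp) (AdjoinRoot.mk pp f) ∧
        (∀ t, RepCond (uK pp) (πK pp) t → t = AdjoinRoot.mk pp f) ∧ PolyNormRep pp f := by
    intro pp hm hi hs
    have hs' := (polyStar_eq_self_iff pp).1 hs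
    exact exists_rep p hp hne hν hm hi (τ := (τ pp : AdjoinRoot pp →+* AdjoinRoot pp))
      (hτ pp hm hi hs') (hνK pp hm hi hs') (hπK pp hm hi hs') (huK pp hm hi hs')
  choose! rep h1 h2 h3 h4 using hrep
  have hPhi : ∀ (pp : F[X]) (l : ℕ), pp.Monic → Irreducible pp → star pp = pp → _ :=
    fun pp l hm hi hs => hPhi1 pp (l + 1) hm hi l.succ_pos ((polyStar_eq_self_iff pp).1 hs)
  let D : CanonData F :=
    { phi := Phi1
      rep := rep
      unit := t
      exists_star_ne := hne
      isUnit_det_phi := fun pp l hm hi hs => (hPhi pp l hm hi hs).1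
      phi_herm := fun pp l hm hi hs => (hPhi pp l hm hi hs).2.1
      phi_mul_herm := fun pp l hm hi hs => (hPhi pp l hm hi hs).2.2
      isNormRep_rep := h4
      isNormRep_unit := polyNormRep_X hN }
  have hD : D.IsCanonical uF πF Phi1 πK uK := ⟨rfl, ht, ht', h1, h2, h3⟩
  exact hD.main (A, B) ⟨hA, hB⟩

end Stmt9

end
end Can
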